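/- arXiv:1201.0886 — 13 statements merged into one kernel-verified Lean document; each statement's English description precedes it below -/
import Mathlib

section
/- There exist T > 0 and a curve γ : [0,T] → ℂ with the following properties: γ is continuous and injective, γ(0) = 0, Im γ(s) > 0 for all s ∈ (0,T], γ is continuously differentiable on (0,T], and for every t ∈ (0,T]: (i) for every z with Im z > 0 and z ∉ γ((0,t]) there exists a function f_z : [0,t] → ℂ with f_z(0) = z, Im f_z(s) > 0 for all s ∈ [0,t], and f_z'(s) = 2/(f_z(s) - s^(1/3)) for all s ∈ [0,t]; (ii) the map z ↦ f_z(t) is a holomorphic bijection from {z : Im z > 0} \ γ((0,t]) onto the open upper half-plane {w : Im w > 0}. -/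
open Set Complex
open Filter Topology

/-- A differential Grönwall inequality using only the radial part of the derivative. -/
lemma norm_le_of_re_conj_mul_deriv_le {Z Z' : ℝ → ℂ} {a b L K : ℝ} (hab : a ≤ b) (hL : 0 ≤ L)
    (hK : 0 ≤ K) (hZ : ContinuousOn Z (Icc a b)) (hZ' : ∀ x ∈ Ioo a b, HasDerivAt Z (Z' x) x)
    (h : ∀ x ∈ Ioo a b, ((starRingEnd ℂ) (Z x) * Z' x).re ≤ L * ‖Z x‖ ^ 2 + K * ‖Z x‖) :
    ‖Z b‖ ≤ Real.exp (L * (b - a)) * (‖Z a‖ + K * (b - a)) := by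
  have key : ∀ k > 0, √(‖Z b‖ ^ 2 + k ^ 2) ≤
      Real.exp (L * (b - a)) * (√(‖Z a‖ ^ 2 + k ^ 2) + K * (b - a)) := by
    intro k hk
    set N : ℝ → ℝ := fun x => √(‖Z x‖ ^ 2 + k ^ 2) with hN
    have hNpos : ∀ x, 0 < N x := fun x => Real.sqrt_pos.2 (by positivity)
    have hNge : ∀ x, ‖Z x‖ ≤ N x := fun x => Real.le_sqrt_of_sq_le (by nlinarith)
    have hNd : ∀ x ∈ Ioo a b,
        HasDerivAt N (((starRingEnd ℂ) (Z x) * Z' x).re / N x) x := by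
      intro x hx
      have h1 := ((hZ' x hx).norm_sq.add_const (k ^ 2)).sqrt (by positivity)
      refine h1.congr_deriv ?_
      rw [Complex.inner, mul_div_mul_left _ _ two_ne_zero]
      simp only [hN, mul_re, conj_re, conj_im]
      ring
    have hanti : AntitoneOn (fun x => Real.exp (-(L * (x - a))) * N x - K * (x - a))
        (Icc a b) := by
      refine antitoneOn_of_hasDerivWithinAt_nonpos (convex_Icc a b)
        (f' := fun x => Real.exp (-(L * (x - a))) * (-L) * N x +
          Real.exp (-(L * (x - a))) * (((starRingEnd ℂ) (Z x) * Z' x).re / N x) - K) ?_ ?_ ?_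
      · refine ContinuousOn.sub (ContinuousOn.mul (by fun_prop) ?_) (by fun_prop)
        exact ((hZ.norm.pow 2).add continuousOn_const).sqrt
      · rw [interior_Icc]
        intro x hx
        have h1 : HasDerivAt (fun x => Real.exp (-(L * (x - a))))
            (Real.exp (-(L * (x - a))) * (-L)) x := by
          have : HasDerivAt (fun x : ℝ => -(L * (x - a))) (-L) x := by
            simpa using (((hasDerivAt_id x).sub_const a).const_mul L).fun_neg
          exact this.exp
        have h2 : HasDerivAt (fun x : ℝ => K * (x - a)) K x := by
          simpa using (((hasDerivAt_id x).sub_const a).const_mul K)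
        exact ((h1.mul (hNd x hx)).sub h2).hasDerivWithinAt
      · rw [interior_Icc]
        intro x hx
        have hxa : 0 ≤ L * (x - a) := mul_nonneg hL (by linarith [hx.1])
        have he : Real.exp (-(L * (x - a))) ≤ 1 := Real.exp_le_one_iff.2 (by linarith)
        have he0 := Real.exp_pos (-(L * (x - a)))
        have h3 : ((starRingEnd ℂ) (Z x) * Z' x).re / N x ≤ L * N x + K := by
          rw [div_le_iff₀ (hNpos x)]
          have := h x hx
          have := hNge x
          have := norm_nonneg (Z x)
          have := hNpos x
          have : L * ‖Z x‖ ^ 2 ≤ L * (N x) ^ 2 := by gcongr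
          have : K * ‖Z x‖ ≤ K * N x := by gcongr
          nlinarith
        have h4 := mul_le_mul_of_nonneg_left h3 he0.le
        nlinarith
    have := hanti (left_mem_Icc.2 hab) (right_mem_Icc.2 hab) hab
    simp only [sub_self, mul_zero, neg_zero, Real.exp_zero, one_mul, sub_zero] at this
    have h5 : N b = Real.exp (L * (b - a)) * (Real.exp (-(L * (b - a))) * N b) := by
      rw [← mul_assoc, ← Real.exp_add]; simp
    change N b ≤ Real.exp (L * (b - a)) * (N a + K * (b - a))
    rw [h5]
    gcongr
    linarith
  have hlim : Tendsto (fun k : ℝ => Real.exp (L * (b - a)) * (√(‖Z a‖ ^ 2 + k ^ 2) + K * (b - a)))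
      (𝓝[>] 0) (𝓝 (Real.exp (L * (b - a)) * (‖Z a‖ + K * (b - a)))) := by
    have : Continuous (fun k : ℝ =>
      Real.exp (L * (b - a)) * (√(‖Z a‖ ^ 2 + k ^ 2) + K * (b - a))) := by fun_prop
    have h0 := this.tendsto 0
    simp only [ne_eq, OfNat.ofNat_ne_zero, not_false_eq_true, zero_pow, add_zero,
      Real.sqrt_sq (norm_nonneg _)] at h0
    exact h0.mono_left nhdsWithin_le_nhds
  refine ge_of_tendsto hlim ?_
  filter_upwards [self_mem_nhdsWithin] with k hk
  exact (Real.le_sqrt_of_sq_le (by nlinarith)).trans (key k hk)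

/-- `g` solves the Löwner equation `g' = c / (g - ξ)` in the upper half-plane on `[a, b]`. -/
structure IsLoewnerOn (c : ℝ) (ξ : ℝ → ℝ) (g : ℝ → ℂ) (a b : ℝ) : Prop where
  continuousOn : ContinuousOn g (Icc a b)
  hasDerivAt : ∀ x ∈ Ioo a b, HasDerivAt g (c / (g x - ξ x)) x
  im_pos : ∀ x ∈ Icc a b, 0 < (g x).im

lemma sub_ofReal_ne_zero {z : ℂ} (hz : 0 < z.im) (x : ℝ) : z - x ≠ 0 := by
  intro h
  have := congrArg Complex.im h
  simp at this
  exact hz.ne' this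

lemma im_le_norm_sub (z : ℂ) (x : ℝ) : z.im ≤ ‖z - x‖ := by
  have := (le_abs_self _).trans (Complex.abs_im_le_norm (z - x))
  simpa using this

namespace IsLoewnerOn

variable {c : ℝ} {ξ : ℝ → ℝ} {g : ℝ → ℂ} {a b : ℝ}

lemma mono (h : IsLoewnerOn c ξ g a b) {a' b' : ℝ} (ha : a ≤ a') (hb : b' ≤ b) :
    IsLoewnerOn c ξ g a' b' :=
  ⟨h.continuousOn.mono (Icc_subset_Icc ha hb), fun x hx => h.hasDerivAt x (Ioo_subset_Ioo ha hb hx),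
    fun x hx => h.im_pos x (Icc_subset_Icc ha hb hx)⟩

lemma reflect (h : IsLoewnerOn c ξ g a b) (d : ℝ) :
    IsLoewnerOn (-c) (fun x => ξ (d - x)) (fun x => g (d - x)) (d - b) (d - a) := by
  refine ⟨?_, ?_, ?_⟩
  · exact h.continuousOn.comp (by fun_prop) fun x hx => ⟨by linarith [hx.2], by linarith [hx.1]⟩
  · intro x hx
    have h1 := h.hasDerivAt (d - x) ⟨by linarith [hx.2], by linarith [hx.1]⟩
    have := h1.scomp x ((hasDerivAt_id x).const_sub d)
    refine this.congr_deriv ?_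
    simp [neg_div]
  · exact fun x hx => h.im_pos _ ⟨by linarith [hx.2], by linarith [hx.1]⟩

/-- The solution stays a positive distance away from the real line. -/
lemma exists_le_im (h : IsLoewnerOn c ξ g a b) : ∃ δ > 0, ∀ x ∈ Icc a b, δ ≤ (g x).im := by
  rcases (Icc a b).eq_empty_or_nonempty with he | hne
  · exact ⟨1, one_pos, by simp [he]⟩
  · obtain ⟨x, hx, hmin⟩ := isCompact_Icc.exists_isMinOn hne
      (f := fun x => (g x).im) (Complex.continuous_im.comp_continuousOn h.continuousOn)
    exact ⟨_, h.im_pos x hx, fun y hy => hmin hy⟩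

/-- Two solutions with lower bounds on the imaginary parts diverge at most exponentially. -/
lemma norm_sub_le {g₁ g₂ : ℝ → ℂ} (h₁ : IsLoewnerOn c ξ g₁ a b) (h₂ : IsLoewnerOn c ξ g₂ a b)
    (hab : a ≤ b) {δ : ℝ} (hδ : 0 < δ) (hd₁ : ∀ x ∈ Icc a b, δ ≤ (g₁ x).im)
    (hd₂ : ∀ x ∈ Icc a b, δ ≤ (g₂ x).im) :
    ‖g₂ b - g₁ b‖ ≤ Real.exp (|c| / δ ^ 2 * (b - a)) * ‖g₂ a - g₁ a‖ := by
  have := norm_le_of_re_conj_mul_deriv_le (Z := fun x => g₂ x - g₁ x) (L := |c| / δ ^ 2) (K := 0)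
    hab (by positivity) le_rfl (h₂.continuousOn.sub h₁.continuousOn)
    (fun x hx => (h₂.hasDerivAt x hx).sub (h₁.hasDerivAt x hx)) ?_
  · simpa using this
  · intro x hx
    have hx' := Ioo_subset_Icc_self hx
    have n1 := sub_ofReal_ne_zero (h₁.im_pos x hx') (ξ x)
    have n2 := sub_ofReal_ne_zero (h₂.im_pos x hx') (ξ x)
    have e : (c : ℂ) / (g₂ x - ξ x) - c / (g₁ x - ξ x) =
        -(c * (g₂ x - g₁ x) / ((g₂ x - ξ x) * (g₁ x - ξ x))) := by
      field_simp; ring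
    rw [e]
    refine (Complex.re_le_norm _).trans ?_
    have b1 := (hd₁ x hx').trans (im_le_norm_sub _ (ξ x))
    have b2 := (hd₂ x hx').trans (im_le_norm_sub _ (ξ x))
    simp only [norm_mul, norm_neg, norm_div, RCLike.norm_conj, Complex.norm_real, Real.norm_eq_abs]
    have : δ ^ 2 ≤ ‖g₂ x - ξ x‖ * ‖g₁ x - ξ x‖ := by nlinarith
    calc ‖g₂ x - g₁ x‖ * (|c| * ‖g₂ x - g₁ x‖ / (‖g₂ x - ξ x‖ * ‖g₁ x - ξ x‖))
        ≤ ‖g₂ x - g₁ x‖ * (|c| * ‖g₂ x - g₁ x‖ / δ ^ 2) := by gcongr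
      _ = _ := by ring

lemma eqOn {g₁ g₂ : ℝ → ℂ} (h₁ : IsLoewnerOn c ξ g₁ a b) (h₂ : IsLoewnerOn c ξ g₂ a b)
    (he : g₁ a = g₂ a) : EqOn g₁ g₂ (Icc a b) := by
  intro x hx
  obtain ⟨δ₁, h1, hd1⟩ := h₁.exists_le_im
  obtain ⟨δ₂, h2, hd2⟩ := h₂.exists_le_im
  have := norm_sub_le (h₁.mono le_rfl hx.2) (h₂.mono le_rfl hx.2) hx.1 (lt_min h1 h2)
    (fun y hy => (min_le_left _ _).trans (hd1 y (Icc_subset_Icc le_rfl hx.2 hy)))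
    (fun y hy => (min_le_right _ _).trans (hd2 y (Icc_subset_Icc le_rfl hx.2 hy)))
  rw [he, sub_self, norm_zero, mul_zero] at this
  exact (sub_eq_zero.1 (norm_le_zero_iff.1 this)).symm

end IsLoewnerOn

/-- The Löwner vector field, made Lipschitz by truncating imaginary parts at height `δ`. -/
noncomputable def truncatedField (c δ : ℝ) (ξ : ℝ → ℝ) (r : ℝ) (z : ℂ) : ℂ :=
  c / (⟨z.re - ξ r, max z.im δ⟩ : ℂ)

section truncated

variable {c δ : ℝ} {ξ : ℝ → ℝ}

lemma truncatedField_of_le (r : ℝ) {z : ℂ} (hz : δ ≤ z.im) :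
    truncatedField c δ ξ r z = c / (z - ξ r) := by
  unfold truncatedField
  congr 1
  apply Complex.ext <;> simp [max_eq_left hz]

lemma le_norm_mk_max (x y δ : ℝ) : δ ≤ ‖(⟨x, max y δ⟩ : ℂ)‖ :=
  (le_max_right y δ).trans ((le_abs_self _).trans (Complex.abs_im_le_norm ⟨x, max y δ⟩))

lemma norm_truncatedField_sub_le (hδ : 0 < δ) (r : ℝ) (z w : ℂ) :
    ‖truncatedField c δ ξ r z - truncatedField c δ ξ r w‖ ≤ |c| / δ ^ 2 * ‖z - w‖ := by
  have hz := le_norm_mk_max (z.re - ξ r) z.im δ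
  have hw := le_norm_mk_max (w.re - ξ r) w.im δ
  unfold truncatedField
  set A : ℂ := ⟨z.re - ξ r, max z.im δ⟩ with hA
  set B : ℂ := ⟨w.re - ξ r, max w.im δ⟩ with hB
  have nA : A ≠ 0 := norm_pos_iff.1 (hδ.trans_le hz)
  have nB : B ≠ 0 := norm_pos_iff.1 (hδ.trans_le hw)
  have hBA : ‖B - A‖ ≤ ‖z - w‖ := by
    rw [← sq_le_sq₀ (norm_nonneg _) (norm_nonneg _), ← Complex.normSq_eq_norm_sq,
      ← Complex.normSq_eq_norm_sq, Complex.normSq_apply, Complex.normSq_apply]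
    have := abs_max_sub_max_le_abs w.im z.im δ
    have := sq_le_sq.2 this
    simp only [hA, hB, sub_re, sub_im]
    nlinarith
  have e : (c : ℂ) / A - c / B = c * (B - A) / (A * B) := by field_simp
  rw [e, norm_div, norm_mul, norm_mul, Complex.norm_real, Real.norm_eq_abs]
  have : δ ^ 2 ≤ ‖A‖ * ‖B‖ := by nlinarith
  calc |c| * ‖B - A‖ / (‖A‖ * ‖B‖) ≤ |c| * ‖z - w‖ / δ ^ 2 := by gcongr
    _ = _ := by ring

lemma exists_truncated_solution (c : ℝ) (hδ : 0 < δ) (hξ : Continuous ξ) {b : ℝ} (hb : 0 ≤ b)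
    (w : ℂ) : ∃ g : ℝ → ℂ, g 0 = w ∧
      ∀ x ∈ Icc 0 b, HasDerivWithinAt g (truncatedField c δ ξ x (g x)) (Icc 0 b) x := by
  have hP : IsPicardLindelof (truncatedField c δ ξ) (⟨0, left_mem_Icc.2 hb⟩ : Icc 0 b) w
      (Real.toNNReal (|c| / δ * b)) 0 (Real.toNNReal (|c| / δ)) (Real.toNNReal (|c| / δ ^ 2)) := by
    refine ⟨fun t _ => ?_, fun x _ => ?_, fun t _ x _ => ?_, ?_⟩
    · refine (LipschitzWith.of_dist_le_mul fun z z' => ?_).lipschitzOnWith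
      rw [dist_eq_norm, dist_eq_norm, Real.coe_toNNReal _ (by positivity)]
      exact norm_truncatedField_sub_le hδ t z z'
    · refine Continuous.continuousOn ?_
      unfold truncatedField
      refine continuous_const.div ?_ fun t =>
        norm_pos_iff.1 (hδ.trans_le (le_norm_mk_max (x.re - ξ t) x.im δ))
      have : (fun t => (⟨x.re - ξ t, max x.im δ⟩ : ℂ)) =
          fun t => ((x.re - ξ t : ℝ) : ℂ) + (max x.im δ : ℝ) * I := by
        ext t; exact Complex.mk_eq_add_mul_I _ _
      rw [this]
      fun_prop
    · rw [Real.coe_toNNReal _ (by positivity)]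
      unfold truncatedField
      rw [norm_div, Complex.norm_real, Real.norm_eq_abs]
      gcongr
      exact le_norm_mk_max _ _ _
    · rw [Real.coe_toNNReal _ (by positivity), Real.coe_toNNReal _ (by positivity)]
      simp [max_eq_left hb]
  exact hP.exists_eq_forall_mem_Icc_hasDerivWithinAt₀

lemma isLoewnerOn_of_truncated {g : ℝ → ℂ} {b d : ℝ} (hδ : 0 < δ) (hdb : d ≤ b)
    (hg : ∀ x ∈ Icc 0 b, HasDerivWithinAt g (truncatedField c δ ξ x (g x)) (Icc 0 b) x)
    (him : ∀ x ∈ Icc 0 d, δ ≤ (g x).im) : IsLoewnerOn c ξ g 0 d := by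
  have hs : Icc 0 d ⊆ Icc 0 b := Icc_subset_Icc le_rfl hdb
  refine ⟨fun x hx => ((hg x (hs hx)).continuousWithinAt).mono hs, fun x hx => ?_,
    fun x hx => hδ.trans_le (him x hx)⟩
  have hx' := Ioo_subset_Icc_self hx
  have := (hg x (hs hx')).hasDerivAt (Icc_mem_nhds hx.1 (hx.2.trans_le hdb))
  rwa [truncatedField_of_le x (him x hx')] at this

lemma im_truncatedField (r : ℝ) (z : ℂ) : (truncatedField c δ ξ r z).im =
    -(c * max z.im δ / Complex.normSq ⟨z.re - ξ r, max z.im δ⟩) := by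
  unfold truncatedField
  rw [div_im]
  simp

end truncated

lemma HasDerivAt.complex_re {f : ℝ → ℂ} {f' : ℂ} {x : ℝ} (h : HasDerivAt f f' x) :
    HasDerivAt (fun y => (f y).re) f'.re x :=
  Complex.reCLM.hasFDerivAt.comp_hasDerivAt x h

lemma HasDerivAt.complex_im {f : ℝ → ℂ} {f' : ℂ} {x : ℝ} (h : HasDerivAt f f' x) :
    HasDerivAt (fun y => (f y).im) f'.im x :=
  Complex.imCLM.hasFDerivAt.comp_hasDerivAt x h

/-- A barrier principle: a function which starts below zero and decreases whenever it vanishes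
cannot become positive. -/
lemma nonpos_of_deriv_neg_of_eq_zero {f f' : ℝ → ℝ} {a b : ℝ} (hab : a ≤ b)
    (hf : ContinuousOn f (Icc a b)) (hd : ∀ x ∈ Ioo a b, HasDerivAt f (f' x) x) (ha : f a < 0)
    (h : ∀ x ∈ Ioo a b, f x = 0 → f' x < 0) : f b ≤ 0 := by
  rcases hab.eq_or_lt with rfl | hab
  · exact ha.le
  have h1 : ∀ᶠ x in 𝓝[Icc a b] a, f x < 0 :=
    (hf a (left_mem_Icc.2 hab.le)).eventually_lt_const ha
  rw [nhdsWithin_Icc_eq_nhdsGE hab] at h1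
  have h2 : ∀ᶠ x in 𝓝[>] a, f x < 0 := h1.filter_mono (nhdsWithin_mono _ Ioi_subset_Ici_self)
  obtain ⟨c, hc, hcab⟩ := (h2.and (Ioo_mem_nhdsGT hab)).exists
  have := image_le_of_deriv_right_lt_deriv_boundary' (f := f) (f' := f') (a := c) (b := b)
    (B := fun _ => 0) (B' := fun _ => 0)
    (hf.mono (Icc_subset_Icc hcab.1.le le_rfl))
    (fun x hx => (hd x ⟨hcab.1.trans_le hx.1, hx.2⟩).hasDerivWithinAt) hc.le continuousOn_const
    (fun x _ => hasDerivWithinAt_const _ _ _)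
    (fun x hx h0 => h x ⟨hcab.1.trans_le hx.1, hx.2⟩ h0)
  exact this (right_mem_Icc.2 hcab.2.le)

lemma sub_le_mul_sub_of_hasDerivAt_le {f f' : ℝ → ℝ} {a b C : ℝ} (hab : a ≤ b)
    (hf : ContinuousOn f (Icc a b)) (hd : ∀ x ∈ Ioo a b, HasDerivAt f (f' x) x)
    (h : ∀ x ∈ Ioo a b, f' x ≤ C) : f b - f a ≤ C * (b - a) := by
  refine (convex_Icc a b).image_sub_le_mul_sub_of_deriv_le hf ?_ ?_ a (left_mem_Icc.2 hab) b
    (right_mem_Icc.2 hab) hab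
  · rw [interior_Icc]; exact fun x hx => (hd x hx).differentiableAt.differentiableWithinAt
  · rw [interior_Icc]; exact fun x hx => (hd x hx).deriv ▸ h x hx

lemma div_sub_ofReal_re (c : ℝ) (z : ℂ) (x : ℝ) :
    ((c : ℂ) / (z - x)).re = c * (z.re - x) / ((z.re - x) ^ 2 + z.im ^ 2) := by
  rw [div_re, Complex.normSq_apply]; simp; ring

lemma div_sub_ofReal_im (c : ℝ) (z : ℂ) (x : ℝ) :
    ((c : ℂ) / (z - x)).im = -(c * z.im / ((z.re - x) ^ 2 + z.im ^ 2)) := by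
  rw [div_im, Complex.normSq_apply]; simp; ring

namespace IsLoewnerOn

variable {ξ : ℝ → ℝ} {P : ℝ → ℂ} {a b : ℝ}

lemma hasDerivAt_im_sq {c : ℝ} (h : IsLoewnerOn c ξ P a b) {x : ℝ} (hx : x ∈ Ioo a b) :
    HasDerivAt (fun x => (P x).im ^ 2)
      (-(2 * c) * ((P x).im ^ 2 / (((P x).re - ξ x) ^ 2 + (P x).im ^ 2))) x := by
  refine ((h.hasDerivAt x hx).complex_im.fun_pow 2).congr_deriv ?_
  rw [div_sub_ofReal_im]
  simp
  ring

lemma continuousOn_im {c : ℝ} (h : IsLoewnerOn c ξ P a b) :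
    ContinuousOn (fun x => (P x).im) (Icc a b) :=
  Complex.continuous_im.comp_continuousOn h.continuousOn

lemma continuousOn_re {c : ℝ} (h : IsLoewnerOn c ξ P a b) :
    ContinuousOn (fun x => (P x).re) (Icc a b) :=
  Complex.continuous_re.comp_continuousOn h.continuousOn

lemma im_sq_le (h : IsLoewnerOn (-2) ξ P a b) (hab : a ≤ b) :
    (P b).im ^ 2 ≤ (P a).im ^ 2 + 4 * (b - a) := by
  have := sub_le_mul_sub_of_hasDerivAt_le hab (h.continuousOn_im.pow 2)
    (fun x hx => h.hasDerivAt_im_sq hx) (C := 4) ?_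
  · simp only [Pi.pow_apply] at this
    linarith
  · intro x hx
    have : (P x).im ^ 2 / (((P x).re - ξ x) ^ 2 + (P x).im ^ 2) ≤ 1 :=
      div_le_one_of_le₀ (by nlinarith [sq_nonneg ((P x).re - ξ x)]) (by positivity)
    linarith

lemma im_mono (h : IsLoewnerOn (-2) ξ P a b) (hab : a ≤ b) : (P a).im ≤ (P b).im := by
  have := sub_le_mul_sub_of_hasDerivAt_le hab (h.continuousOn_im.pow 2).neg
    (fun x hx => (h.hasDerivAt_im_sq hx).neg) (C := 0) ?_
  · simp only [Pi.pow_apply, Pi.neg_apply] at this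
    exact (sq_le_sq₀ (h.im_pos a (left_mem_Icc.2 hab)).le
      (h.im_pos b (right_mem_Icc.2 hab)).le).1 (by linarith)
  · intro x hx
    have : 0 ≤ (P x).im ^ 2 / (((P x).re - ξ x) ^ 2 + (P x).im ^ 2) := by positivity
    linarith

lemma im_sq_ge (h : IsLoewnerOn (-2) ξ P a b) (hab : a ≤ b)
    (hs : ∀ x ∈ Ioo a b, |(P x).re - ξ x| ≤ (P x).im) :
    (P a).im ^ 2 + 2 * (b - a) ≤ (P b).im ^ 2 := by
  have := sub_le_mul_sub_of_hasDerivAt_le hab (h.continuousOn_im.pow 2).neg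
    (fun x hx => (h.hasDerivAt_im_sq hx).neg) (C := -2) ?_
  · simp only [Pi.pow_apply, Pi.neg_apply] at this
    linarith
  · intro x hx
    have h1 := h.im_pos x (Ioo_subset_Icc_self hx)
    have h2 : ((P x).re - ξ x) ^ 2 ≤ (P x).im ^ 2 := sq_le_sq' (neg_le_of_abs_le (hs x hx))
      (le_of_abs_le (hs x hx))
    have : 1 / 2 ≤ (P x).im ^ 2 / (((P x).re - ξ x) ^ 2 + (P x).im ^ 2) := by
      rw [div_le_div_iff₀ two_pos (by positivity)]
      linarith
    linarith

end IsLoewnerOn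

lemma exists_isLoewnerOn_neg_two {ξ : ℝ → ℝ} (hξ : Continuous ξ) {b : ℝ} (hb : 0 ≤ b) {w : ℂ}
    (hw : 0 < w.im) : ∃ h : ℝ → ℂ, h 0 = w ∧
      (∀ x ∈ Icc 0 b, HasDerivWithinAt h ((-2 : ℝ) / (h x - ξ x)) (Icc 0 b) x) ∧
      IsLoewnerOn (-2) ξ h 0 b := by
  obtain ⟨g, g0, hg⟩ := exists_truncated_solution (-2) hw hξ hb w
  have him : ∀ x ∈ Icc 0 b, w.im ≤ (g x).im := by
    intro x hx
    have hs : Icc 0 x ⊆ Icc 0 b := Icc_subset_Icc le_rfl hx.2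
    have := sub_le_mul_sub_of_hasDerivAt_le hx.1 (f := fun x => -(g x).im) (C := 0)
      (f' := fun x => -(truncatedField (-2) w.im ξ x (g x)).im)
      (Complex.continuous_im.comp_continuousOn
        (fun y hy => ((hg y (hs hy)).continuousWithinAt).mono hs)).neg
      (fun y hy => ((hg y (hs (Ioo_subset_Icc_self hy))).hasDerivAt
        (Icc_mem_nhds hy.1 (hy.2.trans_le hx.2))).complex_im.neg) ?_
    · simp only [g0] at this; linarith
    · intro y hy
      rw [im_truncatedField, neg_neg]
      refine div_nonpos_of_nonpos_of_nonneg ?_ (Complex.normSq_nonneg _)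
      have := le_max_right (g y).im w.im
      linarith
  refine ⟨g, g0, fun x hx => ?_, isLoewnerOn_of_truncated hw le_rfl hg him⟩
  have := hg x hx
  rwa [truncatedField_of_le x (him x hx)] at this

/-- The driving function of the normalised backward flow from the tip, with parameter `α`. -/
noncomputable def drive (α x : ℝ) : ℝ := -(α * (1 - (1 - x) ^ ((1 : ℝ) / 3)))

lemma continuous_drive (α : ℝ) : Continuous (drive α) := by
  unfold drive
  have : Continuous fun x : ℝ => (1 - x) ^ ((1 : ℝ) / 3) :=
    (continuous_const.sub continuous_id).rpow_const fun _ => Or.inr (by norm_num)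
  fun_prop

@[simp] lemma drive_zero (α : ℝ) : drive α 0 = 0 := by simp [drive]

lemma exists_hasDerivAt_drive (α : ℝ) {x : ℝ} (hx : 0 ≤ x) (hx' : x ≤ 1 / 8) :
    ∃ d, |d| ≤ |α| ∧ HasDerivAt (drive α) d x := by
  have h1 : HasDerivAt (fun x : ℝ => (1 - x)) (-1) x := by
    simpa using (hasDerivAt_id x).const_sub 1
  have h2 := ((h1.rpow_const (p := (1 : ℝ) / 3) (Or.inl (by linarith))).const_sub 1).const_mul α
  refine ⟨_, ?_, h2.fun_neg⟩
  have h3 : (1 - x) ^ ((1 : ℝ) / 3 - 1) ≤ 3 := by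
    have e : ((1 : ℝ) / 3 - 1) = -(2 / 3) := by norm_num
    rw [e, Real.rpow_neg (by linarith)]
    have : (1 - x) ^ (1 : ℝ) ≤ (1 - x) ^ ((2 : ℝ) / 3) :=
      Real.rpow_le_rpow_of_exponent_ge (by linarith) (by linarith) (by norm_num)
    rw [Real.rpow_one] at this
    rw [inv_le_comm₀ (by linarith) (by norm_num)]
    linarith
  have h4 : 0 ≤ (1 - x) ^ ((1 : ℝ) / 3 - 1) := Real.rpow_nonneg (by linarith) _
  rw [abs_neg, abs_mul]
  refine mul_le_of_le_one_right (abs_nonneg _) ?_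
  rw [abs_le]
  constructor <;> linarith

lemma abs_drive_sub_le (α β : ℝ) {x : ℝ} (hx : x ∈ Icc (0 : ℝ) 1) :
    |drive β x - drive α x| ≤ |β - α| * x := by
  have e : drive β x - drive α x = -((β - α) * (1 - (1 - x) ^ ((1 : ℝ) / 3))) := by
    unfold drive; ring
  rw [e, abs_neg, abs_mul]
  gcongr
  have h1 : (1 - x) ^ (1 : ℝ) ≤ (1 - x) ^ ((1 : ℝ) / 3) :=
    Real.rpow_le_rpow_of_exponent_ge' (by linarith [hx.2]) (by linarith [hx.1]) (by norm_num)
      (by norm_num)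
  have h2 : (1 - x) ^ ((1 : ℝ) / 3) ≤ 1 :=
    Real.rpow_le_one (by linarith [hx.2]) (by linarith [hx.1]) (by norm_num)
  rw [Real.rpow_one] at h1
  rw [abs_le]
  constructor <;> linarith

/-- Close to the tip, the sector `|re| ≤ im` is invariant under the backward flow. -/
lemma IsLoewnerOn.sector {A α σ a b : ℝ} {P : ℝ → ℂ} (hA : 1 ≤ A) (hα : |α| ≤ A)
    (h : IsLoewnerOn (-2) (drive α) P a b) (hab : a ≤ b) (ha : 0 ≤ a) (hb : b ≤ 1 / (8 * A ^ 2))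
    (him : ∀ x ∈ Icc a b, A * (P x).im < 2) (hσ : |σ| = 1)
    (hst : σ * ((P a).re - drive α a) < (P a).im) :
    σ * ((P b).re - drive α b) ≤ (P b).im := by
  have hb8 : b ≤ 1 / 8 := hb.trans (by
    gcongr
    nlinarith)
  choose! d hd hd' using fun x (hx : x ∈ Ioo a b) =>
    exists_hasDerivAt_drive α (ha.trans hx.1.le) (hx.2.le.trans hb8)
  have := nonpos_of_deriv_neg_of_eq_zero hab
    (f := fun x => σ * ((P x).re - drive α x) - (P x).im)
    (((h.continuousOn_re.sub (continuous_drive α).continuousOn).const_mul σ).sub h.continuousOn_im)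
    (fun x hx => ((((h.hasDerivAt x hx).complex_re.sub (hd' x hx)).const_mul σ).sub
      (h.hasDerivAt x hx).complex_im)) (by linarith) ?_
  · linarith
  · intro x hx h0
    have hx' := Ioo_subset_Icc_self hx
    rw [div_sub_ofReal_re, div_sub_ofReal_im]
    have hy := h.im_pos x hx'
    have hy2 := him x hx'
    have hdx := (hd x hx).trans hα
    set X := (P x).re - drive α x
    set Y := (P x).im
    have hσ2 : σ ^ 2 = 1 := by rw [← sq_abs, hσ, one_pow]
    have hXY : σ * X = Y := by linarith
    have hX2 : X ^ 2 = Y ^ 2 := by rw [← hXY, mul_pow, hσ2, one_mul]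
    have e : σ * (-2 * X / (X ^ 2 + Y ^ 2) - d x) - -(-2 * Y / (X ^ 2 + Y ^ 2)) =
        -2 * (σ * X + Y) / (X ^ 2 + Y ^ 2) - σ * d x := by ring
    rw [e, hXY, hX2]
    have e2 : -2 * (Y + Y) / (Y ^ 2 + Y ^ 2) = - (2 / Y) := by field_simp
    rw [e2]
    have h5 : A < 2 / Y := by rw [lt_div_iff₀ hy]; linarith
    have h6 : |σ * d x| ≤ A := by rw [abs_mul, hσ, one_mul]; exact hdx
    linarith [neg_abs_le (σ * d x)]

/-- A backward trajectory which is close to the tip at time `a` and has the expected shape. -/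
structure IsTipSolution (A α : ℝ) (P : ℝ → ℂ) (a : ℝ) : Prop extends
    IsLoewnerOn (-2) (drive α) P a 1 where
  nonneg : 0 ≤ a
  le : a ≤ 1 / (8 * A ^ 2)
  sector : ∀ x ∈ Icc a (1 / (8 * A ^ 2)), |(P x).re - drive α x| ≤ (P x).im
  im_sq : ∀ x ∈ Icc a (1 / (8 * A ^ 2)), 2 * x ≤ (P x).im ^ 2

lemma one_div_eight_mul_sq_le {A : ℝ} (hA : 1 ≤ A) : 1 / (8 * A ^ 2) ≤ 1 / 8 := by
  gcongr
  nlinarith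

lemma IsLoewnerOn.isTipSolution {A α ε : ℝ} {P : ℝ → ℂ} (hA : 1 ≤ A) (hα : |α| ≤ A) (hε : 0 < ε)
    (hεA : ε ≤ 1 / (2 * A)) (h : IsLoewnerOn (-2) (drive α) P 0 1) (h0 : P 0 = ε * I) :
    IsTipSolution A α P 0 := by
  have hx1 := one_div_eight_mul_sq_le hA
  have him : ∀ x ∈ Icc 0 (1 / (8 * A ^ 2)), A * (P x).im < 2 := by
    intro x hx
    have h1 := (h.mono le_rfl (hx.2.trans (hx1.trans (by norm_num)))).im_sq_le hx.1
    have h2 : (P 0).im = ε := by simp [h0]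
    rw [h2] at h1
    have h3 : A * ε ≤ 1 / 2 := by
      rw [le_div_iff₀ (by positivity)] at hεA; linarith
    have h4 : A ^ 2 * x ≤ 1 / 8 := by
      have := hx.2
      rw [le_div_iff₀ (by positivity)] at this; linarith
    refine lt_of_pow_lt_pow_left₀ 2 (by norm_num) ?_
    have h5 : A ^ 2 * (P x).im ^ 2 ≤ A ^ 2 * (ε ^ 2 + 4 * (x - 0)) := by gcongr
    have h6 : (A * ε) ^ 2 ≤ (1 / 2) ^ 2 := by gcongr
    nlinarith
  have hsec : ∀ x ∈ Icc 0 (1 / (8 * A ^ 2)), |(P x).re - drive α x| ≤ (P x).im := by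
    intro x hx
    have hm := h.mono le_rfl (hx.2.trans (hx1.trans (by norm_num)))
    have him' : ∀ y ∈ Icc 0 x, A * (P y).im < 2 := fun y hy => him y ⟨hy.1, hy.2.trans hx.2⟩
    have h1 := hm.sector (σ := 1) hA hα hx.1 le_rfl hx.2 him' (by simp) (by simpa [h0] using hε)
    have h2 := hm.sector (σ := -1) hA hα hx.1 le_rfl hx.2 him' (by simp) (by simpa [h0] using hε)
    rw [abs_le]
    constructor <;> linarith
  refine ⟨h, le_rfl, by positivity, hsec, fun x hx => ?_⟩
  have := (h.mono le_rfl (hx.2.trans (hx1.trans (by norm_num)))).im_sq_ge hx.1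
    fun y hy => hsec y ⟨hy.1.le, hy.2.le.trans hx.2⟩
  nlinarith

namespace IsTipSolution

variable {A α β a : ℝ} {P Q : ℝ → ℂ}

lemma im_sq' (hA : 1 ≤ A) (h : IsTipSolution A α P a) {x : ℝ} (hx : x ∈ Icc a 1) :
    x / (4 * A ^ 2) ≤ (P x).im ^ 2 := by
  have hx1 := one_div_eight_mul_sq_le hA
  have hx0 := h.nonneg.trans hx.1
  rcases le_total x (1 / (8 * A ^ 2)) with hx' | hx'
  · have h1 := h.im_sq x ⟨hx.1, hx'⟩
    have : x / (4 * A ^ 2) ≤ x / 1 := by gcongr; nlinarith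
    linarith
  · have h1 := h.im_sq _ ⟨h.le, le_rfl⟩
    have h2 := (h.toIsLoewnerOn.mono h.le hx.2).im_mono hx'
    have h3 := h.im_pos (1 / (8 * A ^ 2)) ⟨h.le, by linarith⟩
    have h4 : x / (4 * A ^ 2) ≤ 1 / (4 * A ^ 2) := by gcongr; exact hx.2
    have h5 : 1 / (4 * A ^ 2) = 2 * (1 / (8 * A ^ 2)) := by field_simp; norm_num
    nlinarith

lemma im_sq_one (hA : 1 ≤ A) (h : IsTipSolution A α P a) : 1 / (4 * A ^ 2) ≤ (P 1).im ^ 2 :=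
  h.im_sq' hA ⟨h.le.trans ((one_div_eight_mul_sq_le hA).trans (by norm_num)), le_rfl⟩

lemma sq_le_norm_mul_norm (hA : 1 ≤ A) (h : IsTipSolution A α P a) (h' : IsTipSolution A β Q a)
    {x : ℝ} (hx : x ∈ Icc a 1) :
    x / (4 * A ^ 2) ≤ ‖P x - drive α x‖ * ‖Q x - drive β x‖ := by
  have h1 := h.im_sq' hA hx
  have h2 := h'.im_sq' hA hx
  have h3 := im_le_norm_sub (P x) (drive α x)
  have h4 := im_le_norm_sub (Q x) (drive β x)
  have h5 := h.im_pos x hx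
  have h6 := h'.im_pos x hx
  have h7 : x / (4 * A ^ 2) ≤ (P x).im * (Q x).im := by
    refine le_of_sq_le_sq ?_ (by positivity)
    have : 0 ≤ x / (4 * A ^ 2) := div_nonneg (h.nonneg.trans hx.1) (by positivity)
    rw [mul_pow, sq (x / _)]
    gcongr
  nlinarith

lemma norm_coeff_le (hA : 1 ≤ A) (h : IsTipSolution A α P a) (h' : IsTipSolution A β Q a)
    {x : ℝ} (hx : x ∈ Icc a 1) :
    ‖2 / ((P x - drive α x) * (Q x - drive β x))‖ * x ≤ 8 * A ^ 2 := by
  have h1 := h.sq_le_norm_mul_norm hA h' hx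
  rcases (h.nonneg.trans hx.1).eq_or_lt with h0 | h0
  · rw [← h0, mul_zero]; positivity
  · rw [norm_div, norm_mul, Complex.norm_ofNat]
    have : 0 < x / (4 * A ^ 2) := by positivity
    rw [div_mul_eq_mul_div, div_le_iff₀ (this.trans_le h1)]
    calc 2 * x = 8 * A ^ 2 * (x / (4 * A ^ 2)) := by field_simp; norm_num
      _ ≤ _ := by gcongr

lemma re_coeff_le (hA : 1 ≤ A) (h : IsTipSolution A α P a) (h' : IsTipSolution A β Q a)
    {x : ℝ} (hx : x ∈ Icc a 1) :
    (2 / ((P x - drive α x) * (Q x - drive β x))).re ≤ (8 * A ^ 2) ^ 2 := by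
  rcases le_total x (1 / (8 * A ^ 2)) with hx' | hx'
  · refine le_trans ?_ (by positivity : (0 : ℝ) ≤ (8 * A ^ 2) ^ 2)
    have h1 := h.sector x ⟨hx.1, hx'⟩
    have h2 := h'.sector x ⟨hx.1, hx'⟩
    have h3 : ((P x).re - drive α x) * ((Q x).re - drive β x) ≤ (P x).im * (Q x).im := by
      refine (le_abs_self _).trans ?_
      rw [abs_mul]
      gcongr
      exact (h.im_pos x hx).le
    rw [div_re]
    have h4 : ((P x - drive α x) * (Q x - drive β x)).re ≤ 0 := by
      simp only [mul_re, sub_re, sub_im, ofReal_re, ofReal_im, sub_zero]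
      linarith
    simp only [re_ofNat, im_ofNat, zero_mul, zero_div, add_zero]
    refine div_nonpos_of_nonpos_of_nonneg (by linarith) (Complex.normSq_nonneg _)
  · refine (Complex.re_le_norm _).trans ?_
    have h1 := h.norm_coeff_le hA h' hx
    set n := ‖2 / ((P x - drive α x) * (Q x - drive β x))‖
    have h2 : n * (1 / (8 * A ^ 2)) ≤ 8 * A ^ 2 := le_trans (by gcongr) h1
    rw [mul_one_div, div_le_iff₀ (by positivity)] at h2
    linarith

lemma hasDerivAt_sub (h : IsTipSolution A α P a) (h' : IsTipSolution A β Q a)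
    {x : ℝ} (hx : x ∈ Ioo a 1) :
    HasDerivAt (fun x => Q x - P x) (2 / ((P x - drive α x) * (Q x - drive β x)) *
      ((Q x - P x) - ((drive β x - drive α x : ℝ) : ℂ))) x := by
  refine ((h'.hasDerivAt x hx).sub (h.hasDerivAt x hx)).congr_deriv ?_
  have n1 := sub_ofReal_ne_zero (h.im_pos x (Ioo_subset_Icc_self hx)) (drive α x)
  have n2 := sub_ofReal_ne_zero (h'.im_pos x (Ioo_subset_Icc_self hx)) (drive β x)
  push_cast
  field_simp
  ring

lemma norm_sub_le_of_drive (hA : 1 ≤ A) (h : IsTipSolution A α P a) (h' : IsTipSolution A β Q a)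
    {x : ℝ} (hx : x ∈ Icc a 1) :
    ‖Q x - P x‖ ≤ Real.exp ((8 * A ^ 2) ^ 2) * (‖Q a - P a‖ + 8 * A ^ 2 * |β - α| * (x - a)) := by
  have := norm_le_of_re_conj_mul_deriv_le (Z := fun x => Q x - P x) (L := (8 * A ^ 2) ^ 2)
    (K := 8 * A ^ 2 * |β - α|)
    hx.1 (by positivity) (by positivity)
    ((h'.continuousOn.sub h.continuousOn).mono (Icc_subset_Icc le_rfl hx.2))
    (fun y hy => h.hasDerivAt_sub h' ⟨hy.1, hy.2.trans_le hx.2⟩) ?_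
  · refine this.trans ?_
    have : 0 ≤ ‖Q a - P a‖ + 8 * A ^ 2 * |β - α| * (x - a) :=
      add_nonneg (norm_nonneg _) (mul_nonneg (by positivity) (by linarith [hx.1]))
    gcongr
    refine mul_le_of_le_one_right (by positivity) ?_
    linarith [hx.2, h.nonneg]
  · intro y hy
    have hy' : y ∈ Icc a 1 := ⟨hy.1.le, hy.2.le.trans hx.2⟩
    have h1 := h.re_coeff_le hA h' hy'
    have h2 := h.norm_coeff_le hA h' hy'
    have h3 := abs_drive_sub_le α β ⟨h.nonneg.trans hy'.1, hy'.2⟩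
    set k := 2 / ((P y - drive α y) * (Q y - drive β y))
    set D := Q y - P y
    have e : (starRingEnd ℂ) D * (k * (D - ((drive β y - drive α y : ℝ) : ℂ))) =
        ((‖D‖ ^ 2 : ℝ) : ℂ) * k -
          (starRingEnd ℂ) D * (k * ((drive β y - drive α y : ℝ) : ℂ)) := by
      push_cast
      rw [← Complex.conj_mul']
      ring
    rw [e, sub_re, Complex.re_ofReal_mul]
    have h4 : -((starRingEnd ℂ) D * (k * ((drive β y - drive α y : ℝ) : ℂ))).re ≤
        ‖D‖ * (‖k‖ * (|β - α| * y)) := by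
      refine (neg_le_abs _).trans ((Complex.abs_re_le_norm _).trans ?_)
      rw [norm_mul, norm_mul, Complex.norm_real, Real.norm_eq_abs, RCLike.norm_conj]
      gcongr
    have h5 : ‖D‖ ^ 2 * k.re ≤ ‖D‖ ^ 2 * (8 * A ^ 2) ^ 2 := by gcongr
    have h6 : ‖D‖ * |β - α| * (‖k‖ * y) ≤ ‖D‖ * |β - α| * (8 * A ^ 2) := by gcongr
    linarith

/-- The Lipschitz constant of the shifted trajectories with respect to the parameter. -/
noncomputable def lipConst (A : ℝ) : ℝ := Real.exp ((8 * A ^ 2) ^ 2) * (8 * A ^ 2) + 1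

lemma lipConst_pos (A : ℝ) : 0 < lipConst A := by unfold lipConst; positivity

lemma norm_shift_sub_le (hA : 1 ≤ A) (h : IsTipSolution A α P 0) (h' : IsTipSolution A β Q 0)
    (h0 : P 0 = Q 0) {x : ℝ} (hx : x ∈ Icc 0 1) :
    ‖(Q x - drive β x) - (P x - drive α x)‖ ≤ lipConst A * |β - α| * x := by
  have h1 := h.norm_sub_le_of_drive hA h' hx
  have h2 := abs_drive_sub_le α β hx
  rw [h0, sub_self, norm_zero, zero_add, sub_zero] at h1
  have e : (Q x - drive β x) - (P x - drive α x) =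
      (Q x - P x) - ((drive β x - drive α x : ℝ) : ℂ) := by push_cast; ring
  rw [e]
  refine (norm_sub_le _ _).trans ?_
  rw [Complex.norm_real, Real.norm_eq_abs]
  unfold lipConst
  linarith

lemma norm_sub_div_le {m : ℝ} {D U V W : ℂ} (hm : 0 < m) (hm1 : m ≤ 1) (hU : m ≤ ‖U‖)
    (hV : m ≤ ‖V‖) (hW : m ≤ ‖W‖) : ‖D / (U * V * W)‖ ≤ ‖D‖ / m ^ 4 := by
  rw [norm_div, norm_mul, norm_mul]
  gcongr
  calc m ^ 4 = m * (m * m * m) := by ring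
    _ ≤ 1 * (m * m * m) := by gcongr
    _ = m * m * m := one_mul _
    _ ≤ _ := by gcongr

lemma norm_coeff_sub_le (hA : 1 ≤ A) {α₁ α₂ α₃ α₄ : ℝ} {P₁ P₂ P₃ P₄ : ℝ → ℂ}
    (h₁ : IsTipSolution A α₁ P₁ 0) (h₂ : IsTipSolution A α₂ P₂ 0)
    (h₃ : IsTipSolution A α₃ P₃ 0) (h₄ : IsTipSolution A α₄ P₄ 0)
    (h13 : P₁ 0 = P₃ 0) (h24 : P₂ 0 = P₄ 0) {x : ℝ} (hx : x ∈ Ioo 0 1) :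
    ‖2 / ((P₁ x - drive α₁ x) * (P₂ x - drive α₂ x)) -
      2 / ((P₃ x - drive α₃ x) * (P₄ x - drive α₄ x))‖ * x ≤
      32 * A ^ 4 * lipConst A * (|α₃ - α₁| + |α₄ - α₂|) := by
  have hx' := Ioo_subset_Icc_self hx
  have hx0 := hx.1
  have key : ∀ {α : ℝ} {P : ℝ → ℂ}, IsTipSolution A α P 0 → √(x / (4 * A ^ 2)) ≤ ‖P x - drive α x‖ := by
    intro α P h
    refine le_trans ?_ (im_le_norm_sub (P x) (drive α x))
    rw [Real.sqrt_le_left (h.im_pos x hx').le]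
    exact h.im_sq' hA hx'
  have k1 := key h₁
  have k2 := key h₂
  have k3 := key h₃
  have k4 := key h₄
  have d13 := h₁.norm_shift_sub_le hA h₃ h13 hx'
  have d24 := h₂.norm_shift_sub_le hA h₄ h24 hx'
  set m := √(x / (4 * A ^ 2)) with hm
  have hmpos : 0 < m := Real.sqrt_pos.2 (by positivity)
  have hmsq : m ^ 2 = x / (4 * A ^ 2) := Real.sq_sqrt (by positivity)
  have hm1 : m ≤ 1 := by
    rw [hm, Real.sqrt_le_iff, one_pow, div_le_one (by positivity)]
    exact ⟨zero_le_one, by nlinarith [hx.2]⟩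
  set V₁ := P₁ x - drive α₁ x
  set V₂ := P₂ x - drive α₂ x
  set V₃ := P₃ x - drive α₃ x
  set V₄ := P₄ x - drive α₄ x
  have n1 : V₁ ≠ 0 := norm_pos_iff.1 (hmpos.trans_le k1)
  have n2 : V₂ ≠ 0 := norm_pos_iff.1 (hmpos.trans_le k2)
  have n3 : V₃ ≠ 0 := norm_pos_iff.1 (hmpos.trans_le k3)
  have n4 : V₄ ≠ 0 := norm_pos_iff.1 (hmpos.trans_le k4)
  have e : 2 / (V₁ * V₂) - 2 / (V₃ * V₄) =
      2 * ((V₃ - V₁) / (V₁ * V₂ * V₃) + (V₄ - V₂) / (V₂ * V₃ * V₄)) := by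
    field_simp
    ring
  have b1 := norm_sub_div_le (D := V₃ - V₁) hmpos hm1 k1 k2 k3
  have b2 := norm_sub_div_le (D := V₄ - V₂) hmpos hm1 k2 k3 k4
  have hm4 : m ^ 4 = x ^ 2 / (16 * A ^ 4) := by
    rw [show m ^ 4 = (m ^ 2) ^ 2 by ring, hmsq, div_pow]; ring
  rw [e, norm_mul, Complex.norm_ofNat]
  have hD : ∀ {D : ℂ} {k : ℝ}, ‖D‖ ≤ lipConst A * k * x →
      ‖D‖ / m ^ 4 * x ≤ 16 * A ^ 4 * lipConst A * k := by
    intro D k hk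
    rw [hm4, div_div_eq_mul_div, div_mul_eq_mul_div, div_le_iff₀ (by positivity)]
    calc ‖D‖ * (16 * A ^ 4) * x ≤ (lipConst A * k * x) * (16 * A ^ 4) * x := by gcongr
      _ = _ := by ring
  have c1 := hD d13
  have c2 := hD d24
  calc _ ≤ 2 * (‖V₃ - V₁‖ / m ^ 4 + ‖V₄ - V₂‖ / m ^ 4) * x := by
        gcongr
        exact (norm_add_le _ _).trans (add_le_add b1 b2)
    _ ≤ _ := by linarith

/-- The Lipschitz constant of the difference quotients with respect to the parameter. -/
noncomputable def slopeConst (A : ℝ) : ℝ :=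
  Real.exp ((8 * A ^ 2) ^ 2) * (32 * A ^ 4 * lipConst A * lipConst A)

lemma norm_slope_sub_le (hA : 1 ≤ A) {α₁ α₂ α₃ α₄ : ℝ} {P₁ P₂ P₃ P₄ : ℝ → ℂ}
    (h₁ : IsTipSolution A α₁ P₁ 0) (h₂ : IsTipSolution A α₂ P₂ 0)
    (h₃ : IsTipSolution A α₃ P₃ 0) (h₄ : IsTipSolution A α₄ P₄ 0)
    (h12 : P₁ 0 = P₂ 0) (h13 : P₁ 0 = P₃ 0) (h24 : P₂ 0 = P₄ 0)
    (n12 : α₁ ≠ α₂) (n34 : α₃ ≠ α₄) :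
    ‖(P₂ 1 - P₁ 1) / ((α₂ - α₁ : ℝ) : ℂ) - (P₄ 1 - P₃ 1) / ((α₄ - α₃ : ℝ) : ℂ)‖ ≤
      slopeConst A * (|α₃ - α₁| + |α₄ - α₂|) := by
  have m12 : ((α₂ - α₁ : ℝ) : ℂ) ≠ 0 := by exact_mod_cast sub_ne_zero.2 n12.symm
  have m34 : ((α₄ - α₃ : ℝ) : ℂ) ≠ 0 := by exact_mod_cast sub_ne_zero.2 n34.symm
  have hl := lipConst_pos A
  have hlA : 0 < 32 * A ^ 4 * lipConst A := by positivity
  have h34 : P₃ 0 = P₄ 0 := by rw [← h13, ← h24, h12]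
  have := norm_le_of_re_conj_mul_deriv_le
    (Z := fun x => (P₂ x - P₁ x) / ((α₂ - α₁ : ℝ) : ℂ) - (P₄ x - P₃ x) / ((α₄ - α₃ : ℝ) : ℂ))
    (L := (8 * A ^ 2) ^ 2)
    (K := 32 * A ^ 4 * lipConst A * (|α₃ - α₁| + |α₄ - α₂|) * lipConst A)
    zero_le_one (by positivity) (by positivity)
    (((h₂.continuousOn.sub h₁.continuousOn).div_const _).sub
      ((h₄.continuousOn.sub h₃.continuousOn).div_const _))
    (fun y hy => ((h₁.hasDerivAt_sub h₂ hy).div_const _).sub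
      ((h₃.hasDerivAt_sub h₄ hy).div_const _)) ?_
  · simp only [← h12, ← h34, sub_self, zero_div, norm_zero, sub_zero, mul_one, zero_add] at this
    refine this.trans (le_of_eq ?_)
    unfold slopeConst
    ring
  · intro y hy
    have hy' := Ioo_subset_Icc_self hy
    have hy0 := hy.1
    have c1 := h₁.re_coeff_le hA h₂ hy'
    have c2 := norm_coeff_sub_le hA h₁ h₂ h₃ h₄ h13 h24 hy
    have c3 := h₃.norm_shift_sub_le hA h₄ h34 hy'
    set a := 2 / ((P₁ y - drive α₁ y) * (P₂ y - drive α₂ y))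
    set b := 2 / ((P₃ y - drive α₃ y) * (P₄ y - drive α₄ y))
    set k := ((α₂ - α₁ : ℝ) : ℂ)
    set l := ((α₄ - α₃ : ℝ) : ℂ) with hl'
    set W := (P₄ y - P₃ y - ((drive α₄ y - drive α₃ y : ℝ) : ℂ)) / l with hW
    have hWn : ‖W‖ ≤ lipConst A * y := by
      have hlpos : 0 < ‖l‖ := norm_pos_iff.2 m34
      rw [hW, norm_div, div_le_iff₀ hlpos]
      have e : ‖l‖ = |α₄ - α₃| := by rw [hl', Complex.norm_real, Real.norm_eq_abs]
      have e2 : P₄ y - P₃ y - ((drive α₄ y - drive α₃ y : ℝ) : ℂ) =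
        (P₄ y - drive α₄ y) - (P₃ y - drive α₃ y) := by push_cast; ring
      rw [e, e2]
      linarith
    set Z := (P₂ y - P₁ y) / k - (P₄ y - P₃ y) / l with hZ
    have e : a * (P₂ y - P₁ y - ((drive α₂ y - drive α₁ y : ℝ) : ℂ)) / k -
        b * (P₄ y - P₃ y - ((drive α₄ y - drive α₃ y : ℝ) : ℂ)) / l = a * Z + (a - b) * W := by
      have : ((drive α₂ y - drive α₁ y : ℝ) : ℂ) / k = ((drive α₄ y - drive α₃ y : ℝ) : ℂ) / l := by
        rw [div_eq_div_iff m12 m34]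
        change _ * ((α₄ - α₃ : ℝ) : ℂ) = _ * ((α₂ - α₁ : ℝ) : ℂ)
        norm_cast
        unfold drive
        ring
      rw [hZ, hW]
      linear_combination (-a) * this
    rw [e]
    have e3 : (starRingEnd ℂ) Z * (a * Z + (a - b) * W) =
        ((‖Z‖ ^ 2 : ℝ) : ℂ) * a + (starRingEnd ℂ) Z * ((a - b) * W) := by
      push_cast
      rw [← Complex.conj_mul']
      ring
    rw [e3, add_re, Complex.re_ofReal_mul]
    have h4 : ((starRingEnd ℂ) Z * ((a - b) * W)).re ≤ ‖Z‖ * (‖a - b‖ * (lipConst A * y)) := by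
      refine (Complex.re_le_norm _).trans ?_
      rw [norm_mul, norm_mul, RCLike.norm_conj]
      gcongr
    have h5 : ‖Z‖ ^ 2 * a.re ≤ ‖Z‖ ^ 2 * (8 * A ^ 2) ^ 2 := by gcongr
    have h6 : ‖Z‖ * lipConst A * (‖a - b‖ * y) ≤
      ‖Z‖ * lipConst A * (32 * A ^ 4 * lipConst A * (|α₃ - α₁| + |α₄ - α₂|)) := by gcongr
    linarith

end IsTipSolution

lemma IsLoewnerOn.abs_re_le {α ε : ℝ} {P : ℝ → ℂ} (h : IsLoewnerOn (-2) (drive α) P 0 1)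
    (h0 : (P 0).re = 0) (hε : 0 < ε) : |(P 1).re| ≤ |α| + ε := by
  have hd : ∀ x ∈ Ioo (0 : ℝ) 1, |drive α x| ≤ |α| := by
    intro x hx
    have := abs_drive_sub_le 0 α (Ioo_subset_Icc_self hx)
    have e : drive 0 x = 0 := by simp [drive]
    rw [e, sub_zero, sub_zero] at this
    exact this.trans (mul_le_of_le_one_right (abs_nonneg _) hx.2.le)
  have key : ∀ σ : ℝ, |σ| = 1 → σ * (P 1).re - (|α| + ε) ≤ 0 := by
    intro σ hσ
    refine nonpos_of_deriv_neg_of_eq_zero (f := fun x => σ * (P x).re - (|α| + ε)) zero_le_one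
      ((continuousOn_const.mul h.continuousOn_re).sub continuousOn_const)
      (fun x hx => ((h.hasDerivAt x hx).complex_re.const_mul σ).sub_const _) ?_ ?_
    · simp only [h0]
      have := abs_nonneg α
      linarith
    · intro x hx hz
      rw [div_sub_ofReal_re]
      have hp := h.im_pos x (Ioo_subset_Icc_self hx)
      have h1 : 0 < σ * ((P x).re - drive α x) := by
        have h2 : σ * drive α x ≤ |α| := (le_abs_self _).trans (by rw [abs_mul, hσ, one_mul]; exact hd x hx)
        linarith
      have e : σ * (-2 * ((P x).re - drive α x) / (((P x).re - drive α x) ^ 2 + (P x).im ^ 2)) =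
        -2 * ((σ * ((P x).re - drive α x)) / (((P x).re - drive α x) ^ 2 + (P x).im ^ 2)) := by ring
      rw [e]
      have : 0 < (σ * ((P x).re - drive α x)) / (((P x).re - drive α x) ^ 2 + (P x).im ^ 2) := by
        positivity
      linarith
  have h1 := key 1 (by simp)
  have h2 := key (-1) (by simp)
  rw [abs_le]
  constructor <;> linarith

/-- A backward trajectory started at the point `ε * I`. -/
noncomputable def tipApprox (α ε : ℝ) : ℝ → ℂ :=
  Classical.epsilon fun p => p 0 = ε * I ∧ IsLoewnerOn (-2) (drive α) p 0 1

lemma tipApprox_spec (α : ℝ) {ε : ℝ} (hε : 0 < ε) :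
    tipApprox α ε 0 = ε * I ∧ IsLoewnerOn (-2) (drive α) (tipApprox α ε) 0 1 := by
  refine Classical.epsilon_spec (p := fun p : ℝ → ℂ => p 0 = ε * I ∧ IsLoewnerOn (-2) (drive α) p 0 1) ?_
  obtain ⟨p, h0, -, hp⟩ := exists_isLoewnerOn_neg_two (continuous_drive α) zero_le_one
    (w := ε * I) (by simpa using hε)
  exact ⟨p, h0, hp⟩

lemma isTipSolution_tipApprox {A α ε : ℝ} (hA : 1 ≤ A) (hα : |α| ≤ A) (hε : 0 < ε)
    (hεA : ε ≤ 1 / (2 * A)) : IsTipSolution A α (tipApprox α ε) 0 :=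
  (tipApprox_spec α hε).2.isTipSolution hA hα hε hεA (tipApprox_spec α hε).1

lemma eventually_isTipSolution {A α : ℝ} (hA : 1 ≤ A) (hα : |α| ≤ A) :
    ∀ᶠ ε in 𝓝[>] (0 : ℝ), IsTipSolution A α (tipApprox α ε) 0 := by
  have : (0 : ℝ) < 1 / (2 * A) := by positivity
  filter_upwards [Ioc_mem_nhdsGT this] with ε hε
  exact isTipSolution_tipApprox hA hα hε.1 hε.2

/-- The normalised tip of the slit, the limit of `tipApprox α ε 1` as `ε` tends to zero. -/
noncomputable def tip (α : ℝ) : ℂ := limUnder (𝓝[>] (0 : ℝ)) fun ε => tipApprox α ε 1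

lemma tendsto_tip (α : ℝ) : Tendsto (fun ε => tipApprox α ε 1) (𝓝[>] 0) (𝓝 (tip α)) := by
  refine tendsto_nhds_limUnder (cauchy_map_iff_exists_tendsto.1 ?_)
  set A := max 1 |α|
  have hA : 1 ≤ A := le_max_left _ _
  have hα : |α| ≤ A := le_max_right _ _
  set C := Real.exp ((8 * A ^ 2) ^ 2)
  have hC : 0 < C := Real.exp_pos _
  rw [Metric.cauchy_iff]
  refine ⟨inferInstance, fun η hη => ?_⟩
  have hd : 0 < min (1 / (2 * A)) (η / (2 * C)) := by positivity
  refine ⟨_, image_mem_map (Ioc_mem_nhdsGT hd), ?_⟩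
  rintro _ ⟨x, hx, rfl⟩ _ ⟨y, hy, rfl⟩
  have h1 := isTipSolution_tipApprox hA hα hx.1 (hx.2.trans (min_le_left _ _))
  have h2 := isTipSolution_tipApprox hA hα hy.1 (hy.2.trans (min_le_left _ _))
  have h3 := h2.norm_sub_le_of_drive hA h1 (right_mem_Icc.2 zero_le_one)
  rw [(tipApprox_spec α hx.1).1, (tipApprox_spec α hy.1).1, sub_self, abs_zero, mul_zero, zero_mul,
    add_zero, ← sub_mul, norm_mul, norm_I, mul_one, ← ofReal_sub, Complex.norm_real] at h3
  rw [dist_eq_norm]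
  have h4 : ‖x - y‖ < η / (2 * C) := by
    have h5 := hx.2.trans (min_le_right _ _)
    have h6 := hy.2.trans (min_le_right _ _)
    have h7 := hx.1
    have h8 := hy.1
    rw [Real.norm_eq_abs, abs_lt]
    constructor <;> linarith
  calc _ ≤ C * ‖x - y‖ := h3
    _ ≤ C * (η / (2 * C)) := by gcongr
    _ = η / 2 := by field_simp
    _ < η := by linarith

lemma im_tip_pos (α : ℝ) : 0 < (tip α).im := by
  set A := max 1 |α|
  have hA : 1 ≤ A := le_max_left _ _
  have h1 : 1 / (2 * A) ≤ (tip α).im := by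
    refine ge_of_tendsto ((Complex.continuous_im.tendsto _).comp (tendsto_tip α)) ?_
    filter_upwards [eventually_isTipSolution hA (le_max_right _ _ : |α| ≤ A)] with ε hε
    have h2 := hε.im_sq_one hA
    have h3 := hε.im_pos 1 (right_mem_Icc.2 zero_le_one)
    refine le_of_sq_le_sq ?_ h3.le
    rw [div_pow, mul_pow]
    norm_num at h2 ⊢
    exact h2
  exact lt_of_lt_of_le (by positivity) h1

lemma norm_tip_le (α : ℝ) : ‖tip α‖ ≤ |α| + 2 := by
  have hlim : Tendsto (fun ε : ℝ => (|α| + ε) + (ε + 2)) (𝓝[>] 0) (𝓝 (|α| + 2)) := by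
    have : Continuous fun ε : ℝ => (|α| + ε) + (ε + 2) := by fun_prop
    simpa using (this.tendsto 0).mono_left nhdsWithin_le_nhds
  refine le_of_tendsto_of_tendsto (tendsto_tip α).norm hlim ?_
  filter_upwards [self_mem_nhdsWithin] with ε hε
  obtain ⟨h0, h⟩ := tipApprox_spec α (show 0 < ε from hε)
  have hε' : 0 < ε := hε
  refine (Complex.norm_le_abs_re_add_abs_im _).trans (add_le_add (h.abs_re_le (by simp [h0]) hε) ?_)
  have h1 := h.im_sq_le zero_le_one
  have h2 := h.im_pos 1 (right_mem_Icc.2 zero_le_one)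
  rw [abs_of_pos h2]
  have h3 : (tipApprox α ε 0).im = ε := by simp [h0]
  rw [h3] at h1
  refine le_of_sq_le_sq ?_ (by positivity)
  nlinarith

lemma norm_slope_tip_sub_le {A α₁ α₂ α₃ α₄ : ℝ} (hA : 1 ≤ A) (h₁ : |α₁| ≤ A) (h₂ : |α₂| ≤ A)
    (h₃ : |α₃| ≤ A) (h₄ : |α₄| ≤ A) (n12 : α₁ ≠ α₂) (n34 : α₃ ≠ α₄) :
    ‖(tip α₂ - tip α₁) / ((α₂ - α₁ : ℝ) : ℂ) - (tip α₄ - tip α₃) / ((α₄ - α₃ : ℝ) : ℂ)‖ ≤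
      IsTipSolution.slopeConst A * (|α₃ - α₁| + |α₄ - α₂|) := by
  refine le_of_tendsto (((((tendsto_tip α₂).sub (tendsto_tip α₁)).div_const _).sub
    (((tendsto_tip α₄).sub (tendsto_tip α₃)).div_const _)).norm) ?_
  filter_upwards [eventually_isTipSolution hA h₁, eventually_isTipSolution hA h₂,
    eventually_isTipSolution hA h₃, eventually_isTipSolution hA h₄, self_mem_nhdsWithin]
    with ε e1 e2 e3 e4 hε
  have hs : ∀ α, tipApprox α ε 0 = ε * I := fun α => (tipApprox_spec α hε).1
  exact IsTipSolution.norm_slope_sub_le hA e1 e2 e3 e4 (by simp [hs]) (by simp [hs]) (by simp [hs])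
    n12 n34

/-- A function whose slopes at a point satisfy a Cauchy condition is differentiable there. -/
lemma exists_hasDerivWithinAt_of_slope {𝕜 E : Type*} [NontriviallyNormedField 𝕜]
    [NormedAddCommGroup E] [NormedSpace 𝕜 E] [CompleteSpace E] {f : 𝕜 → E} {s : Set 𝕜} {x : 𝕜}
    {C r : ℝ} (hr : 0 < r)
    (h : ∀ y ∈ s, ∀ z ∈ s, y ≠ x → z ≠ x → ‖y - x‖ < r → ‖z - x‖ < r →
      ‖slope f x y - slope f x z‖ ≤ C * (‖y - x‖ + ‖z - x‖)) :
    ∃ f', HasDerivWithinAt f f' s x := by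
  simp only [hasDerivWithinAt_iff_tendsto_slope]
  rcases (𝓝[s \ {x}] x).eq_or_neBot with h0 | h0
  · exact ⟨0, by rw [h0]; exact tendsto_bot⟩
  refine cauchy_map_iff_exists_tendsto.1 ?_
  rw [Metric.cauchy_iff]
  refine ⟨inferInstance, fun η hη => ?_⟩
  have hd : 0 < min r (η / (2 * (|C| + 1))) := by positivity
  refine ⟨_, image_mem_map (inter_mem_nhdsWithin _ (Metric.ball_mem_nhds x hd)), ?_⟩
  rintro _ ⟨y, ⟨⟨hys, hyx⟩, hy⟩, rfl⟩ _ ⟨z, ⟨⟨hzs, hzx⟩, hz⟩, rfl⟩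
  rw [Metric.mem_ball, dist_eq_norm] at hy hz
  have h1 := h y hys z hzs hyx hzx (hy.trans_le (min_le_left _ _)) (hz.trans_le (min_le_left _ _))
  rw [dist_eq_norm]
  refine h1.trans_lt ?_
  have h2 := hy.trans_le (min_le_right _ _)
  have h3 := hz.trans_le (min_le_right _ _)
  calc C * (‖y - x‖ + ‖z - x‖) ≤ (|C| + 1) * (‖y - x‖ + ‖z - x‖) := by
        gcongr; linarith [le_abs_self C]
    _ < (|C| + 1) * (η / (2 * (|C| + 1)) + η / (2 * (|C| + 1))) := by gcongr
    _ = η := by field_simp; ring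

lemma differentiable_tip : Differentiable ℝ tip := by
  intro α
  set A := |α| + 1 with hA'
  have hA : 1 ≤ A := by linarith [abs_nonneg α]
  have hα : |α| ≤ A := by linarith
  have hn : ∀ y : ℝ, ‖y - α‖ < 1 → |y| ≤ A := by
    intro y hy
    rw [Real.norm_eq_abs] at hy
    have := abs_add_le (y - α) α
    rw [sub_add_cancel] at this
    linarith
  suffices h : ∃ d, HasDerivWithinAt tip d univ α by
    obtain ⟨d, hd⟩ := h
    exact (hasDerivWithinAt_univ.1 hd).differentiableAt
  refine exists_hasDerivWithinAt_of_slope (C := IsTipSolution.slopeConst A) one_pos ?_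
  · intro y _ z _ hy hz hy1 hz1
    have := norm_slope_tip_sub_le hA hα (hn y hy1) hα (hn z hz1) hy.symm hz.symm
    have e : ∀ y, slope tip α y = (tip y - tip α) / ((y - α : ℝ) : ℂ) := by
      intro y
      rw [slope_def_module, Complex.real_smul, ofReal_inv, div_eq_inv_mul]
    rw [e, e]
    refine this.trans ?_
    have hpos : 0 ≤ IsTipSolution.slopeConst A := by
      have := IsTipSolution.lipConst_pos A
      unfold IsTipSolution.slopeConst
      positivity
    refine mul_le_mul_of_nonneg_left ?_ hpos
    rw [sub_self, abs_zero, zero_add]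
    have := norm_sub_le (z - α) (y - α)
    rw [sub_sub_sub_cancel_right] at this
    rw [← Real.norm_eq_abs]
    linarith

lemma norm_deriv_tip_sub_le {A α β : ℝ} (hA : 1 ≤ A) (hα : |α| < A) (hβ : |β| < A) :
    ‖deriv tip α - deriv tip β‖ ≤ IsTipSolution.slopeConst A * (|β - α| + |β - α|) := by
  have h1 := hasDerivAt_iff_tendsto_slope_zero.1 (differentiable_tip α).hasDerivAt
  have h2 := hasDerivAt_iff_tendsto_slope_zero.1 (differentiable_tip β).hasDerivAt
  refine le_of_tendsto (h1.sub h2).norm ?_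
  have e : ∀ γ : ℝ, |γ| < A → ∀ᶠ t in 𝓝[≠] (0 : ℝ), |γ + t| < A := by
    intro γ hγ
    have hc : Continuous fun t : ℝ => |γ + t| := by fun_prop
    refine nhdsWithin_le_nhds (hc.continuousAt.eventually_lt_const (by simpa using hγ))
  filter_upwards [e α hα, e β hβ, self_mem_nhdsWithin] with t ht1 ht2 ht
  have ht0 : t ≠ 0 := ht
  have := norm_slope_tip_sub_le hA hα.le ht1.le hβ.le ht2.le (by simpa using ht0)
    (by simpa using ht0)
  simp only [add_sub_cancel_left, add_sub_add_right_eq_sub] at this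
  simpa only [Complex.real_smul, ofReal_inv, div_eq_inv_mul] using this

lemma contDiff_tip : ContDiff ℝ 1 tip := by
  refine contDiff_one_iff_deriv.2 ⟨differentiable_tip, continuous_iff_continuousAt.2 fun α => ?_⟩
  set A := |α| + 1 with hA'
  have hA : 1 ≤ A := by linarith [abs_nonneg α]
  have hlim : Tendsto (fun β : ℝ => IsTipSolution.slopeConst A * (|α - β| + |α - β|)) (𝓝 α) (𝓝 0) := by
    have : Continuous fun β : ℝ => IsTipSolution.slopeConst A * (|α - β| + |α - β|) := by fun_prop
    simpa using this.tendsto α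
  refine tendsto_iff_norm_sub_tendsto_zero.2 (squeeze_zero' (Eventually.of_forall fun _ =>
    norm_nonneg _) ?_ hlim)
  filter_upwards [continuous_abs.continuousAt.eventually_lt_const
    (show |α| < A by linarith)] with β hβ
  exact norm_deriv_tip_sub_le hA hβ (by linarith)

/-- The slit generated by the cubic root driving function. -/
noncomputable def curve (t : ℝ) : ℂ :=
  (√t : ℝ) * tip (t ^ (-(1 : ℝ) / 6)) + ((t ^ ((1 : ℝ) / 3) : ℝ) : ℂ)

lemma curve_zero : curve 0 = 0 := by simp [curve]

lemma im_curve_pos {t : ℝ} (ht : 0 < t) : 0 < (curve t).im := by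
  have := Real.sqrt_pos.2 ht
  have h2 := im_tip_pos (t ^ (-(1 : ℝ) / 6))
  simp only [curve, add_im, ofReal_im, add_zero, Complex.im_ofReal_mul]
  positivity

lemma contDiffOn_curve : ContDiffOn ℝ 1 curve (Ioi 0) := by
  intro t ht
  have ht' : t ≠ 0 := (mem_Ioi.1 ht).ne'
  refine ContDiffAt.contDiffWithinAt ?_
  unfold curve
  refine ((Complex.ofRealCLM.contDiff.contDiffAt.comp t (Real.contDiffAt_sqrt ht')).mul
    (contDiff_tip.contDiffAt.comp t (Real.contDiffAt_rpow_const_of_ne ht'))).add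
    (Complex.ofRealCLM.contDiff.contDiffAt.comp t (Real.contDiffAt_rpow_const_of_ne ht'))

lemma sqrt_mul_rpow {t : ℝ} (ht : 0 < t) : √t * t ^ (-(1 : ℝ) / 6) = t ^ ((1 : ℝ) / 3) := by
  rw [Real.sqrt_eq_rpow, ← Real.rpow_add ht]
  norm_num

lemma continuousOn_curve : ContinuousOn curve (Ici 0) := by
  intro t ht
  rcases (mem_Ici.1 ht).eq_or_lt with rfl | ht
  · have hlim : Tendsto (fun t : ℝ => t ^ ((1 : ℝ) / 3) + 2 * √t + t ^ ((1 : ℝ) / 3)) (𝓝[Ici 0] 0)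
        (𝓝 0) := by
      have h1 : Continuous fun t : ℝ => t ^ ((1 : ℝ) / 3) :=
        continuous_id.rpow_const fun _ => Or.inr (by norm_num)
      have h2 : Continuous fun t : ℝ => t ^ ((1 : ℝ) / 3) + 2 * √t + t ^ ((1 : ℝ) / 3) := by
        fun_prop
      have := (h2.tendsto 0).mono_left (nhdsWithin_le_nhds (s := Ici 0))
      simpa using this
    unfold ContinuousWithinAt
    rw [curve_zero]
    refine tendsto_zero_iff_norm_tendsto_zero.2 (squeeze_zero' (Eventually.of_forall fun _ =>
      norm_nonneg _) ?_ hlim)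
    filter_upwards [self_mem_nhdsWithin] with t ht
    rcases (mem_Ici.1 ht).eq_or_lt with rfl | ht
    · simp [curve_zero]
    · unfold curve
      refine (norm_add_le _ _).trans ?_
      rw [norm_mul, Complex.norm_real, Complex.norm_real, Real.norm_eq_abs, Real.norm_eq_abs,
        abs_of_nonneg (Real.sqrt_nonneg t), abs_of_nonneg (Real.rpow_nonneg ht.le _)]
      have h1 := norm_tip_le (t ^ (-(1 : ℝ) / 6))
      rw [abs_of_nonneg (Real.rpow_nonneg ht.le _)] at h1
      have h2 := mul_le_mul_of_nonneg_left h1 (Real.sqrt_nonneg t)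
      rw [mul_add, sqrt_mul_rpow ht] at h2
      linarith
  · exact (contDiffOn_curve.continuousOn.continuousAt (Ioi_mem_nhds ht)).continuousWithinAt

namespace IsLoewnerOn

variable {c : ℝ} {ξ ξ' : ℝ → ℝ} {g g' : ℝ → ℂ} {a b : ℝ}

lemma congr_drive (h : IsLoewnerOn c ξ g a b) (hξ : EqOn ξ ξ' (Ioo a b)) :
    IsLoewnerOn c ξ' g a b :=
  ⟨h.continuousOn, fun x hx => hξ hx ▸ h.hasDerivAt x hx, h.im_pos⟩

lemma congr (h : IsLoewnerOn c ξ g a b) (hg : EqOn g' g (Icc a b)) : IsLoewnerOn c ξ g' a b := by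
  refine ⟨h.continuousOn.congr hg, fun x hx => ?_, fun x hx => by rw [hg hx]; exact h.im_pos x hx⟩
  rw [hg (Ioo_subset_Icc_self hx)]
  refine (h.hasDerivAt x hx).congr_of_eventuallyEq ?_
  filter_upwards [Icc_mem_nhds hx.1 hx.2] with y hy using hg hy

/-- Brownian scaling of the Löwner equation combined with a translation. -/
lemma rescale (h : IsLoewnerOn c ξ g a b) {k : ℝ} (hk : 0 < k) (d : ℝ) :
    IsLoewnerOn c (fun x => (ξ (k ^ 2 * x) - d) / k) (fun x => (g (k ^ 2 * x) - d) / k)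
      (a / k ^ 2) (b / k ^ 2) := by
  have hk2 : 0 < k ^ 2 := by positivity
  have hkc : (k : ℂ) ≠ 0 := by exact_mod_cast hk.ne'
  have hm : ∀ x ∈ Icc (a / k ^ 2) (b / k ^ 2), k ^ 2 * x ∈ Icc a b := by
    intro x hx
    have h1 := hx.1
    have h2 := hx.2
    rw [div_le_iff₀ hk2] at h1
    rw [le_div_iff₀ hk2] at h2
    constructor <;> linarith
  refine ⟨?_, fun x hx => ?_, fun x hx => ?_⟩
  · exact ((h.continuousOn.comp (by fun_prop) hm).sub continuousOn_const).div_const _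
  · have hx' := hm x (Ioo_subset_Icc_self hx)
    have h1 : k ^ 2 * x ∈ Ioo a b := by
      have h1 := hx.1
      have h2 := hx.2
      rw [div_lt_iff₀ hk2] at h1
      rw [lt_div_iff₀ hk2] at h2
      constructor <;> linarith
    have h2 := (h.hasDerivAt _ h1).scomp x ((hasDerivAt_id x).const_mul (k ^ 2))
    refine ((h2.sub_const (d : ℂ)).div_const (k : ℂ)).congr_deriv ?_
    have n1 := sub_ofReal_ne_zero (h.im_pos _ hx') (ξ (k ^ 2 * x))
    push_cast
    rw [← sub_div, Complex.real_smul]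
    have e : (g (k ^ 2 * x) - d - (ξ (k ^ 2 * x) - d) : ℂ) = g (k ^ 2 * x) - ξ (k ^ 2 * x) := by ring
    rw [e]
    push_cast
    field_simp
  · have := h.im_pos _ (hm x hx)
    rw [Complex.div_ofReal_im]
    simp only [sub_im, ofReal_im, sub_zero]
    positivity

end IsLoewnerOn

/-- The cubic root driving function. -/
noncomputable def cubeRoot (t : ℝ) : ℝ := t ^ ((1 : ℝ) / 3)

lemma continuous_cubeRoot : Continuous cubeRoot :=
  continuous_id.rpow_const fun _ => Or.inr (by norm_num)

lemma sqrt_mul_drive {t x : ℝ} (ht : 0 < t) (hx : x ≤ 1) :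
    √t * drive (t ^ (-(1 : ℝ) / 6)) x = cubeRoot (t * (1 - x)) - cubeRoot t := by
  unfold drive cubeRoot
  rw [Real.mul_rpow ht.le (by linarith), ← sqrt_mul_rpow ht]
  ring

/-- Forward trajectories turn into backward trajectories. -/
lemma IsLoewnerOn.normalise {g : ℝ → ℂ} {r t : ℝ} (h : IsLoewnerOn 2 cubeRoot g 0 r) (ht : 0 < t)
    : IsLoewnerOn (-2) (drive (t ^ (-(1 : ℝ) / 6)))
      (fun x => (g (t * (1 - x)) - cubeRoot t) / (√t : ℝ)) (1 - r / t) 1 := by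
  have hs := Real.sqrt_pos.2 ht
  have h1 := (h.rescale hs (cubeRoot t)).reflect 1
  simp only [Real.sq_sqrt ht.le, zero_div, sub_zero] at h1
  refine h1.congr_drive fun x hx => ?_
  change _ / _ = _
  rw [← sqrt_mul_drive ht hx.2.le]
  field_simp

/-- Backward trajectories turn into forward trajectories. -/
lemma IsLoewnerOn.denormalise {P : ℝ → ℂ} {a t : ℝ} (ht : 0 < t)
    (h : IsLoewnerOn (-2) (drive (t ^ (-(1 : ℝ) / 6))) P a 1) :
    IsLoewnerOn 2 cubeRoot (fun s => (√t : ℝ) * P (1 - s / t) + cubeRoot t) 0 (t * (1 - a)) := by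
  have hs := Real.sqrt_pos.2 ht
  have hsc : ((√t : ℝ) : ℂ) ≠ 0 := by exact_mod_cast hs.ne'
  have h1 := (h.reflect 1).rescale (inv_pos.2 hs) (-(cubeRoot t / √t))
  simp only [inv_pow, Real.sq_sqrt ht.le, sub_self, zero_mul, neg_neg, div_inv_eq_mul] at h1
  have h2 := h1.congr_drive (ξ' := cubeRoot) fun s hs' => ?_
  · rw [mul_comm t]
    refine h2.congr fun s _ => ?_
    push_cast
    rw [div_inv_eq_mul, ← div_eq_inv_mul]
    field_simp
    ring
  · have h3 := sqrt_mul_drive ht (x := 1 - t⁻¹ * s) ?_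
    · have e : t * (1 - (1 - t⁻¹ * s)) = s := by field_simp; ring
      rw [e] at h3
      change (_ - _) * √t = _
      have : cubeRoot t / √t * √t = cubeRoot t := by field_simp
      linarith
    · have := hs'.1.le
      have : 0 ≤ t⁻¹ * s := by positivity
      linarith

lemma IsTipSolution.mono {A α a a' : ℝ} {P : ℝ → ℂ} (h : IsTipSolution A α P a) (ha : a ≤ a')
    (ha' : a' ≤ 1 / (8 * A ^ 2)) : IsTipSolution A α P a' :=
  ⟨h.toIsLoewnerOn.mono ha le_rfl, h.nonneg.trans ha, ha',
    fun x hx => h.sector x ⟨ha.trans hx.1, hx.2⟩, fun x hx => h.im_sq x ⟨ha.trans hx.1, hx.2⟩⟩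

/-- A backward trajectory emanating from the real line does not leave a sector. -/
lemma sector_of_vanishing_im {A α σ x₁ : ℝ} {P : ℝ → ℂ} (hA : 1 ≤ A) (hα : |α| ≤ A)
    (h : ∀ a ∈ Ioc 0 x₁, IsLoewnerOn (-2) (drive α) P a x₁)
    (h0 : ∀ η > 0, ∃ x ∈ Ioo 0 x₁, (P x).im < η) (him : ∀ x ∈ Ioc 0 x₁, (P x).im ^ 2 ≤ 4 * x)
    (hx₀ : 0 < x₁) (hx₁ : x₁ ≤ 1 / (8 * A ^ 2)) (hσ : |σ| = 1) :
    σ * ((P x₁).re - drive α x₁) ≤ (P x₁).im := by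
  by_contra! hcon
  have hx8 : x₁ ≤ 1 / 8 := hx₁.trans (one_div_eight_mul_sq_le hA)
  have hipos : ∀ x ∈ Ioc 0 x₁, 0 < (P x).im := fun x hx => (h x hx).im_pos x ⟨le_rfl, hx.2⟩
  have hA2 : A ^ 2 * x₁ ≤ 1 / 8 := by
    rw [le_div_iff₀ (by positivity)] at hx₁; linarith
  have hAim : ∀ x ∈ Ioc 0 x₁, A * (P x).im < 2 := by
    intro x hx
    refine lt_of_pow_lt_pow_left₀ 2 (by norm_num) ?_
    have h1 := him x hx
    have h2 : A ^ 2 * (P x).im ^ 2 ≤ A ^ 2 * (4 * x₁) := by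
      gcongr; linarith [hx.2]
    nlinarith
  have hR : ∀ x ∈ Ioc 0 x₁, (P x).im ≤ σ * ((P x).re - drive α x) := by
    intro x hx
    by_contra! hlt
    have := (h x hx).sector hA hα hx.2 hx.1.le hx₁
      (fun y hy => hAim y ⟨hx.1.trans_le hy.1, hy.2⟩) hσ hlt
    linarith
  set R : ℝ → ℝ := fun x => σ * ((P x).re - drive α x) with hRdef
  have hR1 : 0 < R x₁ := (hipos x₁ ⟨hx₀, le_rfl⟩).trans hcon
  set m := min (R x₁ / 2) (1 / (2 * A)) with hm
  have hmpos : 0 < m := lt_min (by positivity) (by positivity)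
  have hσ2 : σ ^ 2 = 1 := by rw [← sq_abs, hσ, one_pow]
  have hmR : ∀ x ∈ Ioc 0 x₁, m ≤ R x := by
    intro x hx
    by_contra! hlt
    have hd : ∀ y ∈ Ioo x x₁, ∃ d, |d| ≤ |α| ∧ HasDerivAt R
        (σ * (-2 * ((P y).re - drive α y) / (((P y).re - drive α y) ^ 2 + (P y).im ^ 2) - d)) y := by
      intro y hy
      obtain ⟨d, hd, hd'⟩ := exists_hasDerivAt_drive α (hx.1.trans hy.1).le (hy.2.le.trans hx8)
      refine ⟨d, hd, ?_⟩
      have := (((h x hx).hasDerivAt y hy).complex_re.sub hd').const_mul σ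
      rwa [div_sub_ofReal_re] at this
    choose! d hd hd' using hd
    have := nonpos_of_deriv_neg_of_eq_zero (f := fun y => R y - m) hx.2
      ((continuousOn_const.mul ((h x hx).continuousOn_re.sub
        (continuous_drive α).continuousOn)).sub continuousOn_const)
      (fun y hy => (hd' y hy).sub_const m) (by linarith) ?_
    · have : m ≤ R x₁ / 2 := min_le_left _ _
      linarith
    · intro y hy hz
      have hy' : y ∈ Ioc 0 x₁ := ⟨hx.1.trans hy.1, hy.2.le⟩
      have hRy : R y = m := by linarith
      have h1 := hR y hy'
      have h2 := hipos y hy'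
      have h3 : ((P y).re - drive α y) ^ 2 = m ^ 2 := by
        rw [← hRy, hRdef, mul_pow, hσ2, one_mul]
      have h4 : (P y).im ^ 2 ≤ m ^ 2 := by
        gcongr; rw [← hRy]; exact h1
      have h5 : σ * (-2 * ((P y).re - drive α y) /
          (((P y).re - drive α y) ^ 2 + (P y).im ^ 2) - d y) =
          -(2 * R y / (m ^ 2 + (P y).im ^ 2)) - σ * d y := by
        rw [h3, hRdef]; ring
      rw [h5, hRy]
      have h6 : -(σ * d y) ≤ A := by
        refine (neg_le_abs _).trans ?_
        rw [abs_mul, hσ, one_mul]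
        exact (hd y hy).trans hα
      have h7 : 1 / m ≤ 2 * m / (m ^ 2 + (P y).im ^ 2) := by
        rw [div_le_div_iff₀ hmpos (by positivity)]
        nlinarith
      have h8 : 2 * A ≤ 1 / m := by
        have : m ≤ 1 / (2 * A) := min_le_right _ _
        rwa [le_div_comm₀ (by positivity) (by positivity)] at this
      linarith
  have hgr : ∀ x ∈ Ioo 0 x₁, (P x₁).im ≤ Real.exp (2 / m ^ 2 * x₁) * (P x).im := by
    intro x hx
    have hx' : x ∈ Ioc 0 x₁ := Ioo_subset_Ioc_self hx
    have := norm_le_of_re_conj_mul_deriv_le (Z := fun y => (((P y).im : ℝ) : ℂ)) (L := 2 / m ^ 2)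
      (K := 0) hx.2.le (by positivity) le_rfl
      (continuous_ofReal.comp_continuousOn (h x hx').continuousOn_im)
      (fun y hy => ((h x hx').hasDerivAt y hy).complex_im.ofReal_comp) ?_
    · have p1 := hipos x₁ ⟨hx₀, le_rfl⟩
      have p2 := hipos x hx'
      simp only [Complex.norm_real, Real.norm_eq_abs, abs_of_pos p1, abs_of_pos p2, zero_mul,
        add_zero] at this
      refine this.trans ?_
      have := hx.1.le
      gcongr
      linarith
    · intro y hy
      have hy' : y ∈ Ioc 0 x₁ := ⟨hx.1.trans hy.1, hy.2.le⟩
      rw [conj_ofReal, ← ofReal_mul, ofReal_re, div_sub_ofReal_im, zero_mul, add_zero,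
        Complex.norm_real, Real.norm_eq_abs, sq_abs]
      have h1 : m ^ 2 ≤ ((P y).re - drive α y) ^ 2 + (P y).im ^ 2 := by
        have h2 : m ^ 2 ≤ R y ^ 2 := by gcongr; exact hmR y hy'
        have h3 : R y ^ 2 = ((P y).re - drive α y) ^ 2 := by
          rw [hRdef, mul_pow, hσ2, one_mul]
        nlinarith [sq_nonneg (P y).im]
      calc (P y).im * -(-2 * (P y).im / (((P y).re - drive α y) ^ 2 + (P y).im ^ 2)) =
            2 / (((P y).re - drive α y) ^ 2 + (P y).im ^ 2) * (P y).im ^ 2 := by ring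
        _ ≤ 2 / m ^ 2 * (P y).im ^ 2 := by gcongr
  set E := Real.exp (2 / m ^ 2 * x₁)
  have hE : 0 < E := Real.exp_pos _
  have p1 := hipos x₁ ⟨hx₀, le_rfl⟩
  obtain ⟨x, hx, hlt⟩ := h0 ((P x₁).im / E) (by positivity)
  have := hgr x hx
  rw [lt_div_iff₀ hE] at hlt
  linarith

/-- A backward trajectory emanating from the real line ends at the tip. -/
lemma eq_tip_of_vanishing_im {α : ℝ} {P : ℝ → ℂ}
    (h : ∀ a ∈ Ioc 0 1, IsLoewnerOn (-2) (drive α) P a 1)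
    (h0 : ∀ η > 0, ∃ x ∈ Ioc 0 1, (P x).im < η) : P 1 = tip α := by
  set A := max 1 |α|
  have hA : 1 ≤ A := le_max_left _ _
  have hα : |α| ≤ A := le_max_right _ _
  have hX1 := one_div_eight_mul_sq_le hA
  set X := 1 / (8 * A ^ 2) with hX
  have hXpos : 0 < X := by positivity
  have hsmall : ∀ x ∈ Ioc (0 : ℝ) 1, ∀ η > 0, ∃ y ∈ Ioo 0 x, (P y).im < η := by
    intro x hx η hη
    obtain ⟨y, hy, hlt⟩ := h0 η hη
    have hm : 0 < min (x / 2) y := lt_min (by linarith [hx.1]) hy.1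
    refine ⟨min (x / 2) y, ⟨hm, (min_le_left _ _).trans_lt (by linarith [hx.1])⟩, ?_⟩
    have hm1 : min (x / 2) y ≤ y := min_le_right _ _
    exact (((h _ ⟨hm, hm1.trans hy.2⟩).mono le_rfl hy.2).im_mono hm1).trans_lt hlt
  have him : ∀ x ∈ Ioc (0 : ℝ) 1, (P x).im ^ 2 ≤ 4 * x := by
    intro x hx
    refine le_of_forall_pos_le_add fun η hη => ?_
    obtain ⟨y, hy, hlt⟩ := hsmall x hx (√η) (Real.sqrt_pos.2 hη)
    have hy' : y ∈ Ioc (0 : ℝ) 1 := ⟨hy.1, hy.2.le.trans hx.2⟩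
    have h1 := ((h y hy').mono le_rfl hx.2).im_sq_le hy.2.le
    have h2 := (h y hy').im_pos y ⟨le_rfl, hy'.2⟩
    have h3 : (P y).im ^ 2 ≤ η := by
      rw [← Real.sq_sqrt hη.le]; gcongr
    linarith [hy.1]
  have hsec : ∀ x ∈ Ioc 0 X, |(P x).re - drive α x| ≤ (P x).im := by
    intro x hx
    have hx1 : x ≤ 1 := by linarith [hx.2]
    have key : ∀ σ : ℝ, |σ| = 1 → σ * ((P x).re - drive α x) ≤ (P x).im := fun σ hσ =>
      sector_of_vanishing_im hA hα (fun a ha => (h a ⟨ha.1, ha.2.trans hx1⟩).mono le_rfl hx1)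
        (hsmall x ⟨hx.1, hx1⟩) (fun y hy => him y ⟨hy.1, hy.2.trans hx1⟩) hx.1 hx.2 hσ
    have h1 := key 1 (by simp)
    have h2 := key (-1) (by simp)
    rw [abs_le]
    constructor <;> linarith
  have hsq : ∀ x ∈ Ioc 0 X, 2 * x ≤ (P x).im ^ 2 := by
    intro x hx
    have hx1 : x ≤ 1 := by linarith [hx.2]
    refine le_of_forall_pos_le_add fun η hη => ?_
    have hm : 0 < min x (η / 2) := lt_min hx.1 (by positivity)
    have hm1 : min x (η / 2) ≤ x := min_le_left _ _
    have h1 := ((h (min x (η / 2)) ⟨hm, hm1.trans hx1⟩).mono le_rfl hx1).im_sq_ge hm1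
      fun y hy => hsec y ⟨hm.trans hy.1, hy.2.le.trans hx.2⟩
    have : min x (η / 2) ≤ η / 2 := min_le_right _ _
    nlinarith [sq_nonneg (P (min x (η / 2))).im]
  have htip : ∀ a ∈ Ioc 0 X, IsTipSolution A α P a := fun a ha =>
    ⟨h a ⟨ha.1, by linarith [ha.2]⟩, ha.1.le, ha.2, fun x hx => hsec x ⟨ha.1.trans_le hx.1, hx.2⟩,
      fun x hx => hsq x ⟨ha.1.trans_le hx.1, hx.2⟩⟩
  have hP0 : Tendsto P (𝓝[>] 0) (𝓝 0) := by
    have hlim : Tendsto (fun x : ℝ => √(4 * x) + |drive α x| + √(4 * x)) (𝓝[>] 0) (𝓝 0) := by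
      have hc := continuous_drive α
      have : Continuous fun x : ℝ => √(4 * x) + |drive α x| + √(4 * x) := by fun_prop
      have := (this.tendsto 0).mono_left (nhdsWithin_le_nhds (s := Ioi 0))
      simpa using this
    refine tendsto_zero_iff_norm_tendsto_zero.2 (squeeze_zero' (Eventually.of_forall fun _ =>
      norm_nonneg _) ?_ hlim)
    filter_upwards [Ioc_mem_nhdsGT hXpos] with x hx
    refine (Complex.norm_le_abs_re_add_abs_im _).trans ?_
    have h1 := hsec x hx
    have hx' : x ∈ Ioc (0 : ℝ) 1 := ⟨hx.1, by linarith [hx.2]⟩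
    have h2 : (P x).im ≤ √(4 * x) := Real.le_sqrt_of_sq_le (him x hx')
    have h3 := (htip x hx).im_pos x ⟨le_rfl, hx'.2⟩
    rw [abs_of_pos h3]
    have h4 := abs_add_le ((P x).re - drive α x) (drive α x)
    rw [sub_add_cancel] at h4
    linarith
  have key : ∀ᶠ ε in 𝓝[>] (0 : ℝ), ‖tipApprox α ε 1 - P 1‖ ≤ Real.exp ((8 * A ^ 2) ^ 2) * ε := by
    filter_upwards [eventually_isTipSolution hA hα, self_mem_nhdsWithin] with ε hε hε0
    have hp0 : Tendsto (tipApprox α ε) (𝓝[>] 0) (𝓝 (ε * I)) := by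
      have := hε.continuousOn 0 (left_mem_Icc.2 zero_le_one)
      unfold ContinuousWithinAt at this
      rw [(tipApprox_spec α hε0).1] at this
      refine this.mono_left ?_
      rw [← nhdsWithin_Ioc_eq_nhdsGT (zero_lt_one' ℝ)]
      exact nhdsWithin_mono _ Ioc_subset_Icc_self
    have hlim := ((hp0.sub hP0).norm.add_const (8 * A ^ 2 * |α - α| * (1 - 0))).const_mul
      (Real.exp ((8 * A ^ 2) ^ 2))
    rw [sub_self, abs_zero, mul_zero, zero_mul, add_zero, sub_zero, norm_mul, norm_I, mul_one,
      Complex.norm_real, Real.norm_eq_abs, abs_of_pos (show 0 < ε from hε0)] at hlim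
    refine ge_of_tendsto hlim ?_
    filter_upwards [Ioc_mem_nhdsGT hXpos] with a ha
    have := (htip a ha).norm_sub_le_of_drive hA (hε.mono ha.1.le ha.2) (x := 1)
      ⟨by linarith [ha.2], le_rfl⟩
    simpa using this
  have hlim : Tendsto (fun ε : ℝ => Real.exp ((8 * A ^ 2) ^ 2) * ε) (𝓝[>] 0) (𝓝 0) := by
    have : Continuous fun ε : ℝ => Real.exp ((8 * A ^ 2) ^ 2) * ε := by fun_prop
    have := (this.tendsto 0).mono_left (nhdsWithin_le_nhds (s := Ioi 0))
    simpa using this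
  have h1 := tendsto_iff_norm_sub_tendsto_zero.2
    (squeeze_zero' (Eventually.of_forall fun _ => norm_nonneg _) key hlim)
  exact tendsto_nhds_unique h1 (tendsto_tip α)

/-- No backward trajectory starting inside the half-plane ends at the tip. -/
lemma IsLoewnerOn.ne_tip {α : ℝ} {P : ℝ → ℂ} (h : IsLoewnerOn (-2) (drive α) P 0 1) :
    P 1 ≠ tip α := by
  intro heq
  set A := max 1 |α|
  have hA : 1 ≤ A := le_max_left _ _
  have hα : |α| ≤ A := le_max_right _ _
  set c := (P 0).im with hc
  have hcpos : 0 < c := h.im_pos 0 (left_mem_Icc.2 zero_le_one)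
  set κ := min (1 / 2) (c ^ 2 / 8) with hκ
  have hκpos : 0 < κ := by positivity
  have hκ1 : κ ≤ 1 / 2 := min_le_left _ _
  have hκ2 : κ ≤ c ^ 2 / 8 := min_le_right _ _
  have hPim : ∀ x ∈ Icc κ 1, c ≤ (P x).im := fun x hx =>
    (h.mono le_rfl hx.2).im_mono (hκpos.le.trans hx.1)
  set δ := min c (√(κ / (4 * A ^ 2)))
  have hδ : 0 < δ := by positivity
  have hr := (h.mono hκpos.le le_rfl).reflect 1
  set C := Real.exp (2 / δ ^ 2 * (1 - κ)) with hC
  have key : ∀ᶠ ε in 𝓝[>] (0 : ℝ), ‖tipApprox α ε κ - P κ‖ ≤ C * ‖tipApprox α ε 1 - P 1‖ := by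
    filter_upwards [eventually_isTipSolution hA hα] with ε hε
    have hr' := (hε.toIsLoewnerOn.mono hκpos.le le_rfl).reflect 1
    have := hr.norm_sub_le hr' (by linarith) hδ
      (fun x hx => (min_le_left _ _).trans (hPim _ ⟨by linarith [hx.2], by linarith [hx.1]⟩))
      fun x hx => ?_
    · simpa [hC] using this
    · have hx' : 1 - x ∈ Icc κ 1 := ⟨by linarith [hx.2], by linarith [hx.1]⟩
      have hx'' : 1 - x ∈ Icc (0 : ℝ) 1 := ⟨hκpos.le.trans hx'.1, hx'.2⟩
      refine (min_le_right _ _).trans ?_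
      rw [Real.sqrt_le_left (hε.im_pos _ hx'').le]
      refine le_trans ?_ (hε.im_sq' hA hx'')
      gcongr
      exact hx'.1
  have hlim : Tendsto (fun ε => C * ‖tipApprox α ε 1 - P 1‖) (𝓝[>] 0) (𝓝 0) := by
    have := ((tendsto_tip α).sub_const (P 1)).norm.const_mul C
    rwa [heq, sub_self, norm_zero, mul_zero, ← heq] at this
  have h1 := tendsto_iff_norm_sub_tendsto_zero.2
    (squeeze_zero' (Eventually.of_forall fun _ => norm_nonneg _) key hlim)
  have h2 : (P κ).im ^ 2 ≤ 4 * κ := by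
    have hl : Tendsto (fun ε : ℝ => ε ^ 2 + 4 * κ) (𝓝[>] 0) (𝓝 (4 * κ)) := by
      have : Continuous fun ε : ℝ => ε ^ 2 + 4 * κ := by fun_prop
      have := (this.tendsto 0).mono_left (nhdsWithin_le_nhds (s := Ioi 0))
      simpa using this
    refine le_of_tendsto_of_tendsto (((Complex.continuous_im.tendsto _).comp h1).pow 2) hl ?_
    filter_upwards [self_mem_nhdsWithin] with ε hε
    have h3 := ((tipApprox_spec α hε).2.mono le_rfl (by linarith : κ ≤ 1)).im_sq_le hκpos.le
    have h4 : (tipApprox α ε 0).im = ε := by simp [(tipApprox_spec α hε).1]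
    rw [h4, sub_zero] at h3
    exact h3
  have h3 := hPim κ ⟨le_rfl, by linarith⟩
  have h4 : c ^ 2 ≤ (P κ).im ^ 2 := by gcongr
  nlinarith

lemma norm_truncated_sub_le {c δ b d : ℝ} {ξ : ℝ → ℝ} {g G : ℝ → ℂ} (hδ : 0 < δ) (hd : 0 ≤ d)
    (hdb : d ≤ b)
    (hg : ∀ x ∈ Icc 0 b, HasDerivWithinAt g (truncatedField c δ ξ x (g x)) (Icc 0 b) x)
    (hG : IsLoewnerOn c ξ G 0 d) (him : ∀ x ∈ Icc 0 d, δ ≤ (G x).im) :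
    ‖g d - G d‖ ≤ Real.exp (|c| / δ ^ 2 * d) * ‖g 0 - G 0‖ := by
  have hs : Icc 0 d ⊆ Icc 0 b := Icc_subset_Icc le_rfl hdb
  have := norm_le_of_re_conj_mul_deriv_le (Z := fun x => g x - G x) (L := |c| / δ ^ 2) (K := 0)
    hd (by positivity) le_rfl
    (ContinuousOn.sub (fun x hx => ((hg x (hs hx)).continuousWithinAt).mono hs) hG.continuousOn)
    (fun x hx => ((hg x (hs (Ioo_subset_Icc_self hx))).hasDerivAt
      (Icc_mem_nhds hx.1 (hx.2.trans_le hdb))).sub (hG.hasDerivAt x hx)) ?_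
  · simpa using this
  · intro x hx
    rw [← truncatedField_of_le x (him x (Ioo_subset_Icc_self hx)), zero_mul, add_zero]
    refine (Complex.re_le_norm _).trans ?_
    rw [norm_mul, RCLike.norm_conj]
    have := norm_truncatedField_sub_le (c := c) (ξ := ξ) hδ x (g x) (G x)
    calc _ ≤ ‖g x - G x‖ * (|c| / δ ^ 2 * ‖g x - G x‖) := by gcongr
      _ = _ := by ring

namespace IsLoewnerOn

variable {c : ℝ} {ξ : ℝ → ℝ} {g G : ℝ → ℂ} {a b t : ℝ}

/-- Solutions depend continuously on the initial value; in particular nearby solutions exist. -/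
lemma exists_near (hξ : Continuous ξ) (ht : 0 ≤ t) {δ : ℝ} (hδ : 0 < δ)
    (hG : IsLoewnerOn c ξ G 0 t) (him : ∀ x ∈ Icc 0 t, 2 * δ ≤ (G x).im) {w : ℂ}
    (hw : Real.exp (|c| / δ ^ 2 * t) * ‖w - G 0‖ ≤ δ) :
    ∃ g : ℝ → ℂ, g 0 = w ∧ IsLoewnerOn c ξ g 0 t ∧ ∀ x ∈ Icc 0 t, δ ≤ (g x).im := by
  obtain ⟨g, g0, hg⟩ := exists_truncated_solution c hδ hξ ht w
  have hgim : ∀ x ∈ Icc 0 t, δ ≤ (g x).im := by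
    intro x hx
    have h1 := norm_truncated_sub_le hδ hx.1 hx.2 hg (hG.mono le_rfl hx.2)
      fun y hy => (by linarith : δ ≤ 2 * δ).trans (him y ⟨hy.1, hy.2.trans hx.2⟩)
    have h2 : ‖g x - G x‖ ≤ δ := by
      refine h1.trans (le_trans ?_ hw)
      rw [g0]
      gcongr
      exact hx.2
    have h3 := (Complex.abs_im_le_norm (g x - G x)).trans h2
    rw [abs_le, sub_im] at h3
    linarith [him x hx, h3.1]
  exact ⟨g, g0, isLoewnerOn_of_truncated hδ le_rfl hg hgim, hgim⟩

/-- The equation also holds, with one-sided derivatives, at the end points. -/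
lemma hasDerivWithinAt (h : IsLoewnerOn c ξ g a b) (hξ : Continuous ξ) (hab : a < b) {x : ℝ}
    (hx : x ∈ Icc a b) : HasDerivWithinAt g (c / (g x - ξ x)) (Icc a b) x := by
  have hdiff : DifferentiableOn ℝ g (Ioo a b) :=
    fun y hy => (h.hasDerivAt y hy).differentiableAt.differentiableWithinAt
  have hcont : ContinuousWithinAt (fun y => (c : ℂ) / (g y - ξ y)) (Icc a b) x :=
    continuousWithinAt_const.div ((h.continuousOn x hx).sub
      (continuous_ofReal.comp hξ).continuousWithinAt) (sub_ofReal_ne_zero (h.im_pos x hx) _)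
  have hlim : Tendsto (deriv g) (𝓝[Ioo a b] x) (𝓝 (c / (g x - ξ x))) := by
    refine (hcont.mono_left (nhdsWithin_mono _ Ioo_subset_Icc_self)).congr' ?_
    filter_upwards [self_mem_nhdsWithin] with y hy using (h.hasDerivAt y hy).deriv.symm
  have hgc := (h.continuousOn x hx).mono (Ioo_subset_Icc_self (a := a) (b := b))
  rcases hx.1.eq_or_lt with rfl | hax
  · rw [nhdsWithin_Ioo_eq_nhdsGT hab] at hlim
    exact (hasDerivWithinAt_Ici_of_tendsto_deriv hdiff hgc (Ioo_mem_nhdsGT hab) hlim).mono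
      Icc_subset_Ici_self
  rcases hx.2.eq_or_lt with rfl | hxb
  · rw [nhdsWithin_Ioo_eq_nhdsLT hab] at hlim
    exact (hasDerivWithinAt_Iic_of_tendsto_deriv hdiff hgc (Ioo_mem_nhdsLT hab) hlim).mono
      Icc_subset_Iic_self
  · exact (h.hasDerivAt x ⟨hax, hxb⟩).hasDerivWithinAt

lemma norm_slope_sub_le {g₁ g₂ g₃ : ℝ → ℂ} (h₁ : IsLoewnerOn c ξ g₁ 0 t)
    (h₂ : IsLoewnerOn c ξ g₂ 0 t) (h₃ : IsLoewnerOn c ξ g₃ 0 t) (ht : 0 ≤ t) {δ : ℝ} (hδ : 0 < δ)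
    (hd₁ : ∀ x ∈ Icc 0 t, δ ≤ (g₁ x).im) (hd₂ : ∀ x ∈ Icc 0 t, δ ≤ (g₂ x).im)
    (hd₃ : ∀ x ∈ Icc 0 t, δ ≤ (g₃ x).im) (n12 : g₂ 0 ≠ g₁ 0) (n13 : g₃ 0 ≠ g₁ 0) :
    ‖(g₂ t - g₁ t) / (g₂ 0 - g₁ 0) - (g₃ t - g₁ t) / (g₃ 0 - g₁ 0)‖ ≤
      Real.exp (|c| / δ ^ 2 * t) * (|c| / δ ^ 3 * Real.exp (|c| / δ ^ 2 * t) ^ 2 * t) *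
        ‖g₃ 0 - g₂ 0‖ := by
  set E := Real.exp (|c| / δ ^ 2 * t) with hE
  have hEpos : 0 < E := Real.exp_pos _
  have hcmp : ∀ {g g' : ℝ → ℂ}, IsLoewnerOn c ξ g 0 t → IsLoewnerOn c ξ g' 0 t →
      (∀ x ∈ Icc 0 t, δ ≤ (g x).im) → (∀ x ∈ Icc 0 t, δ ≤ (g' x).im) → ∀ x ∈ Icc 0 t,
      ‖g' x - g x‖ ≤ E * ‖g' 0 - g 0‖ := by
    intro g g' h h' hd hd' x hx
    refine ((h.mono le_rfl hx.2).norm_sub_le (h'.mono le_rfl hx.2) hx.1 hδ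
      (fun y hy => hd y ⟨hy.1, hy.2.trans hx.2⟩)
      (fun y hy => hd' y ⟨hy.1, hy.2.trans hx.2⟩)).trans ?_
    rw [sub_zero, hE]
    gcongr
    exact hx.2
  have m12 := sub_ne_zero.2 n12
  have m13 := sub_ne_zero.2 n13
  have := norm_le_of_re_conj_mul_deriv_le
    (Z := fun x => (g₂ x - g₁ x) / (g₂ 0 - g₁ 0) - (g₃ x - g₁ x) / (g₃ 0 - g₁ 0))
    (L := |c| / δ ^ 2) (K := |c| / δ ^ 3 * E ^ 2 * ‖g₃ 0 - g₂ 0‖) ht (by positivity)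
    (by positivity)
    (((h₂.continuousOn.sub h₁.continuousOn).div_const _).sub
      ((h₃.continuousOn.sub h₁.continuousOn).div_const _))
    (fun y hy => (((h₂.hasDerivAt y hy).sub (h₁.hasDerivAt y hy)).div_const _).sub
      (((h₃.hasDerivAt y hy).sub (h₁.hasDerivAt y hy)).div_const _)) ?_
  · simp only [div_self m12, div_self m13, sub_self, norm_zero, sub_zero, zero_add] at this
    refine this.trans (le_of_eq ?_)
    ring
  · intro y hy
    have hy' := Ioo_subset_Icc_self hy
    have c23 := hcmp h₂ h₃ hd₂ hd₃ y hy'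
    have c13 := hcmp h₁ h₃ hd₁ hd₃ y hy'
    have n1 := sub_ofReal_ne_zero (h₁.im_pos y hy') (ξ y)
    have n2 := sub_ofReal_ne_zero (h₂.im_pos y hy') (ξ y)
    have n3 := sub_ofReal_ne_zero (h₃.im_pos y hy') (ξ y)
    have k1 := (hd₁ y hy').trans (im_le_norm_sub (g₁ y) (ξ y))
    have k2 := (hd₂ y hy').trans (im_le_norm_sub (g₂ y) (ξ y))
    have k3 := (hd₃ y hy').trans (im_le_norm_sub (g₃ y) (ξ y))
    have e21 : g₂ y - g₁ y = (g₂ y - ξ y) - (g₁ y - ξ y) := by ring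
    have e31 : g₃ y - g₁ y = (g₃ y - ξ y) - (g₁ y - ξ y) := by ring
    have e32 : g₃ y - g₂ y = (g₃ y - ξ y) - (g₂ y - ξ y) := by ring
    rw [e31] at c13
    rw [e32] at c23
    rw [e21, e31]
    set u₁ := g₁ y - ξ y
    set u₂ := g₂ y - ξ y
    set u₃ := g₃ y - ξ y
    set k := g₂ 0 - g₁ 0
    set l := g₃ 0 - g₁ 0
    set Z := (u₂ - u₁) / k - (u₃ - u₁) / l with hZ
    have e : ((c : ℂ) / u₂ - c / u₁) / k - (c / u₃ - c / u₁) / l =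
        -(c / (u₁ * u₂)) * Z - c * ((u₃ - u₁) / l) * ((u₃ - u₂) / (u₁ * u₂ * u₃)) := by
      rw [hZ]
      field_simp
      ring
    rw [e]
    refine (Complex.re_le_norm _).trans ?_
    rw [norm_mul, RCLike.norm_conj]
    have b1 : ‖-((c : ℂ) / (u₁ * u₂)) * Z‖ ≤ |c| / δ ^ 2 * ‖Z‖ := by
      rw [norm_mul, norm_neg, norm_div, norm_mul, Complex.norm_real, Real.norm_eq_abs, sq]
      gcongr
    have b2 : ‖(u₃ - u₁) / l‖ ≤ E := by
      rw [norm_div, div_le_iff₀ (norm_pos_iff.2 m13)]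
      exact c13
    have b3 : ‖(u₃ - u₂) / (u₁ * u₂ * u₃)‖ ≤ E * ‖g₃ 0 - g₂ 0‖ / δ ^ 3 := by
      rw [norm_div, norm_mul, norm_mul, show δ ^ 3 = δ * δ * δ by ring]
      gcongr
    have b4 : ‖(c : ℂ) * ((u₃ - u₁) / l) * ((u₃ - u₂) / (u₁ * u₂ * u₃))‖ ≤
        |c| * E * (E * ‖g₃ 0 - g₂ 0‖ / δ ^ 3) := by
      rw [norm_mul, norm_mul (c : ℂ), Complex.norm_real, Real.norm_eq_abs]
      gcongr
    calc _ ≤ ‖Z‖ * (|c| / δ ^ 2 * ‖Z‖ + |c| * E * (E * ‖g₃ 0 - g₂ 0‖ / δ ^ 3)) := by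
          gcongr
          exact (_root_.norm_sub_le _ _).trans (add_le_add b1 b4)
      _ = _ := by ring

end IsLoewnerOn

/-- The points whose Löwner trajectory survives up to time `t`. -/
def loewnerDomain (c : ℝ) (ξ : ℝ → ℝ) (t : ℝ) : Set ℂ :=
  {z | ∃ g : ℝ → ℂ, g 0 = z ∧ IsLoewnerOn c ξ g 0 t}

section domain

variable {c t : ℝ} {ξ : ℝ → ℝ} {f : ℂ → ℝ → ℂ}

lemma loewnerDomain_anti {s : ℝ} (hst : s ≤ t) : loewnerDomain c ξ t ⊆ loewnerDomain c ξ s :=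
  fun _ ⟨g, g0, hg⟩ => ⟨g, g0, hg.mono le_rfl hst⟩

lemma im_pos_of_mem_loewnerDomain (ht : 0 ≤ t) {z : ℂ} (hz : z ∈ loewnerDomain c ξ t) :
    0 < z.im := by
  obtain ⟨g, rfl, hg⟩ := hz
  exact hg.im_pos 0 (left_mem_Icc.2 ht)

/-- The Löwner map is holomorphic. -/
lemma differentiableOn_loewnerDomain (hξ : Continuous ξ) (ht : 0 ≤ t)
    (hf : ∀ z ∈ loewnerDomain c ξ t, f z 0 = z ∧ IsLoewnerOn c ξ (f z) 0 t) :
    DifferentiableOn ℂ (fun z => f z t) (loewnerDomain c ξ t) := by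
  intro z hz
  obtain ⟨h0, h⟩ := hf z hz
  obtain ⟨η, hη, him⟩ := h.exists_le_im
  set δ := η / 2 with hδ'
  have hδ : 0 < δ := by positivity
  have him2 : ∀ x ∈ Icc 0 t, 2 * δ ≤ (f z x).im := fun x hx => by
    have := him x hx
    rw [hδ']; linarith
  set E := Real.exp (|c| / δ ^ 2 * t) with hE
  have hEpos : 0 < E := Real.exp_pos _
  have hnear : ∀ w ∈ loewnerDomain c ξ t, ‖w - z‖ < δ / E → ∀ x ∈ Icc 0 t, δ ≤ (f w x).im := by
    intro w hw hwz x hx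
    rw [lt_div_iff₀ hEpos] at hwz
    obtain ⟨g, g0, hg, hgim⟩ := h.exists_near hξ ht hδ him2 (w := w) (by rw [h0]; linarith)
    rw [(hf w hw).2.eqOn hg (by rw [g0, (hf w hw).1]) hx]
    exact hgim x hx
  suffices hs : ∃ d, HasDerivWithinAt (fun z => f z t) d (loewnerDomain c ξ t) z by
    obtain ⟨d, hd⟩ := hs
    exact hd.differentiableWithinAt
  refine exists_hasDerivWithinAt_of_slope (C := E * (|c| / δ ^ 3 * E ^ 2 * t))
    (show 0 < δ / E by positivity) ?_
  intro y hy w hw hyz hwz hyr hwr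
  have h1 := h.norm_slope_sub_le (hf y hy).2 (hf w hw).2 ht hδ
    (fun x hx => le_trans (by linarith) (him2 x hx)) (hnear y hy hyr) (hnear w hw hwr)
    (by rwa [h0, (hf y hy).1]) (by rwa [h0, (hf w hw).1])
  rw [h0, (hf y hy).1, (hf w hw).1] at h1
  rw [slope_def_field, slope_def_field]
  refine h1.trans ?_
  gcongr
  have := norm_sub_le (w - z) (y - z)
  rw [sub_sub_sub_cancel_right] at this
  linarith

/-- The Löwner map is a bijection onto the half-plane. -/
lemma bijOn_loewnerDomain (hξ : Continuous ξ) (ht : 0 ≤ t)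
    (hf : ∀ z ∈ loewnerDomain 2 ξ t, f z 0 = z ∧ IsLoewnerOn 2 ξ (f z) 0 t) :
    BijOn (fun z => f z t) (loewnerDomain 2 ξ t) {w : ℂ | 0 < w.im} := by
  refine ⟨fun z hz => (hf z hz).2.im_pos t (right_mem_Icc.2 ht), fun z hz w hw hzw => ?_,
    fun w hw => ?_⟩
  · have h1 := ((hf z hz).2.reflect t).eqOn ((hf w hw).2.reflect t)
      (by simpa using hzw) (x := t) (by simpa using ht)
    simpa [(hf z hz).1, (hf w hw).1] using h1
  · have hξ' : Continuous fun x => ξ (t - x) := hξ.comp (continuous_const.sub continuous_id)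
    obtain ⟨g, g0, -, hg⟩ := exists_isLoewnerOn_neg_two hξ' ht hw
    have h1 := hg.reflect t
    simp only [sub_sub_cancel, sub_self, sub_zero, neg_neg] at h1
    have hz : g t ∈ loewnerDomain 2 ξ t := ⟨_, by simp, h1⟩
    refine ⟨g t, hz, ?_⟩
    have := (hf _ hz).2.eqOn h1 (by simp [(hf _ hz).1]) (right_mem_Icc.2 ht)
    simpa [g0] using this

/-- A trajectory which does not survive up to time `t` approaches the real line before. -/
lemma exists_vanishing_im (hξ : Continuous ξ) (ht : 0 ≤ t) {z : ℂ} (hz : 0 < z.im)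
    (hzt : z ∉ loewnerDomain c ξ t) : ∃ τ ≤ t, ∃ G : ℝ → ℂ, G 0 = z ∧
      (∀ r ∈ Ico 0 τ, IsLoewnerOn c ξ G 0 r) ∧ ∀ η > 0, ∃ s ∈ Ico 0 τ, (G s).im < η := by
  set S := {r | r ∈ Icc 0 t ∧ z ∈ loewnerDomain c ξ r} with hS
  have hS0 : (0 : ℝ) ∈ S := ⟨left_mem_Icc.2 ht, fun _ => z, rfl, continuousOn_const,
    fun x hx => absurd (hx.1.trans hx.2) (lt_irrefl _), fun _ _ => hz⟩
  have hbdd : BddAbove S := ⟨t, fun r hr => hr.1.2⟩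
  set τ := sSup S with hτ
  have hτ0 : 0 ≤ τ := le_csSup hbdd hS0
  have hτt : τ ≤ t := csSup_le ⟨0, hS0⟩ fun r hr => hr.1.2
  have hmem : ∀ r ∈ Ico 0 τ, z ∈ loewnerDomain c ξ r := by
    intro r hr
    obtain ⟨r', hr', hlt⟩ := exists_lt_of_lt_csSup ⟨0, hS0⟩ hr.2
    exact loewnerDomain_anti hlt.le hr'.2
  have hF : ∀ r, ∃ g : ℝ → ℂ, g 0 = z ∧ (r ∈ Ico 0 τ → IsLoewnerOn c ξ g 0 r) := by
    intro r
    by_cases hr : r ∈ Ico 0 τ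
    · obtain ⟨g, g0, hg⟩ := hmem r hr
      exact ⟨g, g0, fun _ => hg⟩
    · exact ⟨fun _ => z, rfl, fun h => absurd h hr⟩
  choose F F0 hF using hF
  have hG : ∀ r ∈ Ico 0 τ, IsLoewnerOn c ξ (fun s => F s s) 0 r := by
    intro r hr
    refine (hF r hr).congr fun s hs => ?_
    exact (hF s ⟨hs.1, hs.2.trans_lt hr.2⟩).eqOn ((hF r hr).mono le_rfl hs.2)
      (by rw [F0, F0]) (right_mem_Icc.2 hs.1)
  refine ⟨τ, hτt, fun s => F s s, F0 0, hG, ?_⟩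
  by_contra! hcon
  obtain ⟨η, hη, hle⟩ := hcon
  set δ := min η z.im / 2 with hδ'
  have hδ : 0 < δ := by positivity
  have hδη : 2 * δ ≤ η := by rw [hδ']; linarith [min_le_left η z.im]
  have hδz : 2 * δ ≤ z.im := by rw [hδ']; linarith [min_le_right η z.im]
  obtain ⟨g, g0, hg⟩ := exists_truncated_solution c hδ hξ ht z
  have hgc : ContinuousOn g (Icc 0 t) := fun x hx => (hg x hx).continuousWithinAt
  have hgi : ContinuousOn (fun x => (g x).im) (Icc 0 t) :=
    Complex.continuous_im.comp_continuousOn hgc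
  have hlt : ∀ s ∈ Ico 0 τ, 2 * δ ≤ (g s).im := by
    intro s hs
    have := norm_truncated_sub_le hδ hs.1 (hs.2.le.trans hτt) hg (hG s hs) fun x hx =>
      le_trans (by linarith) (hle x ⟨hx.1, hx.2.trans_lt hs.2⟩)
    rw [g0, F0, sub_self, norm_zero, mul_zero, norm_le_zero_iff, sub_eq_zero] at this
    rw [this]
    exact hδη.trans (hle s hs)
  have hτm : τ ∈ Icc 0 t := ⟨hτ0, hτt⟩
  have hgτ : 2 * δ ≤ (g τ).im := by
    rcases hτ0.eq_or_lt with h0 | h0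
    · rw [← h0, g0]; exact hδz
    · have hcl : τ ∈ closure (Ico 0 τ) := by
        rw [closure_Ico h0.ne]; exact right_mem_Icc.2 hτ0
      exact ContinuousWithinAt.closure_le hcl continuousWithinAt_const
        ((hgi τ hτm).mono fun s hs => ⟨hs.1, hs.2.le.trans hτt⟩) hlt
  have hev := (hgi τ hτm).eventually_const_lt (show δ < (g τ).im by linarith)
  obtain ⟨ρ, hρ, hball⟩ := Metric.mem_nhdsWithin_iff.1 hev
  set s := min (τ + ρ / 2) t with hs
  have hst : s ≤ t := min_le_right _ _
  have hs0 : 0 ≤ s := le_min (by positivity) ht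
  have hsρ : s ≤ τ + ρ / 2 := min_le_left _ _
  have hgs : ∀ x ∈ Icc 0 s, δ ≤ (g x).im := by
    intro x hx
    rcases lt_or_ge x τ with h | h
    · exact le_trans (by linarith) (hlt x ⟨hx.1, h⟩)
    · refine (hball ⟨?_, hx.1, hx.2.trans hst⟩ : δ < (g x).im).le
      rw [Metric.mem_ball, Real.dist_eq, abs_of_nonneg (by linarith)]
      linarith [hx.2]
  have hsS : s ∈ S := ⟨⟨hs0, hst⟩, g, g0, isLoewnerOn_of_truncated hδ hst hg hgs⟩
  have h1 : s ≤ τ := le_csSup hbdd hsS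
  have h2 : s = t := by
    rcases min_choice (τ + ρ / 2) t with h | h
    · rw [← hs] at h; linarith
    · rw [← hs] at h; exact h
  exact hzt (h2 ▸ hsS.2)

end domain

lemma curve_eq (t : ℝ) : curve t = (√t : ℝ) * tip (t ^ (-(1 : ℝ) / 6)) + cubeRoot t := rfl

lemma curve_notMem_loewnerDomain {s t : ℝ} (hs : 0 < s) (hst : s ≤ t) :
    curve s ∉ loewnerDomain 2 cubeRoot t := by
  intro hmem
  obtain ⟨g, g0, hg⟩ := loewnerDomain_anti hst hmem
  have h := hg.normalise hs
  rw [div_self hs.ne', sub_self] at h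
  refine h.ne_tip ?_
  have hsc : ((√s : ℝ) : ℂ) ≠ 0 := by exact_mod_cast (Real.sqrt_pos.2 hs).ne'
  simp only [sub_self, mul_zero, g0, curve_eq, add_sub_cancel_right]
  exact mul_div_cancel_left₀ _ hsc

lemma curve_mem_loewnerDomain {s t : ℝ} (hs : 0 ≤ s) (hst : s < t) :
    curve t ∈ loewnerDomain 2 cubeRoot s := by
  have ht : 0 < t := hs.trans_lt hst
  have hst' : 0 < √t := Real.sqrt_pos.2 ht
  set α := t ^ (-(1 : ℝ) / 6) with hα
  set A := max 1 |α|
  have hA : 1 ≤ A := le_max_left _ _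
  set κ := 1 - s / t with hκ
  have hκ0 : 0 < κ := by
    rw [hκ, sub_pos, div_lt_one ht]; exact hst
  set δ := √t * √(κ / (4 * A ^ 2)) / 2 with hδ'
  have hδ : 0 < δ := by positivity
  set C := Real.exp (|(2 : ℝ)| / δ ^ 2 * s) with hC
  have hlim : Tendsto (fun ε => C * ‖curve t - ((√t : ℝ) * tipApprox α ε 1 + cubeRoot t)‖) (𝓝[>] 0)
      (𝓝 0) := by
    have := (((((tendsto_tip α).const_mul ((√t : ℝ) : ℂ)).add_const
      (cubeRoot t : ℂ)).const_sub (curve t)).norm).const_mul C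
    rwa [← curve_eq, sub_self, norm_zero, mul_zero] at this
  obtain ⟨ε, hε, hεδ⟩ := ((eventually_isTipSolution hA (le_max_right _ _ : |α| ≤ A)).and
    (hlim.eventually_le_const hδ)).exists
  have hmono := (hε.toIsLoewnerOn.mono hκ0.le le_rfl).denormalise ht
  have e : t * (1 - κ) = s := by rw [hκ]; field_simp; ring
  rw [e] at hmono
  have him : ∀ x ∈ Icc 0 s,
      2 * δ ≤ (((√t : ℝ) : ℂ) * tipApprox α ε (1 - x / t) + cubeRoot t).im := by
    intro x hx
    have hx1 : x / t ≤ s / t := by gcongr; exact hx.2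
    have hx0 : 0 ≤ x / t := div_nonneg hx.1 ht.le
    have hst1 : s / t < 1 := (div_lt_one ht).2 hst
    have hx' : 1 - x / t ∈ Icc (0 : ℝ) 1 := ⟨by linarith, by linarith⟩
    simp only [add_im, ofReal_im, add_zero, Complex.im_ofReal_mul]
    have : 2 * δ = √t * √(κ / (4 * A ^ 2)) := by rw [hδ']; ring
    rw [this]
    gcongr
    rw [Real.sqrt_le_left (hε.im_pos _ hx').le]
    refine le_trans ?_ (hε.im_sq' hA hx')
    have : κ ≤ 1 - x / t := by rw [hκ]; linarith
    gcongr
  obtain ⟨g, g0, hg, -⟩ := hmono.exists_near continuous_cubeRoot hs hδ him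
    (w := curve t) (by simpa [hC] using hεδ)
  exact ⟨g, g0, hg⟩

lemma exists_curve_eq {t : ℝ} (ht : 0 ≤ t) {z : ℂ} (hz : 0 < z.im)
    (hzt : z ∉ loewnerDomain 2 cubeRoot t) : z ∈ curve '' Ioc 0 t := by
  obtain ⟨τ, hτt, G, G0, hG, hvan⟩ := exists_vanishing_im continuous_cubeRoot ht hz hzt
  have hτ : 0 < τ := by
    obtain ⟨s, hs, -⟩ := hvan 1 one_pos
    exact hs.1.trans_lt hs.2
  have hsτ : 0 < √τ := Real.sqrt_pos.2 hτ
  refine ⟨τ, ⟨hτ, hτt⟩, ?_⟩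
  have h1 := eq_tip_of_vanishing_im (α := τ ^ (-(1 : ℝ) / 6))
    (P := fun x => (G (τ * (1 - x)) - cubeRoot τ) / (√τ : ℝ)) ?_ ?_
  · rw [curve_eq, ← h1, sub_self, mul_zero, G0]
    have hsc : ((√τ : ℝ) : ℂ) ≠ 0 := by exact_mod_cast hsτ.ne'
    field_simp
    ring
  · intro a ha
    have := (hG (τ * (1 - a)) ⟨mul_nonneg hτ.le (by linarith [ha.2]),
      by nlinarith [ha.1]⟩).normalise hτ
    rwa [mul_div_cancel_left₀ _ hτ.ne', sub_sub_cancel] at this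
  · intro η hη
    obtain ⟨s, hs, hlt⟩ := hvan (η * √τ) (by positivity)
    refine ⟨1 - s / τ, ⟨?_, ?_⟩, ?_⟩
    · rw [sub_pos, div_lt_one hτ]; exact hs.2
    · have := div_nonneg hs.1 hτ.le
      linarith
    · have e : τ * (1 - (1 - s / τ)) = s := by field_simp; ring
      rw [e, Complex.div_ofReal_im, div_lt_iff₀ hsτ]
      simpa using hlt

lemma loewnerDomain_cubeRoot {t : ℝ} (ht : 0 ≤ t) :
    loewnerDomain 2 cubeRoot t = {z : ℂ | 0 < z.im} \ curve '' Ioc 0 t := by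
  ext z
  refine ⟨fun hz => ⟨im_pos_of_mem_loewnerDomain ht hz, ?_⟩, fun hz => ?_⟩
  · rintro ⟨s, hs, rfl⟩
    exact curve_notMem_loewnerDomain hs.1 hs.2 hz
  · by_contra h
    exact hz.2 (exists_curve_eq ht hz.1 h)

lemma injOn_curve : InjOn curve (Ici 0) := by
  have key : ∀ s t : ℝ, 0 ≤ s → s < t → curve s ≠ curve t := by
    intro s t hs hst heq
    rcases hs.eq_or_lt with rfl | h0
    · have := im_curve_pos hst
      rw [← heq, curve_zero] at this
      simp at this
    · exact curve_notMem_loewnerDomain h0 le_rfl (heq ▸ curve_mem_loewnerDomain hs hst)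
  intro s hs t ht heq
  rcases lt_trichotomy s t with h | h | h
  · exact absurd heq (key s t hs h)
  · exact h
  · exact absurd heq.symm (key t s ht h)

/-- The chordal Löwner equation with driving function `t ^ (1/3)` generates, for small time,
a hull which is a slit along a `C¹` Jordan arc `γ` emanating from `0` (C¹ except possibly at
`γ 0 = 0`), and the Löwner map `z ↦ f z t` is a conformal bijection from the upper half-plane
minus the arc onto the upper half-plane. -/
theorem loewner_cubic_root_slit :
    ∃ T : ℝ, 0 < T ∧ ∃ γ : ℝ → ℂ,
      ContinuousOn γ (Icc 0 T) ∧
      InjOn γ (Icc 0 T) ∧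
      γ 0 = 0 ∧
      (∀ s ∈ Ioc 0 T, 0 < (γ s).im) ∧
      (∃ γ' : ℝ → ℂ, ContinuousOn γ' (Ioc 0 T) ∧
        ∀ s ∈ Ioc 0 T, HasDerivWithinAt γ (γ' s) (Ioc 0 T) s) ∧
      ∀ t ∈ Ioc 0 T,
        ∃ f : ℂ → ℝ → ℂ,
          (∀ z : ℂ, 0 < z.im → z ∉ γ '' Ioc 0 t →
            f z 0 = z ∧
            (∀ s ∈ Icc 0 t, 0 < (f z s).im) ∧
            (∀ s ∈ Icc 0 t,
              HasDerivWithinAt (f z)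
                (2 / (f z s - ((s ^ ((1 : ℝ)/3) : ℝ) : ℂ))) (Icc 0 t) s)) ∧
          DifferentiableOn ℂ (fun z => f z t) ({z : ℂ | 0 < z.im} \ γ '' Ioc 0 t) ∧
          BijOn (fun z => f z t) ({z : ℂ | 0 < z.im} \ γ '' Ioc 0 t) {w : ℂ | 0 < w.im} := by
  refine ⟨1, one_pos, curve, continuousOn_curve.mono Icc_subset_Ici_self,
    injOn_curve.mono Icc_subset_Ici_self, curve_zero, fun s hs => im_curve_pos hs.1,
    ⟨deriv curve, ?_, fun s hs => ?_⟩, fun t ht => ?_⟩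
  · exact (contDiffOn_curve.continuousOn_deriv_of_isOpen isOpen_Ioi le_rfl).mono Ioc_subset_Ioi_self
  · exact ((contDiffOn_curve.differentiableOn one_ne_zero).differentiableAt
      (Ioi_mem_nhds hs.1)).hasDerivAt.hasDerivWithinAt
  · have hf : ∀ z, ∃ g : ℝ → ℂ, z ∈ loewnerDomain 2 cubeRoot t →
        g 0 = z ∧ IsLoewnerOn 2 cubeRoot g 0 t := by
      intro z
      by_cases hz : z ∈ loewnerDomain 2 cubeRoot t
      · obtain ⟨g, hg⟩ := hz
        exact ⟨g, fun _ => hg⟩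
      · exact ⟨fun _ => z, fun h => absurd h hz⟩
    choose f hf using hf
    rw [← loewnerDomain_cubeRoot ht.1.le]
    refine ⟨f, fun z hz hzc => ?_, differentiableOn_loewnerDomain continuous_cubeRoot ht.1.le hf,
      bijOn_loewnerDomain continuous_cubeRoot ht.1.le hf⟩
    have hmem : z ∈ loewnerDomain 2 cubeRoot t := by
      rw [loewnerDomain_cubeRoot ht.1.le]
      exact ⟨hz, hzc⟩
    obtain ⟨h0, h⟩ := hf z hmem
    exact ⟨h0, h.im_pos, fun s hs => by
      simpa [cubeRoot] using h.hasDerivWithinAt continuous_cubeRoot ht.1 hs⟩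
end

section
/- Let the coefficients a_n^+ be defined recursively by a_1^+ = 1, a_2^+ = 6, and a_n^+ = -∑_{k=2}^{n-1} k a_k^+ a_{n+1-k}^+ for n ≥ 3. Then for every n ≥ 2 the inequalities 6^(n-1) (n-1)! ≤ |a_n^+| ≤ 12^(n-1) n^(n-3) hold. -/
open Finset

/-- A sum weighted by `k` over an antidiagonal-type convolution symmetrizes. -/
lemma two_mul_sum_mul_convolution (b : ℕ → ℝ) (n : ℕ) :
    2 * ∑ k ∈ Icc 2 (n - 1), (k : ℝ) * b k * b (n + 1 - k) =
      (n + 1) * ∑ k ∈ Icc 2 (n - 1), b k * b (n + 1 - k) := by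
  have hflip : ∑ k ∈ Icc 2 (n - 1), (k : ℝ) * b k * b (n + 1 - k) =
      ∑ k ∈ Icc 2 (n - 1), ((n : ℝ) + 1 - k) * (b k * b (n + 1 - k)) := by
    refine Finset.sum_nbij' (fun k => n + 1 - k) (fun k => n + 1 - k) ?_ ?_ ?_ ?_ ?_
    · intro k hk; simp only [mem_Icc] at hk ⊢; omega
    · intro k hk; simp only [mem_Icc] at hk ⊢; omega
    · intro k hk; simp only [mem_Icc] at hk; omega
    · intro k hk; simp only [mem_Icc] at hk; omega
    · intro k hk
      simp only [mem_Icc] at hk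
      rw [Nat.cast_sub (by omega), Nat.sub_sub_self (by omega)]
      push_cast
      ring
  rw [two_mul]
  nth_rewrite 2 [hflip]
  rw [← sum_add_distrib, mul_sum]
  exact sum_congr rfl fun k _ => by ring

lemma add_six_mul_add_four_pow_le (m : ℕ) :
    ((m : ℝ) + 6) * (m + 4) ^ (m + 1) ≤ (m + 5) ^ (m + 2) := by
  have hpos : (0 : ℝ) < m + 4 := by positivity
  have hB := one_add_mul_le_pow (a := 1 / ((m : ℝ) + 4))
    (le_trans (by norm_num) (by positivity : (0 : ℝ) ≤ _)) (m + 2)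
  have hfac : ((m : ℝ) + 5) = (m + 4) * (1 + 1 / (m + 4)) := by field_simp; ring
  calc ((m : ℝ) + 6) * (m + 4) ^ (m + 1)
      ≤ (2 * m + 6) * (m + 4) ^ (m + 1) := by
        gcongr
        linarith [(Nat.cast_nonneg m : (0 : ℝ) ≤ m)]
    _ = (m + 4) ^ (m + 2) * (1 + ((m + 2 : ℕ) : ℝ) * (1 / (m + 4))) := by
        push_cast
        rw [pow_succ _ (m + 1)]
        field_simp
        ring
    _ ≤ (m + 4) ^ (m + 2) * (1 + 1 / (m + 4)) ^ (m + 2) := by gcongr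
    _ = (m + 5) ^ (m + 2) := by rw [hfac, mul_pow]

lemma pow_mul_factorial_le_of_convolution {b : ℕ → ℝ} (h2 : b 2 = 6)
    (hrec : ∀ n, 3 ≤ n → b n = ∑ k ∈ Icc 2 (n - 1), (k : ℝ) * b k * b (n + 1 - k))
    {n : ℕ} (hn : 2 ≤ n) :
    (6 : ℝ) ^ (n - 1) * ((n - 1).factorial : ℝ) ≤ b n := by
  induction n using Nat.strong_induction_on with
  | _ n ih =>
    obtain rfl | hn3 := hn.eq_or_lt
    · norm_num [h2]
    have hnn : ∀ k, 2 ≤ k → k < n → 0 ≤ b k := fun k hk hkn =>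
      le_trans (by positivity) (ih k hkn hk)
    obtain ⟨m, rfl⟩ : ∃ m, n = m + 3 := ⟨n - 3, by omega⟩
    have hterm := single_le_sum (f := fun k : ℕ => (k : ℝ) * b k * b (m + 3 + 1 - k))
      (s := Icc 2 (m + 3 - 1)) (fun k hk => by
        simp only [mem_Icc] at hk
        have h₁ := hnn k (by omega) (by omega)
        have h₂ := hnn (m + 3 + 1 - k) (by omega) (by omega)
        positivity) (a := m + 2) (by simp)
    rw [← hrec _ (by omega)] at hterm
    refine le_trans ?_ hterm
    have hprev := ih (m + 2) (by omega) (by omega)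
    simp only [show m + 3 + 1 - (m + 2) = 2 by omega, h2, show m + 3 - 1 = m + 2 by omega,
      show m + 2 - 1 = m + 1 by omega] at hprev ⊢
    calc (6 : ℝ) ^ (m + 2) * ((m + 2).factorial : ℝ)
        = ((m + 2 : ℕ) : ℝ) * (6 ^ (m + 1) * ((m + 1).factorial : ℝ)) * 6 := by
          rw [Nat.factorial_succ (m + 1)]; push_cast; ring
      _ ≤ ((m + 2 : ℕ) : ℝ) * b (m + 2) * 6 := by gcongr

lemma le_pow_mul_pow_of_convolution {b : ℕ → ℝ} (h2 : b 2 = 6)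
    (hrec : ∀ n, 3 ≤ n → b n = ∑ k ∈ Icc 2 (n - 1), (k : ℝ) * b k * b (n + 1 - k))
    {n : ℕ} (hn : 3 ≤ n) :
    b n ≤ (12 : ℝ) ^ (n - 1) * (n : ℝ) ^ (n - 3) := by
  have hnn : ∀ k, 2 ≤ k → 0 ≤ b k := fun k hk =>
    le_trans (by positivity) (pow_mul_factorial_le_of_convolution h2 hrec hk)
  have h3 : b 3 = 72 := by
    rw [hrec 3 le_rfl]; norm_num [h2]
  induction n using Nat.strong_induction_on with
  | _ n ih =>
    obtain rfl | hn4 := hn.eq_or_lt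
    · norm_num [h3]
    obtain rfl | hn5 := (show 4 ≤ n from hn4).eq_or_lt
    · rw [hrec 4 (by norm_num), show Icc 2 (4 - 1) = ({2, 3} : Finset ℕ) from rfl]
      norm_num [h2, h3]
    obtain ⟨m, rfl⟩ : ∃ m, n = m + 5 := ⟨n - 5, by omega⟩
    have hsym := two_mul_sum_mul_convolution b (m + 5)
    rw [← hrec _ (by omega)] at hsym
    have hsplit : ∑ k ∈ Icc 2 (m + 5 - 1), b k * b (m + 5 + 1 - k) =
        12 * b (m + 4) + ∑ k ∈ Icc 3 (m + 3), b k * b (m + 6 - k) := by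
      rw [show m + 5 - 1 = m + 3 + 1 by omega, sum_Icc_succ_top (by omega),
        ← add_sum_Ioc_eq_sum_Icc (by omega), show Ioc 2 (m + 3) = Icc 3 (m + 3) by ext; simp; omega]
      simp only [show m + 5 + 1 - 2 = m + 4 by omega, show m + 5 + 1 - (m + 3 + 1) = 2 by omega,
        h2]
      ring
    have hend : b (m + 4) ≤ (12 : ℝ) ^ (m + 3) * ((m : ℝ) + 4) ^ (m + 1) := by
      simpa using ih (m + 4) (by omega) (by omega)
    have hmid : ∀ k ∈ Icc 3 (m + 3),
        b k * b (m + 6 - k) ≤ (12 : ℝ) ^ (m + 4) * ((m : ℝ) + 4) ^ m := by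
      intro k hk
      rw [mem_Icc] at hk
      have hbase : ∀ j : ℕ, j ≤ m + 3 → (j : ℝ) ≤ m + 4 := fun j hj => by
        exact_mod_cast hj.trans (by omega)
      calc b k * b (m + 6 - k)
          ≤ ((12 : ℝ) ^ (k - 1) * (k : ℝ) ^ (k - 3)) *
            (12 ^ (m + 6 - k - 1) * ((m + 6 - k : ℕ) : ℝ) ^ (m + 6 - k - 3)) :=
            mul_le_mul (ih k (by omega) hk.1) (ih (m + 6 - k) (by omega) (by omega))
              (hnn _ (by omega)) (by positivity)
        _ ≤ ((12 : ℝ) ^ (k - 1) * ((m : ℝ) + 4) ^ (k - 3)) *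
            (12 ^ (m + 6 - k - 1) * ((m : ℝ) + 4) ^ (m + 6 - k - 3)) := by
            gcongr
            · exact hbase k hk.2
            · exact hbase _ (by omega)
        _ = (12 : ℝ) ^ ((k - 1) + (m + 6 - k - 1)) *
            ((m : ℝ) + 4) ^ ((k - 3) + (m + 6 - k - 3)) := by
            rw [pow_add, pow_add]; ring
        _ = (12 : ℝ) ^ (m + 4) * ((m : ℝ) + 4) ^ m := by
            congr 2 <;> omega
    have hsum := sum_le_card_nsmul _ _ _ hmid
    rw [Nat.card_Icc, nsmul_eq_mul, show m + 3 + 1 - 3 = m + 1 by omega] at hsum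
    push_cast at hsum
    have hsum' : ∑ k ∈ Icc 3 (m + 3), b k * b (m + 6 - k) ≤
        (12 : ℝ) ^ (m + 4) * ((m : ℝ) + 4) ^ (m + 1) := by
      refine hsum.trans ?_
      rw [pow_succ ((m : ℝ) + 4), mul_left_comm, mul_comm ((m : ℝ) + 1)]
      gcongr
      norm_num
    have htotal : 12 * b (m + 4) + ∑ k ∈ Icc 3 (m + 3), b k * b (m + 6 - k) ≤
        2 * ((12 : ℝ) ^ (m + 4) * ((m : ℝ) + 4) ^ (m + 1)) := by
      rw [pow_succ (12 : ℝ)] at hsum' ⊢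
      linarith
    rw [hsplit] at hsym
    have hfinal := mul_le_mul_of_nonneg_left (add_six_mul_add_four_pow_le m)
      (by positivity : (0 : ℝ) ≤ 12 ^ (m + 4))
    have hscaled := mul_le_mul_of_nonneg_left htotal (by positivity : (0 : ℝ) ≤ (m : ℝ) + 6)
    push_cast at hsym
    rw [show (m : ℝ) + 5 + 1 = m + 6 by ring] at hsym
    simp only [show m + 5 - 1 = m + 4 by omega, show m + 5 - 3 = m + 2 by omega]
    push_cast
    linarith

/-- Lemma 1: the coefficients `a n` of the singular solution `g⁺(0,τ)` of the transformed
Löwner equation satisfy `6^(n-1) (n-1)! ≤ |a n| ≤ 12^(n-1) n^(n-3)` for `n ≥ 2`. -/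
theorem loewner_coeff_plus_bounds (a : ℕ → ℝ)
    (h1 : a 1 = 1) (h2 : a 2 = 6)
    (hrec : ∀ n, 3 ≤ n →
      a n = -∑ k ∈ Finset.Icc 2 (n - 1), (k : ℝ) * a k * a (n + 1 - k)) :
    ∀ n, 2 ≤ n →
      (6 : ℝ) ^ (n - 1) * (Nat.factorial (n - 1) : ℝ) ≤ |a n| ∧
      |a n| ≤ (12 : ℝ) ^ (n - 1) * (n : ℝ) ^ ((n : ℝ) - 3) := by
  intro n hn
  let b : ℕ → ℝ := fun n => (-1) ^ n * a n
  have hb2 : b 2 = 6 := by simp [b, h2]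
  have hbrec : ∀ n, 3 ≤ n → b n = ∑ k ∈ Icc 2 (n - 1), (k : ℝ) * b k * b (n + 1 - k) := by
    intro n hn
    simp only [b]
    rw [hrec n hn, mul_neg, mul_sum, ← sum_neg_distrib]
    refine sum_congr rfl fun k hk => ?_
    rw [mem_Icc] at hk
    have hsign : (-1 : ℝ) ^ k * (-1) ^ (n + 1 - k) = -(-1) ^ n := by
      rw [← pow_add, show k + (n + 1 - k) = n + 1 by omega, pow_succ, mul_neg_one]
    linear_combination (-(k : ℝ) * a k * a (n + 1 - k)) * hsign
  have hlow := pow_mul_factorial_le_of_convolution hb2 hbrec hn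
  have habs : |a n| = b n := by
    rw [← abs_of_nonneg (le_trans (by positivity) hlow : 0 ≤ b n)]
    simp [b, abs_mul]
  rw [habs]
  refine ⟨hlow, ?_⟩
  obtain rfl | hn3 := hn.eq_or_lt
  · rw [hb2, show ((2 : ℕ) : ℝ) - 3 = -1 by norm_num, Real.rpow_neg_one]
    norm_num
  · have hcast : (n : ℝ) - 3 = ((n - 3 : ℕ) : ℝ) := by
      rw [Nat.cast_sub hn3]; norm_num
    rw [hcast, Real.rpow_natCast]
    exact le_pow_mul_pow_of_convolution hb2 hbrec hn3
end

section
/- Let the coefficients a_n^+ be defined recursively by a_1^+ = 1, a_2^+ = 6, and a_n^+ = -∑_{k=2}^{n-1} k a_k^+ a_{n+1-k}^+ for n ≥ 3. Then for every complex number τ ≠ 0 the power series ∑_{n=1}^∞ a_n^+ τ^n diverges; in fact its terms a_n^+ τ^n are unbounded, so the radius of convergence of the series is 0. -/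
open Finset

/-- If `a 2 > 0` and `a` satisfies the quadratic recursion, then its signs alternate. -/
theorem neg_one_pow_mul_pos_of_quadratic_rec {a : ℕ → ℝ} (h2 : 0 < a 2)
    (hrec : ∀ n, 3 ≤ n →
      a n = -∑ k ∈ Finset.Icc 2 (n - 1), (k : ℝ) * a k * a (n + 1 - k))
    (n : ℕ) (hn : 2 ≤ n) : 0 < (-1) ^ n * a n := by
  induction n using Nat.strong_induction_on with
  | _ n ih =>
    rcases hn.eq_or_lt with rfl | hn3
    · simpa using h2
    · rw [hrec n hn3, mul_neg, ← neg_mul, Finset.mul_sum]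
      refine Finset.sum_pos (fun k hk => ?_) ⟨2, by simp; omega⟩
      rw [Finset.mem_Icc] at hk
      have hk_pos : (0 : ℝ) < k := by exact_mod_cast (by omega : 0 < k)
      have hsign : -(-1 : ℝ) ^ n = (-1) ^ k * (-1) ^ (n + 1 - k) := by
        rw [← pow_add, show k + (n + 1 - k) = n + 1 by omega, pow_succ]
        ring
      rw [hsign]
      calc (0 : ℝ) < k * (((-1) ^ k * a k) * ((-1) ^ (n + 1 - k) * a (n + 1 - k))) :=
            mul_pos hk_pos (mul_pos (ih k (by omega) hk.1) (ih _ (by omega) (by omega)))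
        _ = _ := by ring

/-- The last summand of the recursion bounds the alternating coefficients from below. -/
theorem mul_le_neg_one_pow_mul_of_quadratic_rec {a : ℕ → ℝ} (h2 : 0 < a 2)
    (hrec : ∀ n, 3 ≤ n →
      a n = -∑ k ∈ Finset.Icc 2 (n - 1), (k : ℝ) * a k * a (n + 1 - k))
    (n : ℕ) (hn : 2 ≤ n) :
    a 2 * n * ((-1) ^ n * a n) ≤ (-1) ^ (n + 1) * a (n + 1) := by
  have hpos := neg_one_pow_mul_pos_of_quadratic_rec h2 hrec
  rw [hrec (n + 1) (by omega), mul_neg, ← neg_mul, Finset.mul_sum, Nat.add_sub_cancel]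
  have hterm : ∀ k ∈ Finset.Icc 2 n,
      -(-1 : ℝ) ^ (n + 1) * (k * a k * a (n + 1 + 1 - k)) =
        k * (((-1) ^ k * a k) * ((-1) ^ (n + 1 + 1 - k) * a (n + 1 + 1 - k))) := by
    intro k hk
    rw [Finset.mem_Icc] at hk
    have hsign : -(-1 : ℝ) ^ (n + 1) = (-1) ^ k * (-1) ^ (n + 1 + 1 - k) := by
      rw [← pow_add, show k + (n + 1 + 1 - k) = n + 1 + 1 by omega, pow_succ _ (n + 1)]
      ring
    rw [hsign]
    ring
  rw [Finset.sum_congr rfl hterm]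
  refine le_trans (le_of_eq ?_) (Finset.single_le_sum (fun k hk => ?_)
    (Finset.right_mem_Icc.mpr hn))
  · rw [show n + 1 + 1 - n = 2 by omega]
    ring
  · rw [Finset.mem_Icc] at hk
    exact mul_nonneg k.cast_nonneg
      (mul_pos (hpos k hk.1) (hpos _ (by omega))).le

/-- The factorial lower bound `6 ^ n * n ! ≤ |a (n + 1)|`. -/
theorem pow_mul_factorial_le_abs_of_quadratic_rec {a : ℕ → ℝ} (h1 : a 1 = 1) (h2 : a 2 = 6)
    (hrec : ∀ n, 3 ≤ n →
      a n = -∑ k ∈ Finset.Icc 2 (n - 1), (k : ℝ) * a k * a (n + 1 - k))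
    (n : ℕ) : 6 ^ n * (n.factorial : ℝ) ≤ |a (n + 1)| := by
  rcases n.eq_zero_or_pos with rfl | hn
  · simp [h1]
  · refine le_trans ?_ (le_of_le_of_eq (le_abs_self ((-1) ^ (n + 1) * a (n + 1)))
      (by simp [abs_mul]))
    induction n, hn using Nat.le_induction with
    | base => norm_num [h2]
    | succ n hn ih =>
      have hstep := mul_le_neg_one_pow_mul_of_quadratic_rec (by rw [h2]; norm_num) hrec
        (n + 1) (by omega)
      rw [h2] at hstep
      refine le_trans ?_ hstep
      calc (6 : ℝ) ^ (n + 1) * ((n + 1).factorial : ℝ)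
          = 6 * (n + 1 : ℕ) * (6 ^ n * (n.factorial : ℝ)) := by
            rw [Nat.factorial_succ]; push_cast; ring
        _ ≤ _ := by gcongr

/-- The power series `∑ a n τ^n` of the singular solution `g⁺(0,τ)` diverges for every
`τ ≠ 0`: its terms are unbounded (hence the radius of convergence is `0`) and the series
is not summable. -/
theorem loewner_series_plus_diverges (a : ℕ → ℝ)
    (h1 : a 1 = 1) (h2 : a 2 = 6)
    (hrec : ∀ n, 3 ≤ n →
      a n = -∑ k ∈ Finset.Icc 2 (n - 1), (k : ℝ) * a k * a (n + 1 - k)) :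
    ∀ τ : ℂ, τ ≠ 0 →
      ¬ BddAbove (Set.range fun n : ℕ => ‖(a n : ℂ) * τ ^ n‖) ∧
      ¬ Summable (fun n : ℕ => (a n : ℂ) * τ ^ n) := by
  intro τ hτ
  have hunbdd : ¬ BddAbove (Set.range fun n : ℕ => ‖(a n : ℂ) * τ ^ n‖) := by
    rintro ⟨C, hC⟩
    have hr : 0 < ‖τ‖ := norm_pos_iff.mpr hτ
    have hle : ∀ n : ℕ, ‖τ‖ ≤ C * ((6 * ‖τ‖)⁻¹ ^ n / (n.factorial : ℝ)) := by
      intro n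
      have hterm : ‖(a (n + 1) : ℂ) * τ ^ (n + 1)‖ ≤ C := hC ⟨n + 1, rfl⟩
      rw [norm_mul, norm_pow, Complex.norm_real, Real.norm_eq_abs] at hterm
      have hbound : 6 ^ n * (n.factorial : ℝ) * ‖τ‖ ^ (n + 1) ≤ C :=
        le_trans (mul_le_mul_of_nonneg_right
          (pow_mul_factorial_le_abs_of_quadratic_rec h1 h2 hrec n) (by positivity)) hterm
      have hfac : (0 : ℝ) < n.factorial := by exact_mod_cast n.factorial_pos
      rw [inv_pow, div_eq_mul_inv, ← mul_inv, ← div_eq_mul_inv, le_div_iff₀ (by positivity)]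
      refine le_of_eq_of_le ?_ hbound
      ring
    have hlim := (FloorSemiring.tendsto_pow_div_factorial_atTop (6 * ‖τ‖)⁻¹).const_mul C
    rw [mul_zero] at hlim
    exact absurd (ge_of_tendsto' hlim hle) (not_le.mpr hr)
  exact ⟨hunbdd, fun hs => hunbdd hs.tendsto_atTop_zero.norm.bddAbove_range⟩
end

section
/- Let the coefficients a_n^- be defined recursively by a_1^- = 0, a_2^- = -3, and a_n^- = (1/n) ∑_{k=2}^{n-1} k a_k^- a_{n+1-k}^- for n ≥ 3. Then for every n ≥ 2 the inequality |a_n^-| ≤ 12^(n-1) n^(n-3) holds. -/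
open Finset

/-- A sequence satisfying the Löwner coefficient recursion from `a 2 = -3` grows at most like
`3 ^ (n - 1) * (n - 2)!`. -/
lemma abs_le_three_pow_mul_factorial (a : ℕ → ℝ) (h2 : a 2 = -3)
    (hrec : ∀ n, 3 ≤ n →
      a n = (1 / (n : ℝ)) * ∑ k ∈ Finset.Icc 2 (n - 1), (k : ℝ) * a k * a (n + 1 - k)) (m : ℕ) :
    |a (m + 2)| ≤ 3 ^ (m + 1) * (m.factorial : ℝ) := by
  induction m using Nat.strong_induction_on with
  | _ m ih =>
  rcases m with _ | m
  · norm_num [h2]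
  have hn : (0 : ℝ) < ((m + 1 + 2 : ℕ) : ℝ) := by positivity
  have hterm : ∀ k ∈ Finset.Icc 2 (m + 1 + 2 - 1),
      |(k : ℝ) * a k * a (m + 1 + 2 + 1 - k)| ≤
        ((m + 1 + 2 : ℕ) : ℝ) * (3 ^ (m + 2) * (m.factorial : ℝ)) := by
    intro k hk
    rw [Finset.mem_Icc] at hk
    obtain ⟨i, rfl⟩ := Nat.exists_eq_add_of_le' hk.1
    obtain ⟨j, rfl⟩ : ∃ j, m = i + j := Nat.exists_eq_add_of_le (by lia)
    have hj : i + j + 1 + 2 + 1 - (i + 2) = j + 2 := by lia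
    have hfact : (i.factorial : ℝ) * j.factorial ≤ (i + j).factorial := by
      exact_mod_cast Nat.le_of_dvd (Nat.factorial_pos _)
        (Nat.factorial_mul_factorial_dvd_factorial_add i j)
    have hprod : |a (i + 2)| * |a (j + 2)| ≤ 3 ^ (i + j + 2) * ((i + j).factorial : ℝ) :=
      calc |a (i + 2)| * |a (j + 2)|
          ≤ (3 ^ (i + 1) * (i.factorial : ℝ)) * (3 ^ (j + 1) * (j.factorial : ℝ)) := by
            gcongr
            · exact ih i (by lia)
            · exact ih j (by lia)
        _ = 3 ^ (i + j + 2) * ((i.factorial : ℝ) * j.factorial) := by ring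
        _ ≤ _ := by gcongr
    rw [hj, abs_mul, abs_mul, Nat.abs_cast, mul_assoc]
    gcongr
    lia
  rw [hrec _ (by lia), abs_mul, abs_of_pos (by positivity : 0 < 1 / ((m + 1 + 2 : ℕ) : ℝ)),
    one_div_mul_eq_div, div_le_iff₀ hn]
  refine (Finset.abs_sum_le_sum_abs _ _).trans ((Finset.sum_le_card_nsmul _ _ _ hterm).trans_eq ?_)
  have hcard : m + 1 + 2 - 1 + 1 - 2 = m + 1 := by lia
  rw [Nat.card_Icc, nsmul_eq_mul, hcard, Nat.factorial_succ]
  push_cast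
  ring

/-- The coefficients `a n` of the second singular solution `g⁻(0,τ)` of the transformed
Löwner equation satisfy `|a n| ≤ 12^(n-1) n^(n-3)` for `n ≥ 2`. -/
theorem loewner_coeff_minus_bound (a : ℕ → ℝ)
    (h1 : a 1 = 0) (h2 : a 2 = -3)
    (hrec : ∀ n, 3 ≤ n →
      a n = (1 / (n : ℝ)) * ∑ k ∈ Finset.Icc 2 (n - 1), (k : ℝ) * a k * a (n + 1 - k)) :
    ∀ n, 2 ≤ n → |a n| ≤ (12 : ℝ) ^ (n - 1) * (n : ℝ) ^ ((n : ℝ) - 3) := by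
  intro n hn
  obtain ⟨m, rfl⟩ := Nat.exists_eq_add_of_le' hn
  have hpos : (0 : ℝ) < ((m + 2 : ℕ) : ℝ) := by positivity
  have hexp : ((m + 2 : ℕ) : ℝ) - 3 = (m : ℝ) - 1 := by push_cast; ring
  rw [hexp, Real.rpow_sub_one hpos.ne', Real.rpow_natCast]
  refine (abs_le_three_pow_mul_factorial a h2 hrec m).trans ?_
  have hfact : (m.factorial : ℝ) ≤ ((m + 2 : ℕ) : ℝ) ^ m := by
    exact_mod_cast (Nat.factorial_le_pow m).trans (Nat.pow_le_pow_left (by lia) m)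
  have hfour : ((m + 2 : ℕ) : ℝ) ≤ 4 ^ (m + 1) := by
    have h : m + 2 ≤ 4 ^ (m + 1) := Nat.lt_pow_self (by norm_num : 1 < 4)
    exact_mod_cast h
  have htwelve : (12 : ℝ) ^ (m + 1) = 3 ^ (m + 1) * 4 ^ (m + 1) := by
    rw [← mul_pow]; norm_num
  rw [show m + 2 - 1 = m + 1 by lia, htwelve, ← mul_div_assoc, le_div_iff₀ hpos]
  calc 3 ^ (m + 1) * (m.factorial : ℝ) * ((m + 2 : ℕ) : ℝ)
      ≤ 3 ^ (m + 1) * ((m + 2 : ℕ) : ℝ) ^ m * 4 ^ (m + 1) := by gcongr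
    _ = 3 ^ (m + 1) * 4 ^ (m + 1) * ((m + 2 : ℕ) : ℝ) ^ m := by ring
end

section
/- Let the coefficients a_n^+ be defined recursively by a_1^+ = 1, a_2^+ = 6, and a_n^+ = -∑_{k=2}^{n-1} k a_k^+ a_{n+1-k}^+ for n ≥ 3. Then the Borel-transformed power series G(τ) = ∑_{n=1}^∞ (a_n^+ / n!) τ^n has positive radius of convergence; in particular it converges absolutely for every complex τ with |τ| < 1/(12e). -/
open Finset

theorem factorial_mul_factorial_le_two_mul (p q : ℕ) :
    (p + 2).factorial * (q + 2).factorial ≤ 2 * (p + q + 2).factorial := by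
  induction q with
  | zero => simp [mul_comm]
  | succ q ih =>
    calc (p + 2).factorial * (q + 1 + 2).factorial
        = (q + 3) * ((p + 2).factorial * (q + 2).factorial) := by
          rw [show q + 1 + 2 = (q + 2) + 1 by ring, Nat.factorial_succ (q + 2)]; ring
      _ ≤ (p + q + 3) * (2 * (p + q + 2).factorial) := by gcongr; omega
      _ = 2 * (p + (q + 1) + 2).factorial := by
          rw [show p + (q + 1) + 2 = (p + q + 2) + 1 by ring, Nat.factorial_succ (p + q + 2)]; ring

theorem sum_factorial_mul_factorial_le {n : ℕ} (hn : 3 ≤ n) :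
    ∑ k ∈ Icc 2 (n - 1), k.factorial * (n - k).factorial ≤ 3 * (n - 1).factorial := by
  obtain ⟨m, rfl⟩ := Nat.exists_eq_add_of_le' hn
  have hinner : ∑ k ∈ Icc 2 (m + 1), k.factorial * (m + 3 - k).factorial
      ≤ m * (2 * (m + 1).factorial) := by
    have hterm : ∀ k ∈ Icc 2 (m + 1),
        k.factorial * (m + 3 - k).factorial ≤ 2 * (m + 1).factorial := by
      intro k hk
      obtain ⟨hk2, hkm⟩ := mem_Icc.mp hk
      have h := factorial_mul_factorial_le_two_mul (k - 2) (m + 1 - k)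
      rwa [show k - 2 + 2 = k by omega, show m + 1 - k + 2 = m + 3 - k by omega,
        show k - 2 + (m + 1 - k) + 2 = m + 1 by omega] at h
    simpa using sum_le_card_nsmul _ _ _ hterm
  rw [show m + 3 - 1 = (m + 1) + 1 by omega, sum_Icc_succ_top (by omega),
    show m + 3 - (m + 1 + 1) = 1 by omega, Nat.factorial_one, mul_one,
    Nat.factorial_succ (m + 1)]
  nlinarith [Nat.factorial_pos (m + 1)]

/-- Factorial growth bound for the coefficients of the singular solution. -/
theorem abs_coeff_le (a : ℕ → ℝ) (h2 : a 2 = 6)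
    (hrec : ∀ n, 3 ≤ n →
      a n = -∑ k ∈ Finset.Icc 2 (n - 1), (k : ℝ) * a k * a (n + 1 - k))
    (n : ℕ) (hn : 2 ≤ n) : |a n| ≤ 18 ^ n * ((n - 1).factorial : ℝ) / 54 := by
  induction n using Nat.strong_induction_on with
  | _ n ih =>
    rcases hn.eq_or_lt with rfl | hn3
    · norm_num [h2]
    have hterm : ∀ k ∈ Icc 2 (n - 1), |(k : ℝ) * a k * a (n + 1 - k)| ≤
        18 ^ n / 162 * ((k.factorial * (n - k).factorial : ℕ) : ℝ) := by
      intro k hk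
      obtain ⟨hk2, hkn⟩ := mem_Icc.mp hk
      have hb := ih k (by omega) hk2
      have hc := ih (n + 1 - k) (by omega) (by omega)
      rw [show n + 1 - k - 1 = n - k by omega] at hc
      have hpow : (18 : ℝ) ^ k * 18 ^ (n + 1 - k) = 18 * 18 ^ n := by
        rw [← pow_add, show k + (n + 1 - k) = n + 1 by omega, pow_succ']
      have hfac : (k : ℝ) * ((k - 1).factorial : ℝ) = (k.factorial : ℝ) := by
        exact_mod_cast Nat.mul_factorial_pred (by omega : k ≠ 0)
      rw [abs_mul, abs_mul, Nat.abs_cast]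
      calc (k : ℝ) * |a k| * |a (n + 1 - k)|
          ≤ k * (18 ^ k * ((k - 1).factorial : ℝ) / 54) *
              (18 ^ (n + 1 - k) * ((n - k).factorial : ℝ) / 54) := by gcongr
        _ = (18 ^ k * 18 ^ (n + 1 - k)) * (k * ((k - 1).factorial : ℝ)) *
              ((n - k).factorial : ℝ) / 2916 := by ring
        _ = 18 ^ n / 162 * ((k.factorial * (n - k).factorial : ℕ) : ℝ) := by
          rw [hpow, hfac]; push_cast; ring
    have hsum : ((∑ k ∈ Icc 2 (n - 1), k.factorial * (n - k).factorial : ℕ) : ℝ) ≤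
        3 * ((n - 1).factorial : ℝ) := by
      exact_mod_cast sum_factorial_mul_factorial_le hn3
    rw [hrec n hn3, abs_neg]
    calc |∑ k ∈ Icc 2 (n - 1), (k : ℝ) * a k * a (n + 1 - k)|
        ≤ ∑ k ∈ Icc 2 (n - 1), |(k : ℝ) * a k * a (n + 1 - k)| := abs_sum_le_sum_abs _ _
      _ ≤ ∑ k ∈ Icc 2 (n - 1), 18 ^ n / 162 * ((k.factorial * (n - k).factorial : ℕ) : ℝ) :=
          sum_le_sum hterm
      _ = 18 ^ n / 162 *
            ((∑ k ∈ Icc 2 (n - 1), k.factorial * (n - k).factorial : ℕ) : ℝ) := by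
          rw [← mul_sum, Nat.cast_sum]
      _ ≤ 18 ^ n / 162 * (3 * ((n - 1).factorial : ℝ)) := by gcongr
      _ = 18 ^ n * ((n - 1).factorial : ℝ) / 54 := by ring

/-- The Borel transform `G(τ) = ∑ (a n / n!) τ^n` of the divergent singular-solution series
has positive radius of convergence; in particular it converges absolutely for every complex
`τ` with `|τ| < 1/(12 e)`. -/
theorem loewner_borel_transform_converges (a : ℕ → ℝ)
    (h1 : a 1 = 1) (h2 : a 2 = 6)
    (hrec : ∀ n, 3 ≤ n →
      a n = -∑ k ∈ Finset.Icc 2 (n - 1), (k : ℝ) * a k * a (n + 1 - k)) :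
    (∃ r : ℝ, 0 < r ∧ ∀ τ : ℂ, ‖τ‖ < r →
      Summable (fun n : ℕ => ‖((a n / (Nat.factorial n : ℝ)) : ℂ) * τ ^ n‖)) ∧
    ∀ τ : ℂ, ‖τ‖ < 1 / (12 * Real.exp 1) →
      Summable (fun n : ℕ => ‖((a n / (Nat.factorial n : ℝ)) : ℂ) * τ ^ n‖) := by
  suffices h : ∀ τ : ℂ, ‖τ‖ < 1 / (12 * Real.exp 1) →
      Summable (fun n : ℕ => ‖((a n / (Nat.factorial n : ℝ)) : ℂ) * τ ^ n‖) from
    ⟨⟨1 / (12 * Real.exp 1), by positivity, h⟩, h⟩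
  intro τ hτ
  have hratio : 18 * ‖τ‖ < 1 := by
    rw [lt_div_iff₀ (by positivity)] at hτ
    nlinarith [Real.add_one_le_exp (1 : ℝ), norm_nonneg τ]
  refine Summable.of_norm_bounded_eventually_nat
    (summable_geometric_of_lt_one (by positivity) hratio) ?_
  filter_upwards [Filter.eventually_ge_atTop 2] with n hn
  have hcoeff : |a n| / (n.factorial : ℝ) ≤ 18 ^ n := by
    rw [div_le_iff₀ (by positivity)]
    have hfac : ((n - 1).factorial : ℝ) ≤ n.factorial := by
      exact_mod_cast Nat.factorial_le (Nat.sub_le n 1)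
    calc |a n| ≤ 18 ^ n * ((n - 1).factorial : ℝ) / 54 := abs_coeff_le a h2 hrec n hn
      _ ≤ 18 ^ n * ((n - 1).factorial : ℝ) := div_le_self (by positivity) (by norm_num)
      _ ≤ 18 ^ n * (n.factorial : ℝ) := by gcongr
  rw [norm_norm, norm_mul, norm_pow, norm_div, Complex.norm_real, Complex.norm_real,
    Real.norm_eq_abs, Real.norm_eq_abs, Nat.abs_cast, mul_pow]
  gcongr
end

section
/- For every integer n ≥ 4 the inequality ∑_{k=2}^{n-1} k^(k-2) (n+1-k)^(n-2-k) < n^(n-3) holds, where all powers are real powers (negative exponents allowed). -/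
open Finset

/-- Bernoulli's inequality, multiplied by `b ^ m`. -/
lemma pow_mul_one_add_div_le_add_one_pow {b : ℝ} (hb : 0 < b) (m : ℕ) :
    b ^ m * (1 + m / b) ≤ (b + 1) ^ m := by
  have h : 1 + (m : ℝ) * (1 / b) ≤ (1 + 1 / b) ^ m :=
    one_add_mul_le_pow (by linarith [one_div_pos.2 hb]) m
  calc b ^ m * (1 + m / b) = b ^ m * (1 + m * (1 / b)) := by ring
    _ ≤ b ^ m * (1 + 1 / b) ^ m := by gcongr
    _ = (b + 1) ^ m := by rw [← mul_pow]; congr 1; field_simp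

/-- A product of powers of numbers in `[0, c]` is at most the power of `c` to the total exponent. -/
lemma rpow_mul_rpow_le_rpow_add {a b c x y : ℝ} (ha : 0 ≤ a) (hb : 0 ≤ b) (hac : a ≤ c)
    (hbc : b ≤ c) (hc : 0 < c) (hx : 0 ≤ x) (hy : 0 ≤ y) :
    a ^ x * b ^ y ≤ c ^ (x + y) := by
  rw [Real.rpow_add hc]
  gcongr

/-- The key combinatorial inequality in the inductive proof of the upper coefficient bound:
for `n ≥ 4`, `∑_{k=2}^{n-1} k^(k-2) (n+1-k)^(n-2-k) < n^(n-3)`, with real powers. -/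
theorem loewner_combinatorial_sum_lt (n : ℕ) (hn : 4 ≤ n) :
    ∑ k ∈ Finset.Icc 2 (n - 1),
        (k : ℝ) ^ ((k : ℝ) - 2) * ((n : ℝ) + 1 - (k : ℝ)) ^ ((n : ℝ) - 2 - (k : ℝ)) <
      (n : ℝ) ^ ((n : ℝ) - 3) := by
  obtain ⟨m, rfl⟩ := Nat.exists_eq_add_of_le' hn
  have hm : (0 : ℝ) ≤ m := m.cast_nonneg
  rw [show m + 4 - 1 = (m + 2) + 1 by omega, Finset.sum_Icc_succ_top (by omega)]
  have hterm : ∀ k ∈ Finset.Icc 2 (m + 2),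
      (k : ℝ) ^ ((k : ℝ) - 2) *
        (((m + 4 : ℕ) : ℝ) + 1 - (k : ℝ)) ^ (((m + 4 : ℕ) : ℝ) - 2 - (k : ℝ)) ≤
          ((m : ℝ) + 3) ^ m := by
    intro k hk
    obtain ⟨h2, hk⟩ := Finset.mem_Icc.1 hk
    have h2 : (2 : ℝ) ≤ k := by exact_mod_cast h2
    have hk : (k : ℝ) ≤ m + 2 := by exact_mod_cast hk
    push_cast
    refine (rpow_mul_rpow_le_rpow_add (c := (m : ℝ) + 3) ?_ ?_ ?_ ?_ ?_ ?_ ?_).trans_eq ?_ <;>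
      try linarith
    rw [← Real.rpow_natCast]
    congr 1
    ring
  have hsum := Finset.sum_le_card_nsmul _ _ _ hterm
  have hlast : ((m + 2 + 1 : ℕ) : ℝ) ^ (((m + 2 + 1 : ℕ) : ℝ) - 2) *
      (((m + 4 : ℕ) : ℝ) + 1 - ((m + 2 + 1 : ℕ) : ℝ)) ^
        (((m + 4 : ℕ) : ℝ) - 2 - ((m + 2 + 1 : ℕ) : ℝ)) = ((m : ℝ) + 3) ^ m * ((m + 3) / 2) := by
    rw [show ((m + 2 + 1 : ℕ) : ℝ) - 2 = ((m + 1 : ℕ) : ℝ) by push_cast; ring,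
      show ((m + 4 : ℕ) : ℝ) - 2 - ((m + 2 + 1 : ℕ) : ℝ) = -1 by push_cast; ring,
      show ((m + 4 : ℕ) : ℝ) + 1 - ((m + 2 + 1 : ℕ) : ℝ) = 2 by push_cast; ring,
      Real.rpow_natCast, Real.rpow_neg_one]
    push_cast
    ring
  have hrhs : ((m + 4 : ℕ) : ℝ) ^ (((m + 4 : ℕ) : ℝ) - 3) = ((m : ℝ) + 3 + 1) ^ m * (m + 4) := by
    rw [show ((m + 4 : ℕ) : ℝ) - 3 = ((m + 1 : ℕ) : ℝ) by push_cast; ring, Real.rpow_natCast]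
    push_cast
    ring
  rw [Nat.card_Icc, show m + 2 + 1 - 2 = m + 1 by omega, nsmul_eq_mul] at hsum
  rw [hlast, hrhs]
  have hcoeff : ((m : ℝ) + 1) + (m + 3) / 2 < (1 + m / (m + 3)) * (m + 4) := by
    rw [← sub_pos]
    have : (1 + (m : ℝ) / (m + 3)) * (m + 4) - ((m + 1) + (m + 3) / 2) =
        (m ^ 2 + 8 * m + 9) / (2 * (m + 3)) := by
      field_simp
      ring
    rw [this]
    positivity
  calc _ ≤ ((m + 1 : ℕ) : ℝ) * ((m : ℝ) + 3) ^ m + ((m : ℝ) + 3) ^ m * ((m + 3) / 2) := by gcongr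
    _ = ((m : ℝ) + 3) ^ m * ((m + 1) + (m + 3) / 2) := by push_cast; ring
    _ < ((m : ℝ) + 3) ^ m * ((1 + m / (m + 3)) * (m + 4)) := by gcongr
    _ = ((m : ℝ) + 3) ^ m * (1 + m / (m + 3)) * (m + 4) := by ring
    _ ≤ ((m : ℝ) + 3 + 1) ^ m * (m + 4) := by
      gcongr
      exact pow_mul_one_add_div_le_add_one_pow (by positivity) m
end

section
/- Let 0 < t0 < T and let F : (0,T) → ℝ and G : [t0,T) → ℝ be functions such that: F is differentiable on (0,T) with F'(t) = 2/(F(t) - t^(1/3)) and satisfies t^(1/3) < F(t) < t^(1/3) + 6 t^(2/3) for all t ∈ (0,T); G is continuous on [t0,T), differentiable on (t0,T) with G'(t) = 2/(G(t) - t^(1/3)), G(t0) = t0^(1/3), and G(t) > t^(1/3) for all t ∈ (t0,T). Then G(t) < F(t) for all t ∈ (t0,T). -/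
open Set

/-- A function with `f' ≥ -K f` on the interior of `[a, b]` and positive at `a` is positive at `b`. -/
theorem pos_of_neg_mul_le_deriv {f f' : ℝ → ℝ} {a b K : ℝ} (hab : a ≤ b)
    (hc : ContinuousOn f (Icc a b)) (hd : ∀ x ∈ Ioo a b, HasDerivAt f (f' x) x)
    (hK : ∀ x ∈ Ioo a b, -K * f x ≤ f' x) (ha : 0 < f a) : 0 < f b := by
  have hmono : MonotoneOn (fun x => f x * Real.exp (K * x)) (Icc a b) := by
    refine monotoneOn_of_hasDerivWithinAt_nonneg (convex_Icc a b)
      (f' := fun x => f' x * Real.exp (K * x) + f x * (Real.exp (K * x) * K))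
      (hc.mul (by fun_prop)) ?_ ?_
    · intro x hx
      rw [interior_Icc] at hx
      have he : HasDerivAt (fun x => Real.exp (K * x)) (Real.exp (K * x) * K) x := by
        simpa using ((hasDerivAt_id x).const_mul K).exp
      exact ((hd x hx).mul he).hasDerivWithinAt
    · intro x hx
      rw [interior_Icc] at hx
      have h : 0 ≤ (f' x + K * f x) * Real.exp (K * x) :=
        mul_nonneg (by linarith [hK x hx]) (Real.exp_pos _).le
      linarith
  have h := hmono (left_mem_Icc.2 hab) (right_mem_Icc.2 hab) hab
  exact pos_of_mul_pos_left ((mul_pos ha (Real.exp_pos _)).trans_le h) (Real.exp_pos _).le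

/-- Lemma 2 (upper branches): the upper singular solution `G` emanating from the algebraic
critical point at time `t0` stays strictly below the upper singular solution `F` emanating
from the origin. -/
theorem loewner_upper_branch_comparison (t0 T : ℝ) (ht0 : 0 < t0) (htT : t0 < T)
    (F G : ℝ → ℝ)
    (hF : ∀ t ∈ Ioo (0 : ℝ) T, HasDerivAt F (2 / (F t - t ^ ((1 : ℝ)/3))) t)
    (hFlb : ∀ t ∈ Ioo (0 : ℝ) T, t ^ ((1 : ℝ)/3) < F t)
    (hFub : ∀ t ∈ Ioo (0 : ℝ) T, F t < t ^ ((1 : ℝ)/3) + 6 * t ^ ((2 : ℝ)/3))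
    (hGc : ContinuousOn G (Ico t0 T))
    (hG : ∀ t ∈ Ioo t0 T, HasDerivAt G (2 / (G t - t ^ ((1 : ℝ)/3))) t)
    (hG0 : G t0 = t0 ^ ((1 : ℝ)/3))
    (hGlb : ∀ t ∈ Ioo t0 T, t ^ ((1 : ℝ)/3) < G t) :
    ∀ t ∈ Ioo t0 T, G t < F t := by
  intro t ht
  by_contra! hle
  have hu : Continuous fun x : ℝ => x ^ ((1 : ℝ) / 3) :=
    Real.continuous_rpow_const (by norm_num)
  have hFc : ContinuousOn F (Ioo 0 T) := fun x hx => (hF x hx).continuousAt.continuousWithinAt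
  have hsub : Icc t0 t ⊆ Ioo 0 T := fun x hx => ⟨ht0.trans_le hx.1, hx.2.trans_lt ht.2⟩
  have hD : ContinuousOn (fun x => F x - G x) (Icc t0 t) :=
    (hFc.mono hsub).sub (hGc.mono fun x hx => ⟨hx.1, hx.2.trans_lt ht.2⟩)
  have hcomp : IsCompact (Icc t0 t ∩ (fun x => F x - G x) ⁻¹' Iic 0) :=
    isCompact_Icc.of_isClosed_subset
      (hD.preimage_isClosed_of_isClosed isClosed_Icc isClosed_Iic) inter_subset_left
  obtain ⟨s, ⟨hs, hsD⟩, hmin⟩ := hcomp.exists_isLeast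
    ⟨t, ⟨ht.1.le, le_rfl⟩, sub_nonpos.2 hle⟩
  have hsD : F s - G s ≤ 0 := hsD
  have hpos : ∀ x ∈ Ico t0 s, 0 < F x - G x := by
    intro x hx
    by_contra! h
    exact hx.2.not_ge (hmin ⟨⟨hx.1, hx.2.le.trans hs.2⟩, h⟩)
  have hts : t0 < s := by
    refine hs.1.lt_of_ne ?_
    rintro rfl
    linarith [hFlb t0 ⟨ht0, htT⟩]
  obtain ⟨a, hta, has⟩ := exists_between hts
  have hmem : ∀ x ∈ Icc a s, x ∈ Ioo t0 T := fun x hx =>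
    ⟨hta.trans_le hx.1, (hx.2.trans hs.2).trans_lt ht.2⟩
  have hmem0 : ∀ x ∈ Icc a s, x ∈ Ioo 0 T := fun x hx =>
    ⟨ht0.trans (hmem x hx).1, (hmem x hx).2⟩
  have hFa : ContinuousOn F (Icc a s) := hFc.mono hmem0
  have hGa : ContinuousOn G (Icc a s) := hGc.mono fun x hx => Ioo_subset_Ico_self (hmem x hx)
  obtain ⟨m, hm, hmP⟩ : ∃ m : ℝ, 0 < m ∧ ∀ x ∈ Icc a s,
      m ≤ (F x - x ^ ((1 : ℝ) / 3)) * (G x - x ^ ((1 : ℝ) / 3)) := by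
    obtain ⟨y, hy, hy'⟩ := isCompact_Icc.exists_isMinOn (nonempty_Icc.2 has.le)
      ((hFa.sub hu.continuousOn).mul (hGa.sub hu.continuousOn))
    exact ⟨_, mul_pos (sub_pos.2 (hFlb y (hmem0 y hy))) (sub_pos.2 (hGlb y (hmem y hy))),
      fun x hx => hy' hx⟩
  refine hsD.not_gt (pos_of_neg_mul_le_deriv (f := fun x => F x - G x) (K := 2 / m) has.le
    (hFa.sub hGa) (fun x hx => (hF x (hmem0 x (Ioo_subset_Icc_self hx))).sub
      (hG x (hmem x (Ioo_subset_Icc_self hx)))) ?_ (hpos a ⟨hta.le, has⟩))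
  intro x hx
  have hx' := Ioo_subset_Icc_self hx
  have h1 := sub_pos.2 (hFlb x (hmem0 x hx'))
  have h2 := sub_pos.2 (hGlb x (hmem x hx'))
  have heq : 2 / (F x - x ^ ((1 : ℝ) / 3)) - 2 / (G x - x ^ ((1 : ℝ) / 3)) =
      -(2 / ((F x - x ^ ((1 : ℝ) / 3)) * (G x - x ^ ((1 : ℝ) / 3))) * (F x - G x)) := by
    field_simp
    ring
  rw [heq, neg_mul, neg_le_neg_iff]
  exact mul_le_mul_of_nonneg_right
    (div_le_div_of_nonneg_left zero_le_two hm (hmP x hx'))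
    (hpos x ⟨(hmem x hx').1.le, hx.2⟩).le
end

section
/- Let 0 < t0 < T and let F : (0,T) → ℝ and G : [t0,T) → ℝ be functions such that: F is differentiable on (0,T) with F'(t) = 2/(F(t) - t^(1/3)), satisfies F(t) < t^(1/3) for all t ∈ (0,T), and F(t) → 0 as t → 0+; G is continuous on [t0,T), differentiable on (t0,T) with G'(t) = 2/(G(t) - t^(1/3)), G(t0) = t0^(1/3), and G(t) < t^(1/3) for all t ∈ (t0,T). Then F(t) < G(t) for all t ∈ (t0,T). -/
open Set Filter

/-- A solution of the linear equation `D' = -p D` with continuous coefficient that is nonzero at the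
left endpoint of an interval stays nonzero up to the right endpoint. -/
theorem ne_zero_of_hasDerivAt_neg_mul {D p : ℝ → ℝ} {a b : ℝ} (hab : a ≤ b)
    (hp : ContinuousOn p (Icc a b)) (hD : ∀ t ∈ Icc a b, HasDerivAt D (-(p t * D t)) t)
    (ha : D a ≠ 0) : D b ≠ 0 := by
  obtain ⟨M, hM⟩ := isCompact_Icc.bddAbove_image hp
  have hderiv : ∀ t ∈ Icc a b, HasDerivAt (fun t => D t ^ 2 * Real.exp (2 * M * t))
      (2 * (M - p t) * (D t ^ 2 * Real.exp (2 * M * t))) t := by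
    intro t ht
    have he : HasDerivAt (fun t => Real.exp (2 * M * t))
        (Real.exp (2 * M * t) * (2 * M * 1)) t :=
      ((hasDerivAt_id t).const_mul (2 * M)).exp
    refine (((hD t ht).pow 2).mul he).congr_deriv ?_
    simp only [Pi.pow_apply]
    push_cast
    ring
  have hmono : MonotoneOn (fun t => D t ^ 2 * Real.exp (2 * M * t)) (Icc a b) := by
    refine monotoneOn_of_hasDerivWithinAt_nonneg (convex_Icc a b)
      (fun t ht => (hderiv t ht).continuousAt.continuousWithinAt)
      (fun t ht => (hderiv t (interior_subset ht)).hasDerivWithinAt) fun t ht => ?_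
    have hpM : p t ≤ M := hM (mem_image_of_mem p (interior_subset ht))
    have : 0 ≤ M - p t := sub_nonneg.2 hpM
    positivity
  intro hb
  have hle := hmono (left_mem_Icc.2 hab) (right_mem_Icc.2 hab) hab
  have hpos : 0 < D a ^ 2 * Real.exp (2 * M * a) := by positivity
  simp only [hb] at hle
  linarith

/-- Lemma 2 (lower branches): the lower singular solution `F` emanating from the origin stays
strictly below the lower singular solution `G` emanating from the algebraic critical point at
time `t0`. -/
theorem loewner_lower_branch_comparison (t0 T : ℝ) (ht0 : 0 < t0) (htT : t0 < T)
    (F G : ℝ → ℝ)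
    (hF : ∀ t ∈ Ioo (0 : ℝ) T, HasDerivAt F (2 / (F t - t ^ ((1 : ℝ)/3))) t)
    (hFub : ∀ t ∈ Ioo (0 : ℝ) T, F t < t ^ ((1 : ℝ)/3))
    (hF0 : Tendsto F (nhdsWithin 0 (Ioi 0)) (nhds 0))
    (hGc : ContinuousOn G (Ico t0 T))
    (hG : ∀ t ∈ Ioo t0 T, HasDerivAt G (2 / (G t - t ^ ((1 : ℝ)/3))) t)
    (hG0 : G t0 = t0 ^ ((1 : ℝ)/3))
    (hGub : ∀ t ∈ Ioo t0 T, G t < t ^ ((1 : ℝ)/3)) :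
    ∀ t ∈ Ioo t0 T, F t < G t := by
  intro t ht
  by_contra! hle
  have hpos : ∀ u ∈ Ioo t0 T, u ∈ Ioo 0 T := fun u hu => ⟨ht0.trans hu.1, hu.2⟩
  have hstart : ∀ᶠ a in nhdsWithin t0 (Ioi t0), F a < G a := by
    have hGt : Tendsto G (nhdsWithin t0 (Ioi t0)) (nhds (G t0)) :=
      (hGc t0 ⟨le_rfl, htT⟩).mono_left
        (nhdsWithin_le_of_mem (mem_of_superset (Ioo_mem_nhdsGT htT) Ioo_subset_Ico_self))
    have hFt : Tendsto F (nhdsWithin t0 (Ioi t0)) (nhds (F t0)) :=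
      (hF t0 ⟨ht0, htT⟩).continuousAt.continuousWithinAt
    exact hFt.eventually_lt hGt (hG0 ▸ hFub t0 ⟨ht0, htT⟩)
  obtain ⟨a, haFG, ha⟩ := (hstart.and (Ioo_mem_nhdsGT ht.1)).exists
  have hFc : ContinuousOn F (Ioo t0 T) :=
    fun u hu => (hF u (hpos u hu)).continuousAt.continuousWithinAt
  have hGc' : ContinuousOn G (Ioo t0 T) := hGc.mono Ioo_subset_Ico_self
  have hsub : Icc a t ⊆ Ioo t0 T := fun u hu => ⟨ha.1.trans_le hu.1, hu.2.trans_lt ht.2⟩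
  obtain ⟨c, hc, hc0⟩ := intermediate_value_Icc' ha.2.le ((hGc'.sub hFc).mono hsub)
    (show (0 : ℝ) ∈ Icc ((G - F) t) ((G - F) a) from
      ⟨sub_nonpos.2 hle, sub_nonneg.2 haFG.le⟩)
  have hsub' : Icc a c ⊆ Ioo t0 T := (Icc_subset_Icc_right hc.2).trans hsub
  have hGne : ∀ u ∈ Ioo t0 T, G u - u ^ ((1 : ℝ)/3) ≠ 0 := fun u hu => (sub_neg.2 (hGub u hu)).ne
  have hFne : ∀ u ∈ Ioo t0 T, F u - u ^ ((1 : ℝ)/3) ≠ 0 :=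
    fun u hu => (sub_neg.2 (hFub u (hpos u hu))).ne
  have hroot : ContinuousOn (fun u : ℝ => u ^ ((1 : ℝ)/3)) (Ioo t0 T) :=
    (Real.continuous_rpow_const (by norm_num)).continuousOn
  refine ne_zero_of_hasDerivAt_neg_mul (D := G - F)
    (p := fun u => 2 / ((G u - u ^ ((1 : ℝ)/3)) * (F u - u ^ ((1 : ℝ)/3)))) hc.1
    ?_ (fun u hu => ?_) (sub_pos.2 haFG).ne' hc0
  · exact (continuousOn_const.div ((hGc'.sub hroot).mul (hFc.sub hroot))
      fun u hu => mul_ne_zero (hGne u hu) (hFne u hu)).mono hsub'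
  · have hu' := hsub' hu
    refine ((hG u hu').sub (hF u (hpos u hu'))).congr_deriv ?_
    have h1 := hGne u hu'
    have h2 := hFne u hu'
    simp only [Pi.sub_apply]
    field_simp
    ring
end

section
/- Let 0 < t1 < t0 < T and let F : [t1,T) → ℝ and G : [t0,T) → ℝ be functions such that: F is continuous on [t1,T), differentiable on (t1,T) with F'(t) = 2/(F(t) - t^(1/3)), F(t1) = t1^(1/3), and t^(1/3) < F(t) < t^(1/3) + 6 t^(2/3) for all t ∈ (t1,T); G is continuous on [t0,T), differentiable on (t0,T) with G'(t) = 2/(G(t) - t^(1/3)), G(t0) = t0^(1/3), and G(t) > t^(1/3) for all t ∈ (t0,T). Then G(t) < F(t) for all t ∈ (t0,T). -/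
open Set

/-- Lemma 3 (upper branches): monotonic disposition of the upper branches of singular
solutions emanating from algebraic critical points at times `t1 < t0`: the later one `G`
stays strictly below the earlier one `F`. -/
theorem loewner_upper_branches_monotone (t1 t0 T : ℝ)
    (ht1 : 0 < t1) (ht10 : t1 < t0) (ht0T : t0 < T)
    (F G : ℝ → ℝ)
    (hFc : ContinuousOn F (Ico t1 T))
    (hF : ∀ t ∈ Ioo t1 T, HasDerivAt F (2 / (F t - t ^ ((1 : ℝ)/3))) t)
    (hF1 : F t1 = t1 ^ ((1 : ℝ)/3))
    (hFlb : ∀ t ∈ Ioo t1 T, t ^ ((1 : ℝ)/3) < F t)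
    (hFub : ∀ t ∈ Ioo t1 T, F t < t ^ ((1 : ℝ)/3) + 6 * t ^ ((2 : ℝ)/3))
    (hGc : ContinuousOn G (Ico t0 T))
    (hG : ∀ t ∈ Ioo t0 T, HasDerivAt G (2 / (G t - t ^ ((1 : ℝ)/3))) t)
    (hG0 : G t0 = t0 ^ ((1 : ℝ)/3))
    (hGlb : ∀ t ∈ Ioo t0 T, t ^ ((1 : ℝ)/3) < G t) :
    ∀ t ∈ Ioo t0 T, G t < F t := by
  intro t ht
  by_contra! hGF
  have hsub : Icc t0 t ⊆ Ico t0 T := fun x hx => ⟨hx.1, hx.2.trans_lt ht.2⟩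
  have hFc' : ContinuousOn F (Icc t0 t) :=
    hFc.mono fun x hx => ⟨ht10.le.trans hx.1, hx.2.trans_lt ht.2⟩
  have hGc' : ContinuousOn G (Icc t0 t) := hGc.mono hsub
  -- `s` is the first time at which `F ≤ G`
  obtain ⟨s, ⟨hs, hFGs⟩, hsmin⟩ : ∃ s, IsLeast {x ∈ Icc t0 t | F x ≤ G x} s :=
    (isCompact_Icc.of_isClosed_subset (isClosed_Icc.isClosed_le hFc' hGc')
      (sep_subset _ _)).exists_isLeast ⟨t, ⟨ht.1.le, le_rfl⟩, hGF⟩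
  have hpos : ∀ x ∈ Ico t0 s, G x < F x := fun x hx => by
    by_contra! h
    exact hx.2.not_ge (hsmin ⟨⟨hx.1, hx.2.le.trans hs.2⟩, h⟩)
  have hroot : Continuous fun x : ℝ => x ^ ((1 : ℝ) / 3) :=
    Real.continuous_rpow_const (by norm_num)
  -- `m` is a positive lower bound of the distance from `F` to the driving function
  obtain ⟨y, hy, hymin⟩ := isCompact_Icc.exists_isMinOn (nonempty_Icc.2 ht.1.le)
    (hFc'.sub hroot.continuousOn)
  set m := F y - y ^ ((1 : ℝ) / 3)
  have hm0 : 0 < m := sub_pos.2 (hFlb y ⟨ht10.trans_le hy.1, hy.2.trans_lt ht.2⟩)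
  have hst : Icc t0 s ⊆ Icc t0 t := Icc_subset_Icc_right hs.2
  have hmono : MonotoneOn (fun x => (F x - G x) * Real.exp (G x / m)) (Icc t0 s) := by
    refine monotoneOn_of_hasDerivWithinAt_nonneg (convex_Icc t0 s)
      (f' := fun x => (2 / (F x - x ^ ((1 : ℝ) / 3)) - 2 / (G x - x ^ ((1 : ℝ) / 3))) *
        Real.exp (G x / m) + (F x - G x) *
        (Real.exp (G x / m) * (2 / (G x - x ^ ((1 : ℝ) / 3)) / m))) ?_ ?_ ?_
    · exact ((hFc'.sub hGc').mul (hGc'.div_const m).rexp).mono hst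
    · rw [interior_Icc]
      intro x hx
      have hxT : x < T := hx.2.trans_le hs.2 |>.trans ht.2
      have hFx := hF x ⟨ht10.trans hx.1, hxT⟩
      have hGx := hG x ⟨hx.1, hxT⟩
      exact ((hFx.sub hGx).mul (hGx.div_const m).exp).hasDerivWithinAt
    · rw [interior_Icc]
      intro x hx
      have hxT : x < T := hx.2.trans_le hs.2 |>.trans ht.2
      have hb : 0 < G x - x ^ ((1 : ℝ) / 3) := sub_pos.2 (hGlb x ⟨hx.1, hxT⟩)
      have hma : m ≤ F x - x ^ ((1 : ℝ) / 3) := hymin ⟨hx.1.le, hx.2.le.trans hs.2⟩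
      have hd : 0 < F x - G x := sub_pos.2 (hpos x ⟨hx.1.le, hx.2⟩)
      have ha := hm0.trans_le hma
      have hda : F x - G x = (F x - x ^ ((1 : ℝ) / 3)) - (G x - x ^ ((1 : ℝ) / 3)) := by ring
      rw [hda] at hd ⊢
      clear_value m
      generalize F x - x ^ ((1 : ℝ) / 3) = a at *
      generalize G x - x ^ ((1 : ℝ) / 3) = b at *
      have key : (2 / a - 2 / b) * Real.exp (G x / m) +
          (a - b) * (Real.exp (G x / m) * (2 / b / m)) =
          Real.exp (G x / m) * (2 * (a - b) * (a - m) / (a * b * m)) := by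
        field_simp
        ring
      rw [key]
      have := sub_nonneg.2 hma
      positivity
  have hle := hmono (left_mem_Icc.2 hs.1) (right_mem_Icc.2 hs.1) hs.1
  have h0 : 0 < F t0 - G t0 := by
    rw [hG0]
    exact sub_pos.2 (hFlb t0 ⟨ht10, ht0T⟩)
  have hpos0 := mul_pos h0 (Real.exp_pos (G t0 / m))
  exact (pos_of_mul_pos_left (hpos0.trans_le hle) (Real.exp_pos _).le).not_ge (sub_nonpos.2 hFGs)
end

section
/- Let 0 < t1 < t0 < T and let F : [t1,T) → ℝ and G : [t0,T) → ℝ be functions such that: F is continuous on [t1,T), differentiable on (t1,T) with F'(t) = 2/(F(t) - t^(1/3)), F(t1) = t1^(1/3), and F(t) < t^(1/3) for all t ∈ (t1,T); G is continuous on [t0,T), differentiable on (t0,T) with G'(t) = 2/(G(t) - t^(1/3)), G(t0) = t0^(1/3), and G(t) < t^(1/3) for all t ∈ (t0,T). Then F(t) < G(t) for all t ∈ (t0,T). -/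
open Set

/-- A real function that is positive at the left endpoint of an interval and satisfies
`D' = -c D` with a continuous coefficient `c` cannot vanish first at the right endpoint. -/
theorem pos_right_of_hasDerivAt_neg_mul {D c : ℝ → ℝ} {a b : ℝ} (hab : a ≤ b)
    (hc : ContinuousOn c (Icc a b)) (hD : ∀ t ∈ Icc a b, HasDerivAt D (-(c t * D t)) t)
    (hpos : ∀ t ∈ Ico a b, 0 < D t) (ha : 0 < D a) : 0 < D b := by
  obtain ⟨K, hK⟩ := isCompact_Icc.bddAbove_image hc
  have hderiv : ∀ t ∈ Icc a b, HasDerivAt (fun t => D t * Real.exp (K * t))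
      ((K - c t) * D t * Real.exp (K * t)) t := by
    intro t ht
    have hexp : HasDerivAt (fun t => Real.exp (K * t)) (Real.exp (K * t) * (K * 1)) t :=
      ((hasDerivAt_id t).const_mul K).exp
    exact ((hD t ht).mul hexp).congr_deriv (by ring)
  have hmono : MonotoneOn (fun t => D t * Real.exp (K * t)) (Icc a b) := by
    refine monotoneOn_of_hasDerivWithinAt_nonneg (convex_Icc a b)
      (fun t ht => (hderiv t ht).continuousAt.continuousWithinAt)
      (fun t ht => (hderiv t (interior_subset ht)).hasDerivWithinAt) ?_
    intro t ht
    rw [interior_Icc] at ht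
    have hct : c t ≤ K := hK (mem_image_of_mem c (Ioo_subset_Icc_self ht))
    have hDt := hpos t (Ioo_subset_Ico_self ht)
    exact mul_nonneg (mul_nonneg (sub_nonneg.2 hct) hDt.le) (Real.exp_pos _).le
  have hle : D a * Real.exp (K * a) ≤ D b * Real.exp (K * b) :=
    hmono (left_mem_Icc.2 hab) (right_mem_Icc.2 hab) hab
  exact pos_of_mul_pos_left ((mul_pos ha (Real.exp_pos _)).trans_le hle) (Real.exp_pos _).le

/-- Lemma 3 (lower branches): monotonic disposition of the lower branches of singular
solutions emanating from algebraic critical points at times `t1 < t0`: the earlier one `F`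
stays strictly below the later one `G`. -/
theorem loewner_lower_branches_monotone (t1 t0 T : ℝ)
    (ht1 : 0 < t1) (ht10 : t1 < t0) (ht0T : t0 < T)
    (F G : ℝ → ℝ)
    (hFc : ContinuousOn F (Ico t1 T))
    (hF : ∀ t ∈ Ioo t1 T, HasDerivAt F (2 / (F t - t ^ ((1 : ℝ)/3))) t)
    (hF1 : F t1 = t1 ^ ((1 : ℝ)/3))
    (hFub : ∀ t ∈ Ioo t1 T, F t < t ^ ((1 : ℝ)/3))
    (hGc : ContinuousOn G (Ico t0 T))
    (hG : ∀ t ∈ Ioo t0 T, HasDerivAt G (2 / (G t - t ^ ((1 : ℝ)/3))) t)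
    (hG0 : G t0 = t0 ^ ((1 : ℝ)/3))
    (hGub : ∀ t ∈ Ioo t0 T, G t < t ^ ((1 : ℝ)/3)) :
    ∀ t ∈ Ioo t0 T, F t < G t := by
  intro s hs
  by_contra! hle
  have hcont : ContinuousOn (fun t => G t - F t) (Icc t0 s) :=
    (hGc.mono fun t ht => ⟨ht.1, ht.2.trans_lt hs.2⟩).sub
      (hFc.mono fun t ht => ⟨ht10.le.trans ht.1, ht.2.trans_lt hs.2⟩)
  have hcompact : IsCompact (Icc t0 s ∩ (fun t => G t - F t) ⁻¹' Iic 0) :=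
    isCompact_Icc.of_isClosed_subset (hcont.preimage_isClosed_of_isClosed isClosed_Icc isClosed_Iic)
      inter_subset_left
  obtain ⟨b, ⟨⟨h0b, hbs⟩, hDb⟩, hleast⟩ :=
    hcompact.exists_isLeast ⟨s, ⟨hs.1.le, le_rfl⟩, sub_nonpos.2 hle⟩
  have hpos : ∀ t ∈ Ico t0 b, 0 < G t - F t := by
    intro t ht
    by_contra! h
    exact ht.2.not_ge (hleast ⟨⟨ht.1, ht.2.le.trans hbs⟩, h⟩)
  have hD0 : 0 < G t0 - F t0 := by
    rw [hG0]
    exact sub_pos.2 (hFub t0 ⟨ht10, ht0T⟩)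
  have h0b' : t0 < b := by
    refine h0b.lt_of_ne ?_
    rintro rfl
    exact hD0.not_ge hDb
  obtain ⟨a, h0a, hab⟩ := exists_between h0b'
  have hmemG : ∀ t ∈ Icc a b, t ∈ Ioo t0 T := fun t ht =>
    ⟨h0a.trans_le ht.1, (ht.2.trans hbs).trans_lt hs.2⟩
  have hmemF : ∀ t ∈ Icc a b, t ∈ Ioo t1 T := fun t ht =>
    ⟨ht10.trans (hmemG t ht).1, (hmemG t ht).2⟩
  have hGne : ∀ t ∈ Icc a b, G t - t ^ ((1 : ℝ)/3) ≠ 0 := fun t ht =>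
    (sub_neg.2 (hGub t (hmemG t ht))).ne
  have hFne : ∀ t ∈ Icc a b, F t - t ^ ((1 : ℝ)/3) ≠ 0 := fun t ht =>
    (sub_neg.2 (hFub t (hmemF t ht))).ne
  have hroot : ContinuousOn (fun t : ℝ => t ^ ((1 : ℝ)/3)) (Icc a b) :=
    (Real.continuous_rpow_const (by norm_num)).continuousOn
  have hGcont : ContinuousOn G (Icc a b) := fun t ht =>
    (hG t (hmemG t ht)).continuousAt.continuousWithinAt
  have hFcont : ContinuousOn F (Icc a b) := fun t ht =>
    (hF t (hmemF t ht)).continuousAt.continuousWithinAt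
  refine (pos_right_of_hasDerivAt_neg_mul (D := fun t => G t - F t)
    (c := fun t => 2 / ((G t - t ^ ((1 : ℝ)/3)) * (F t - t ^ ((1 : ℝ)/3)))) hab.le
    (continuousOn_const.div ((hGcont.sub hroot).mul (hFcont.sub hroot))
      fun t ht => mul_ne_zero (hGne t ht) (hFne t ht)) ?_
    (fun t ht => hpos t ⟨h0a.le.trans ht.1, ht.2⟩) (hpos a ⟨h0a.le, hab⟩)).not_ge hDb
  intro t ht
  refine ((hG t (hmemG t ht)).sub (hF t (hmemF t ht))).congr_deriv ?_
  have hg := hGne t ht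
  have hf := hFne t ht
  field_simp
  ring
end

section
/- Let I ⊆ (0,∞) be an open interval and let g : I → ℝ be differentiable with g'(t) = 2/(g(t) - t^(1/3)) for all t ∈ I. (a) If t^(1/3) < g(t) < t^(1/3) + 6 t^(2/3) for all t ∈ I, then the function t ↦ g(t) - t^(1/3) is strictly monotonically increasing on I; its derivative equals (t^(1/3) + 6 t^(2/3) - g(t)) / (3 t^(2/3) (g(t) - t^(1/3))) > 0. (b) If g(t) < t^(1/3) for all t ∈ I, then the function t ↦ g(t) - t^(1/3) is strictly monotonically decreasing on I. -/
open Set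

/-- The derivative of `g(t) - t^(1/3)` for a solution `g` of the Löwner ODE at a point `t > 0`. -/
theorem hasDerivAt_sub_cubeRoot {g : ℝ → ℝ} {t : ℝ} (ht : 0 < t)
    (hg : HasDerivAt g (2 / (g t - t ^ ((1 : ℝ)/3))) t) (hne : g t - t ^ ((1 : ℝ)/3) ≠ 0) :
    HasDerivAt (fun t => g t - t ^ ((1 : ℝ)/3))
      ((t ^ ((1 : ℝ)/3) + 6 * t ^ ((2 : ℝ)/3) - g t) /
        (3 * t ^ ((2 : ℝ)/3) * (g t - t ^ ((1 : ℝ)/3)))) t := by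
  have hroot : HasDerivAt (fun t : ℝ => t ^ ((1 : ℝ)/3)) (1 / (3 * t ^ ((2 : ℝ)/3))) t := by
    convert Real.hasDerivAt_rpow_const (p := (1 : ℝ)/3) (Or.inl ht.ne') using 1
    rw [show (1 : ℝ)/3 - 1 = -(2/3) by norm_num, Real.rpow_neg ht.le]
    field_simp
  refine (hg.sub hroot).congr_deriv ?_
  have hp : 3 * t ^ ((2 : ℝ)/3) ≠ 0 := (mul_pos three_pos (Real.rpow_pos_of_pos ht _)).ne'
  rw [div_sub_div _ _ hne hp, div_eq_div_iff (mul_ne_zero hne hp) (mul_ne_zero hp hne)]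
  ring

/-- Monotonicity of `g(t) - t^(1/3)` for a solution `g` of the Löwner ODE
`g' = 2/(g - t^(1/3))` on an open interval `I = (a,b) ⊆ (0,∞)`:
(a) if `t^(1/3) < g(t) < t^(1/3) + 6 t^(2/3)` on `I` then `g(t) - t^(1/3)` is strictly
increasing with positive derivative `(t^(1/3) + 6 t^(2/3) - g(t)) / (3 t^(2/3) (g(t) - t^(1/3)))`;
(b) if `g(t) < t^(1/3)` on `I` then `g(t) - t^(1/3)` is strictly decreasing. -/
theorem loewner_distance_monotone (a b : ℝ) (ha : 0 ≤ a) (g : ℝ → ℝ)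
    (hg : ∀ t ∈ Ioo a b, HasDerivAt g (2 / (g t - t ^ ((1 : ℝ)/3))) t) :
    ((∀ t ∈ Ioo a b, t ^ ((1 : ℝ)/3) < g t ∧ g t < t ^ ((1 : ℝ)/3) + 6 * t ^ ((2 : ℝ)/3)) →
      StrictMonoOn (fun t => g t - t ^ ((1 : ℝ)/3)) (Ioo a b) ∧
      ∀ t ∈ Ioo a b,
        HasDerivAt (fun t => g t - t ^ ((1 : ℝ)/3))
          ((t ^ ((1 : ℝ)/3) + 6 * t ^ ((2 : ℝ)/3) - g t) /
            (3 * t ^ ((2 : ℝ)/3) * (g t - t ^ ((1 : ℝ)/3)))) t ∧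
        0 < (t ^ ((1 : ℝ)/3) + 6 * t ^ ((2 : ℝ)/3) - g t) /
            (3 * t ^ ((2 : ℝ)/3) * (g t - t ^ ((1 : ℝ)/3)))) ∧
    ((∀ t ∈ Ioo a b, g t < t ^ ((1 : ℝ)/3)) →
      StrictAntiOn (fun t => g t - t ^ ((1 : ℝ)/3)) (Ioo a b)) := by
  have hpos : ∀ t ∈ Ioo a b, 0 < t := fun t ht => ha.trans_lt ht.1
  refine ⟨fun h => ?_, fun h => ?_⟩
  · have key : ∀ t ∈ Ioo a b,
        HasDerivAt (fun t => g t - t ^ ((1 : ℝ)/3))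
          ((t ^ ((1 : ℝ)/3) + 6 * t ^ ((2 : ℝ)/3) - g t) /
            (3 * t ^ ((2 : ℝ)/3) * (g t - t ^ ((1 : ℝ)/3)))) t ∧
        0 < (t ^ ((1 : ℝ)/3) + 6 * t ^ ((2 : ℝ)/3) - g t) /
            (3 * t ^ ((2 : ℝ)/3) * (g t - t ^ ((1 : ℝ)/3))) := by
      intro t ht
      have hd : 0 < g t - t ^ ((1 : ℝ)/3) := sub_pos.2 (h t ht).1
      have hp : 0 < t ^ ((2 : ℝ)/3) := Real.rpow_pos_of_pos (hpos t ht) _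
      exact ⟨hasDerivAt_sub_cubeRoot (hpos t ht) (hg t ht) hd.ne',
        div_pos (sub_pos.2 (h t ht).2) (by positivity)⟩
    refine ⟨strictMonoOn_of_deriv_pos (convex_Ioo a b)
      (fun t ht => (key t ht).1.continuousAt.continuousWithinAt) fun t ht => ?_, key⟩
    rw [interior_Ioo] at ht
    rw [(key t ht).1.deriv]
    exact (key t ht).2
  · have hd : ∀ t ∈ Ioo a b, g t - t ^ ((1 : ℝ)/3) < 0 := fun t ht => sub_neg.2 (h t ht)
    have key := fun t ht => hasDerivAt_sub_cubeRoot (hpos t ht) (hg t ht) (hd t ht).ne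
    refine strictAntiOn_of_deriv_neg (convex_Ioo a b)
      (fun t ht => (key t ht).continuousAt.continuousWithinAt) fun t ht => ?_
    rw [interior_Ioo] at ht
    rw [(key t ht).deriv]
    have hp : 0 < t ^ ((2 : ℝ)/3) := Real.rpow_pos_of_pos (hpos t ht) _
    exact div_neg_of_pos_of_neg (by linarith [hd t ht])
      (mul_neg_of_pos_of_neg (by positivity) (hd t ht))
end

section
/- For ε > 0 define coefficients a_n(ε) by a_1(ε) = a_2(ε) = 0, a_k(ε) = 6/(k ε^(k-2)) for k = 3, 4, 5, and a_n(ε) = (1/(n ε)) [ (n-1) a_{n-1}(ε) - ∑_{k=3}^{n-3} (n-k) a_{n-k}(ε) a_k(ε) ] for n ≥ 6. Let R(ε) be the radius of convergence of the power series ∑_{n=1}^∞ a_n(ε) τ^n. Then liminf_{ε→0+} R(ε)/ε ≥ 1; that is, for every c ∈ (0,1) there exists ε₀ > 0 such that for all ε ∈ (0,ε₀) and all complex τ with |τ| < c ε, the series ∑_{n=1}^∞ a_n(ε) τ^n converges absolutely. -/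
open Finset

/-- The convolution sums of a nonnegative sequence are dominated by the square of its sum. -/
theorem sum_convolution_le_sq {X : ℕ → ℝ} (hX : ∀ n, 0 ≤ X n) (N : ℕ) :
    ∑ n ∈ Icc 6 (N + 1), ∑ k ∈ Icc 3 (n - 3), X (n - k) * X k ≤ (∑ n ∈ Icc 3 N, X n) ^ 2 := by
  rw [Finset.sum_comm' (t' := Icc 3 (N - 2)) (s' := fun k => Icc (k + 3) (N + 1))
    (by intro n k; simp only [mem_Icc]; omega), sq, Finset.mul_sum]
  calc ∑ k ∈ Icc 3 (N - 2), ∑ n ∈ Icc (k + 3) (N + 1), X (n - k) * X k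
      ≤ ∑ k ∈ Icc 3 (N - 2), (∑ n ∈ Icc 3 N, X n) * X k := by
        refine Finset.sum_le_sum fun k hk => ?_
        rw [← Finset.sum_mul]
        refine mul_le_mul_of_nonneg_right ?_ (hX k)
        have hinj : Set.InjOn (fun n => n - k) (Icc (k + 3) (N + 1) : Finset ℕ) := by
          intro x hx y hy hxy
          simp only [coe_Icc, Set.mem_Icc] at hx hy hxy
          omega
        rw [← Finset.sum_image (f := X) hinj]
        refine Finset.sum_le_sum_of_subset_of_nonneg ?_ fun n _ _ => hX n
        intro m hm
        simp only [mem_image, mem_Icc] at hm hk ⊢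
        omega
    _ ≤ ∑ k ∈ Icc 3 N, (∑ n ∈ Icc 3 N, X n) * X k :=
        Finset.sum_le_sum_of_subset_of_nonneg (Icc_subset_Icc_right (by omega))
          fun k _ _ => mul_nonneg (Finset.sum_nonneg fun n _ => hX n) (hX k)

/-- Partial sums of a nonnegative sequence satisfying a quadratic convolution inequality stay
below any `σ` with `η + c σ + σ² ≤ σ`. -/
theorem sum_le_of_convolution_le {X : ℕ → ℝ} {c η σ : ℝ} (hX : ∀ n, 0 ≤ X n) (hc : 0 ≤ c)
    (hσ : 0 ≤ σ) (hησ : η + c * σ + σ ^ 2 ≤ σ) (hη : ∑ n ∈ Icc 3 5, X n ≤ η)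
    (hrec : ∀ n, 6 ≤ n → X n ≤ c * X (n - 1) + ∑ k ∈ Icc 3 (n - 3), X (n - k) * X k) (N : ℕ) :
    ∑ n ∈ Icc 3 N, X n ≤ σ := by
  induction N with
  | zero => simpa using hσ
  | succ N ih =>
    rcases Nat.lt_or_ge N 5 with hN | hN
    · have hsub : ∑ n ∈ Icc 3 (N + 1), X n ≤ ∑ n ∈ Icc 3 5, X n :=
        Finset.sum_le_sum_of_subset_of_nonneg (Icc_subset_Icc_right (by omega)) fun n _ _ => hX n
      nlinarith [mul_nonneg hc hσ]
    · have hsplit : Icc 3 (N + 1) = Icc 3 5 ∪ Icc 6 (N + 1) := by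
        ext m; simp only [mem_union, mem_Icc]; omega
      have hdisj : Disjoint (Icc 3 5) (Icc 6 (N + 1)) := by
        rw [Finset.disjoint_left]; intro m; simp only [mem_Icc]; omega
      have hshift : ∑ n ∈ Icc 6 (N + 1), X (n - 1) ≤ ∑ n ∈ Icc 3 N, X n := by
        have hinj : Set.InjOn (fun n => n - 1) (Icc 6 (N + 1) : Finset ℕ) := by
          intro x hx y hy hxy
          simp only [coe_Icc, Set.mem_Icc] at hx hy hxy
          omega
        rw [← Finset.sum_image (f := X) hinj]
        refine Finset.sum_le_sum_of_subset_of_nonneg ?_ fun n _ _ => hX n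
        intro m hm
        simp only [mem_image, mem_Icc] at hm ⊢
        omega
      have htail : ∑ n ∈ Icc 6 (N + 1), X n ≤ c * σ + σ ^ 2 :=
        calc ∑ n ∈ Icc 6 (N + 1), X n
            ≤ ∑ n ∈ Icc 6 (N + 1), (c * X (n - 1) + ∑ k ∈ Icc 3 (n - 3), X (n - k) * X k) :=
              Finset.sum_le_sum fun n hn => hrec n (mem_Icc.mp hn).1
          _ = c * ∑ n ∈ Icc 6 (N + 1), X (n - 1) +
                ∑ n ∈ Icc 6 (N + 1), ∑ k ∈ Icc 3 (n - 3), X (n - k) * X k := by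
              rw [Finset.sum_add_distrib, Finset.mul_sum]
          _ ≤ c * σ + σ ^ 2 :=
              add_le_add (mul_le_mul_of_nonneg_left (hshift.trans ih) hc)
                ((sum_convolution_le_sq hX N).trans
                  (pow_le_pow_left₀ (Finset.sum_nonneg fun n _ => hX n) ih 2))
      rw [hsplit, Finset.sum_union hdisj]
      linarith

/-- A nonnegative sequence with bounded partial sums from index `3` on is summable. -/
theorem summable_of_sum_Icc_three_le {X : ℕ → ℝ} {σ : ℝ} (hX : ∀ n, 0 ≤ X n)
    (h : ∀ N, ∑ n ∈ Icc 3 N, X n ≤ σ) : Summable X := by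
  rw [← summable_nat_add_iff 3]
  refine summable_of_sum_range_le (c := σ) (fun n => hX _) fun N => ?_
  rw [← Finset.sum_image (f := X) (g := fun n => n + 3) (add_left_injective 3).injOn]
  refine (Finset.sum_le_sum_of_subset_of_nonneg ?_ fun n _ _ => hX n).trans (h (N + 3))
  intro m hm
  simp only [mem_image, mem_range, mem_Icc] at hm ⊢
  omega

/-- The recurrence for the coefficients, rescaled to `|b n| * c ^ n * ε ^ (n - 1)`. -/
theorem rescaled_recurrence_le {b : ℕ → ℝ} {c ε : ℝ} (hc : 0 < c) (hε : 0 < ε) {n : ℕ}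
    (hn : 6 ≤ n)
    (hrec : b n = (1 / (n * ε)) * ((n - 1 : ℝ) * b (n - 1) -
      ∑ k ∈ Icc 3 (n - 3), ((n - k : ℕ) : ℝ) * b (n - k) * b k)) :
    |b n| * c ^ n * ε ^ (n - 1) ≤ c * (|b (n - 1)| * c ^ (n - 1) * ε ^ (n - 1 - 1)) +
      ∑ k ∈ Icc 3 (n - 3),
        |b (n - k)| * c ^ (n - k) * ε ^ (n - k - 1) * (|b k| * c ^ k * ε ^ (k - 1)) := by
  have hn0 : (0 : ℝ) < n := by positivity
  have hn1 : (1 : ℝ) ≤ n := by exact_mod_cast (by omega : 1 ≤ n)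
  have hsum : |∑ k ∈ Icc 3 (n - 3), ((n - k : ℕ) : ℝ) * b (n - k) * b k| ≤
      n * ∑ k ∈ Icc 3 (n - 3), |b (n - k)| * |b k| := by
    rw [Finset.mul_sum]
    refine (Finset.abs_sum_le_sum_abs _ _).trans (Finset.sum_le_sum fun k _ => ?_)
    rw [abs_mul, abs_mul, Nat.abs_cast, mul_assoc]
    exact mul_le_mul_of_nonneg_right (by exact_mod_cast Nat.sub_le n k) (by positivity)
  have hmain : |b n| * ε ≤ |b (n - 1)| + ∑ k ∈ Icc 3 (n - 3), |b (n - k)| * |b k| := by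
    have hlead : |(n - 1 : ℝ) * b (n - 1)| ≤ n * |b (n - 1)| := by
      rw [abs_mul, abs_of_nonneg (by linarith)]
      exact mul_le_mul_of_nonneg_right (by linarith) (abs_nonneg _)
    have heq : n * (b n * ε) = (n - 1 : ℝ) * b (n - 1) -
        ∑ k ∈ Icc 3 (n - 3), ((n - k : ℕ) : ℝ) * b (n - k) * b k := by
      rw [hrec]; field_simp
    refine le_of_mul_le_mul_left ?_ hn0
    calc n * (|b n| * ε) = |n * (b n * ε)| := by
          rw [abs_mul, abs_mul, Nat.abs_cast, abs_of_pos hε]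
      _ ≤ _ := by
          rw [heq, mul_add]
          exact (abs_sub _ _).trans (add_le_add hlead hsum)
  calc |b n| * c ^ n * ε ^ (n - 1) = |b n| * ε * (c ^ n * ε ^ (n - 2)) := by
        rw [show n - 1 = n - 2 + 1 by omega, pow_succ]; ring
    _ ≤ (|b (n - 1)| + ∑ k ∈ Icc 3 (n - 3), |b (n - k)| * |b k|) * (c ^ n * ε ^ (n - 2)) :=
        mul_le_mul_of_nonneg_right hmain (by positivity)
    _ = _ := by
        rw [add_mul, Finset.sum_mul]
        congr 1
        · rw [show n - 1 - 1 = n - 2 by omega, show c ^ n = c ^ (n - 1) * c by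
            rw [← pow_succ]; congr 1; omega]
          ring
        · refine Finset.sum_congr rfl fun k hk => ?_
          rw [mem_Icc] at hk
          rw [show c ^ n = c ^ (n - k) * c ^ k by rw [← pow_add]; congr 1; omega,
            show ε ^ (n - 2) = ε ^ (n - k - 1) * ε ^ (k - 1) by rw [← pow_add]; congr 1; omega]
          ring

/-- The rescaled initial coefficients are at most `2 ε`. -/
theorem rescaled_initial_le {b : ℕ → ℝ} {c ε : ℝ} (hc : 0 < c) (hc1 : c ≤ 1) (hε : 0 < ε) {k : ℕ}
    (hk : 3 ≤ k) (hb : b k = 6 / (k * ε ^ (k - 2))) :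
    |b k| * c ^ k * ε ^ (k - 1) ≤ 2 * ε := by
  have hk3 : (3 : ℝ) ≤ k := by exact_mod_cast hk
  have hbk : |b k| * ε ^ (k - 1) = 6 / k * ε := by
    rw [hb, abs_of_nonneg (by positivity), show k - 1 = k - 2 + 1 by omega, pow_succ]
    field_simp
  calc |b k| * c ^ k * ε ^ (k - 1) = 6 / k * ε * c ^ k := by rw [← hbk]; ring
    _ ≤ 6 / k * ε := mul_le_of_le_one_right (by positivity) (pow_le_one₀ hc.le hc1)
    _ ≤ 2 * ε := by
        refine mul_le_mul_of_nonneg_right ?_ hε.le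
        rw [div_le_iff₀ (by linarith)]; linarith

/-- Theorem 3: the radius of convergence `R(ε)` of the power series `∑ a_n(ε) τ^n`
representing the holomorphic solution of the Löwner equation starting at `ε > 0` satisfies
`liminf R(ε)/ε ≥ 1` as `ε → 0+`: for every `c ∈ (0,1)` there is `ε₀ > 0` such that for all
`ε ∈ (0,ε₀)` the series converges absolutely whenever `|τ| < c ε`. -/
theorem loewner_holomorphic_solution_radius (a : ℝ → ℕ → ℝ)
    (h1 : ∀ ε : ℝ, 0 < ε → a ε 1 = 0)
    (h2 : ∀ ε : ℝ, 0 < ε → a ε 2 = 0)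
    (h345 : ∀ ε : ℝ, 0 < ε → ∀ k, 3 ≤ k → k ≤ 5 → a ε k = 6 / (k * ε ^ (k - 2)))
    (hrec : ∀ ε : ℝ, 0 < ε → ∀ n, 6 ≤ n →
      a ε n = (1 / (n * ε)) *
        ((n - 1 : ℝ) * a ε (n - 1) -
          ∑ k ∈ Finset.Icc 3 (n - 3), ((n - k : ℕ) : ℝ) * a ε (n - k) * a ε k)) :
    ∀ c : ℝ, 0 < c → c < 1 → ∃ ε₀ : ℝ, 0 < ε₀ ∧
      ∀ ε : ℝ, 0 < ε → ε < ε₀ →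
        ∀ τ : ℂ, ‖τ‖ < c * ε →
          Summable (fun n : ℕ => ‖((a ε n : ℝ) : ℂ) * τ ^ n‖) := by
  intro c hc hc1
  refine ⟨(1 - c) ^ 2 / 24, by have := sub_pos.mpr hc1; positivity, fun ε hε hε0 τ hτ => ?_⟩
  set X : ℕ → ℝ := fun n => |a ε n| * c ^ n * ε ^ (n - 1) with hXdef
  have hX : ∀ n, 0 ≤ X n := fun n => by positivity
  have hinit : ∑ n ∈ Icc 3 5, X n ≤ 6 * ε := by
    have hle : ∑ n ∈ Icc 3 5, X n ≤ ∑ _n ∈ Icc 3 5, 2 * ε := Finset.sum_le_sum fun k hk =>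
      rescaled_initial_le hc hc1.le hε (mem_Icc.mp hk).1
        (h345 ε hε k (mem_Icc.mp hk).1 (mem_Icc.mp hk).2)
    refine hle.trans_eq ?_
    rw [Finset.sum_const, Nat.card_Icc, nsmul_eq_mul]
    norm_num
    ring
  have hsum : Summable X := summable_of_sum_Icc_three_le hX <|
    sum_le_of_convolution_le (σ := (1 - c) / 2) hX hc.le (by linarith) (by nlinarith) hinit
      fun n hn => rescaled_recurrence_le hc hε hn (hrec ε hε n hn)
  rw [← summable_nat_add_iff 1]
  refine Summable.of_nonneg_of_le (fun n => norm_nonneg _) (fun n => ?_)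
    (((summable_nat_add_iff 1).mpr hsum).mul_left ε)
  rw [norm_mul, norm_pow, Complex.norm_real, Real.norm_eq_abs]
  calc |a ε (n + 1)| * ‖τ‖ ^ (n + 1) ≤ |a ε (n + 1)| * (c * ε) ^ (n + 1) := by gcongr
    _ = ε * X (n + 1) := by
        simp only [hXdef, Nat.add_sub_cancel]
        ring
end

section
/- Let ε₀ > 0 and let c : (0,ε₀) → (0,1) be a function such that for every ε ∈ (0,ε₀), 1 - exp( -(1 - c(ε))² / (48 ε c(ε)³) ) · (1 + (1 - c(ε))(3 - c(ε)) / (48 ε c(ε)³)) = 0. Then c(ε) → 1 as ε → 0+, and moreover (1 - c(ε))² / ε → ∞ as ε → 0+. -/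
open Set Filter

/-- A positive solution `u` of `exp u = 1 + u * (1 + 2 / s)` satisfies `s * u ≤ 4`. -/
lemma mul_le_four_of_exp_eq {s u : ℝ} (hs : 0 < s) (hu : 0 < u)
    (h : Real.exp u = 1 + u * (1 + 2 / s)) : s * u ≤ 4 := by
  have hquad := Real.quadratic_le_exp_of_nonneg hu.le
  have hle : u * u ≤ u * (4 / s) := by
    have : u * (4 / s) = 2 * (u * (2 / s)) := by ring
    nlinarith
  have hle' := le_of_mul_le_mul_left hle hu
  rw [le_div_iff₀ hs] at hle'
  linarith

/-- A positive solution `u` of `exp u = 1 + u * (1 + 2 / s)` satisfies `log (2 / s) ≤ u`. -/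
lemma log_two_div_le_of_exp_eq {s u : ℝ} (hs : 0 < s) (hu : 0 < u)
    (h : Real.exp u = 1 + u * (1 + 2 / s)) : Real.log (2 / s) ≤ u := by
  have hneg := Real.add_one_le_exp (-u)
  have hone : Real.exp (-u) * Real.exp u = 1 := by rw [← Real.exp_add]; simp
  have hle : u * (1 + 2 / s) ≤ u * Real.exp u := by
    nlinarith [Real.exp_pos u]
  have hle' := le_of_mul_le_mul_left hle hu
  rw [Real.log_le_iff_le_exp (by positivity)]
  linarith

/-- If `c(ε) ∈ (0,1)` satisfies the critical-point equation (der) for every small `ε > 0`,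
then `c(ε) → 1` as `ε → 0+`, and moreover `(1 - c(ε))²/ε → ∞` as `ε → 0+`. -/
theorem loewner_critical_point_asymptotics (ε₀ : ℝ) (hε₀ : 0 < ε₀) (c : ℝ → ℝ)
    (hc : ∀ ε ∈ Ioo (0 : ℝ) ε₀, c ε ∈ Ioo (0 : ℝ) 1)
    (heq : ∀ ε ∈ Ioo (0 : ℝ) ε₀,
      1 - Real.exp (-(1 - c ε) ^ 2 / (48 * ε * (c ε) ^ 3)) *
        (1 + (1 - c ε) * (3 - c ε) / (48 * ε * (c ε) ^ 3)) = 0) :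
    Tendsto c (nhdsWithin 0 (Ioi 0)) (nhds 1) ∧
    Tendsto (fun ε => (1 - c ε) ^ 2 / ε) (nhdsWithin 0 (Ioi 0)) atTop := by
  let u : ℝ → ℝ := fun ε => (1 - c ε) ^ 2 / (48 * ε * (c ε) ^ 3)
  have hmem : ∀ᶠ ε in nhdsWithin (0 : ℝ) (Ioi 0), ε ∈ Ioo (0 : ℝ) ε₀ := Ioo_mem_nhdsGT hε₀
  have hu : ∀ ε ∈ Ioo (0 : ℝ) ε₀, 0 < u ε := by
    intro ε hε
    have h0 := (hc ε hε).1
    have h1 : 0 < 1 - c ε := sub_pos.2 (hc ε hε).2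
    have h2 := hε.1
    positivity
  have hexp : ∀ ε ∈ Ioo (0 : ℝ) ε₀, Real.exp (u ε) = 1 + u ε * (1 + 2 / (1 - c ε)) := by
    intro ε hε
    have h0 := (hc ε hε).1
    have h1 : 0 < 1 - c ε := sub_pos.2 (hc ε hε).2
    have h2 := hε.1
    have h := heq ε hε
    have hfac : (1 - c ε) * (3 - c ε) / (48 * ε * (c ε) ^ 3) =
        u ε * (1 + 2 / (1 - c ε)) := by
      simp only [u]
      field_simp
      ring
    rw [hfac, neg_div, Real.exp_neg] at h
    change 1 - (Real.exp (u ε))⁻¹ * _ = 0 at h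
    have hpos := Real.exp_pos (u ε)
    field_simp at h ⊢
    linarith
  have hcube : ∀ ε ∈ Ioo (0 : ℝ) ε₀, (1 - c ε) ^ 3 ≤ 192 * ε := by
    intro ε hε
    have h0 := (hc ε hε).1
    have h1 : 0 < 1 - c ε := sub_pos.2 (hc ε hε).2
    have h2 := hε.1
    have h := mul_le_four_of_exp_eq h1 (hu ε hε) (hexp ε hε)
    simp only [u] at h
    rw [← mul_div_assoc, div_le_iff₀ (by positivity)] at h
    have h3 : c ε ^ 3 ≤ 1 := pow_le_one₀ h0.le (hc ε hε).2.le
    nlinarith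
  have hlim : Tendsto (fun ε => 1 - c ε) (nhdsWithin 0 (Ioi 0)) (nhdsWithin 0 (Ioi 0)) := by
    refine tendsto_nhdsWithin_iff.2 ⟨?_, hmem.mono fun ε hε => sub_pos.2 (hc ε hε).2⟩
    refine tendsto_order.2 ⟨fun a ha => hmem.mono fun ε hε =>
      ha.trans (sub_pos.2 (hc ε hε).2), fun δ hδ => ?_⟩
    have hsmall : Ioo (0 : ℝ) (δ ^ 3 / 192) ∈ nhdsWithin (0 : ℝ) (Ioi 0) :=
      Ioo_mem_nhdsGT (by positivity)
    filter_upwards [hmem, hsmall] with ε hε hεδ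
    refine lt_of_pow_lt_pow_left₀ 3 hδ.le ?_
    linarith [hcube ε hε, hεδ.2]
  have hc1 : Tendsto c (nhdsWithin 0 (Ioi 0)) (nhds 1) := by
    simpa using (tendsto_nhds_of_tendsto_nhdsWithin hlim).const_sub 1
  refine ⟨hc1, ?_⟩
  have hu_top : Tendsto u (nhdsWithin 0 (Ioi 0)) atTop := by
    refine tendsto_atTop_mono' _ (hmem.mono fun ε hε =>
      log_two_div_le_of_exp_eq (sub_pos.2 (hc ε hε).2) (hu ε hε) (hexp ε hε)) ?_
    simp only [div_eq_mul_inv]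
    exact Real.tendsto_log_atTop.comp
      ((tendsto_inv_nhdsGT_zero.comp hlim).const_mul_atTop two_pos)
  have hcoef : Tendsto (fun ε => 48 * c ε ^ 3) (nhdsWithin 0 (Ioi 0)) (nhds (48 * 1 ^ 3)) :=
    (hc1.pow 3).const_mul 48
  refine (hcoef.pos_mul_atTop (by norm_num) hu_top).congr' (hmem.mono fun ε hε => ?_)
  have h0 := (hc ε hε).1
  have h2 := hε.1
  simp only [u]
  field_simp
end
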